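/- Let H be a bipartite graph of order h. There exist integers n_0 and c_2(H) < 8h² such that every balanced bipartite graph G with n ≥ n_0 vertices in each partition set and δ(G) ≥ (1 − 1/χ_cr(H))n contains an H-tiling that covers all but at most c_2(H) vertices of G. -/

import Mathlib

open Finset

attribute [local instance] Classical.propDecidable

namespace BipTiling

variable {α β V : Type*}

/-- A proper 2-coloring of the graph `H`. -/
def Proper2Coloring (H : SimpleGraph α) (c : α → Bool) : Prop :=
  ∀ ⦃a b : α⦄, H.Adj a b → c a ≠ c b

/-- `H` is bipartite, i.e. it admits a proper 2-coloring. -/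
def IsBip (H : SimpleGraph α) : Prop :=
  ∃ c : α → Bool, Proper2Coloring H c

/-- The size of the color class of color `i` under the 2-coloring `c`. -/
noncomputable def colorCard [Fintype α] (c : α → Bool) (i : Bool) : ℕ :=
  (Finset.univ.filter fun v => c v = i).card

/-- `σ(H)`: the smallest size of a color class over all proper 2-colorings of `H`. -/
noncomputable def sigmaBip [Fintype α] (H : SimpleGraph α) : ℕ :=
  sInf {k | ∃ c : α → Bool, Proper2Coloring H c ∧
    k = min (colorCard c true) (colorCard c false)}

/-- The finset of connected components of `H`. -/
noncomputable def comps [Fintype α] (H : SimpleGraph α) : Finset H.ConnectedComponent :=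
  Finset.univ.image H.connectedComponentMk

/-- `c_i`: the number of vertices of the connected component `K`. -/
noncomputable def compCard [Fintype α] (H : SimpleGraph α) (K : H.ConnectedComponent) : ℕ :=
  (Finset.univ.filter fun v => H.connectedComponentMk v = K).card

/-- `d_i = |W_i| - |U_i|`: the (absolute) difference of the sizes of the two color classes
of the component `K`, computed with respect to a proper 2-coloring `c` of `H`.
(For a proper 2-coloring this is independent of the choice of `c`, since the 2-coloring of a
connected bipartite graph is unique up to swapping the colors.) -/
noncomputable def compDiff [Fintype α] (H : SimpleGraph α) (c : α → Bool)
    (K : H.ConnectedComponent) : ℕ :=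
  (((Finset.univ.filter fun v => H.connectedComponentMk v = K ∧ c v = true).card : ℤ) -
    ((Finset.univ.filter fun v => H.connectedComponentMk v = K ∧ c v = false).card : ℤ)).natAbs

/-- `hcf_c(H) = gcd(c_1, …, c_k)`. -/
noncomputable def hcfC [Fintype α] (H : SimpleGraph α) : ℕ :=
  (comps H).gcd (compCard H)

/-- `hcf_{χ,c}(H) = gcd(d_1, …, d_k)`, with respect to a proper 2-coloring `c`. -/
noncomputable def hcfChiC [Fintype α] (H : SimpleGraph α) (c : α → Bool) : ℕ :=
  (comps H).gcd (compDiff H c)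

/-- `x_2 - x_1` for the 2-coloring `c`, where `x_1 ≤ x_2` are the sizes of its color classes. -/
noncomputable def colorDiff [Fintype α] (c : α → Bool) : ℕ :=
  ((colorCard c true : ℤ) - (colorCard c false : ℤ)).natAbs

/-- `hcf_χ(H)`: the gcd of the set `D(H)` of all differences `x_2 - x_1` of color class sizes
over all proper 2-colorings of `H` (`0` represents `∞`, i.e. `D(H) = {0}`). -/
noncomputable def hcfChi [Fintype α] (H : SimpleGraph α) : ℕ :=
  (Finset.univ.filter fun c : α → Bool => Proper2Coloring H c).gcd colorDiff

/-- `hcf(H) = 1` for a bipartite graph `H`: `hcf_c(H) = 1` and `hcf_χ(H) ≤ 2`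
(in particular `hcf_χ(H)` is finite, i.e. nonzero in our encoding). -/
def HcfOne [Fintype α] (H : SimpleGraph α) : Prop :=
  hcfC H = 1 ∧ 0 < hcfChi H ∧ hcfChi H ≤ 2

/-- `f` is a copy of `H` inside `G` (an injective graph homomorphism). -/
def IsCopy (H : SimpleGraph α) (G : SimpleGraph β) (f : α → β) : Prop :=
  Function.Injective f ∧ ∀ ⦃a b : α⦄, H.Adj a b → G.Adj (f a) (f b)

/-- `s` is an `H`-tiling of `G`: a finite collection of pairwise vertex-disjoint copies of `H`. -/
def IsHTiling (H : SimpleGraph α) (G : SimpleGraph β) (s : Finset (α → β)) : Prop :=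
  (∀ f ∈ s, IsCopy H G f) ∧
    ∀ f ∈ s, ∀ g ∈ s, f ≠ g → ∀ a b : α, f a ≠ g b

/-- The set of vertices covered by the tiling `s`. -/
noncomputable def coveredSet [Fintype α] [Fintype β] (s : Finset (α → β)) : Finset β :=
  s.biUnion fun f => Finset.univ.image f

/-- `G` has a perfect `H`-tiling (`H`-factor). -/
def HasHFactor [Fintype α] [Fintype β] (H : SimpleGraph α) (G : SimpleGraph β) : Prop :=
  ∃ s : Finset (α → β), IsHTiling H G s ∧ coveredSet s = Finset.univ

/-- `G` has an `H`-tiling covering all but at most `t` vertices. -/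
def HasHTilingMissingAtMost [Fintype α] [Fintype β] (H : SimpleGraph α) (G : SimpleGraph β)
    (t : ℕ) : Prop :=
  ∃ s : Finset (α → β), IsHTiling H G s ∧ (Finset.univ \ coveredSet s).card ≤ t

/-- `G` is a bipartite graph with partition sets `X` and `Y`, written `G[X,Y]`. -/
structure BipartiteWith [Fintype V] (G : SimpleGraph V) (X Y : Finset V) : Prop where
  disj : Disjoint X Y
  cover : X ∪ Y = Finset.univ
  cross : ∀ ⦃a b : V⦄, G.Adj a b → (a ∈ X ∧ b ∈ Y) ∨ (a ∈ Y ∧ b ∈ X)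

/-- `e(A,B)`: the number of edges of `G` between `A` and `B`. -/
noncomputable def eAB (G : SimpleGraph V) (A B : Finset V) : ℕ :=
  ((A ×ˢ B).filter fun p => G.Adj p.1 p.2).card

/-- The density `d(A,B) = e(A,B)/(|A||B|)`. -/
noncomputable def dens (G : SimpleGraph V) (A B : Finset V) : ℝ :=
  (eAB G A B : ℝ) / ((A.card : ℝ) * (B.card : ℝ))

/-- `|Γ(x) ∩ B|`: the number of neighbors of `x` in `B`. -/
noncomputable def degIn (G : SimpleGraph V) (x : V) (B : Finset V) : ℕ :=
  (B.filter fun y => G.Adj x y).card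

/-- The pair `(X,Y)` is `ε`-regular in `G`. -/
def EpsRegularPair (G : SimpleGraph V) (X Y : Finset V) (ε : ℝ) : Prop :=
  ∀ A ⊆ X, ∀ B ⊆ Y, ε * X.card < A.card → ε * Y.card < B.card →
    |dens G A B - dens G X Y| < ε

/-- The pair `(X,Y)` is `(ε,δ)`-super-regular in `G`. -/
def SuperRegularPair (G : SimpleGraph V) (X Y : Finset V) (ε δ : ℝ) : Prop :=
  EpsRegularPair G X Y ε ∧
    (∀ x ∈ X, δ * Y.card < (degIn G x Y : ℝ)) ∧
    (∀ y ∈ Y, δ * X.card < (degIn G y X : ℝ))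

/-- `G[X,Y]` has an almost `(ε,d,p,q,N)`-cover. -/
def HasAlmostCover [Fintype V] (G : SimpleGraph V) (X Y : Finset V) (ε d : ℝ) (p q N : ℕ) :
    Prop :=
  ∃ (X₀ Y₀ : Finset V) (k : ℕ) (P Q : Fin k → Finset V),
    X₀ ⊆ X ∧ Y₀ ⊆ Y ∧
    (X₀.card : ℝ) ≤ ε * X.card ∧ (Y₀.card : ℝ) ≤ ε * Y.card ∧
    ((X₀ ∪ Y₀) ∪ Finset.univ.biUnion fun i => P i ∪ Q i) = Finset.univ ∧
    (∀ i, Disjoint (X₀ ∪ Y₀) (P i ∪ Q i)) ∧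
    (∀ i j, i ≠ j → Disjoint (P i ∪ Q i) (P j ∪ Q j)) ∧
    (∀ i, Disjoint (P i) (Q i)) ∧
    (∀ i, SuperRegularPair G (P i) (Q i) ε d) ∧
    (∀ i, (P i ⊆ X ∧ Q i ⊆ Y) ∨ (P i ⊆ Y ∧ Q i ⊆ X)) ∧
    (∀ i, q * (P i).card = p * (Q i).card ∧ N * p ≤ (P i).card)

/-- `G[X,Y]` (with `|X| = |Y| = n`) is in the extremal case with parameter `a`:
there are `A ⊆ X`, `B ⊆ Y` with `|A| = |B| = ⌊wn/h⌋` and `d(A,B) ≤ a`. -/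
def ExtremalWith [Fintype V] (G : SimpleGraph V) (X Y : Finset V) (w h : ℕ) (a : ℝ) : Prop :=
  ∃ A ⊆ X, ∃ B ⊆ Y, A.card = w * X.card / h ∧ B.card = w * X.card / h ∧ dens G A B ≤ a

section Tiling

/-- `P` and `Q` are completely joined in `G`. -/
def Joined (G : SimpleGraph V) (P Q : Finset V) : Prop :=
  ∀ x ∈ P, ∀ y ∈ Q, G.Adj x y

lemma Joined.symm {G : SimpleGraph V} {P Q : Finset V} (h : Joined G P Q) : Joined G Q P :=
  fun x hx y hy => (h y hy x hx).symm

lemma Joined.mono {G : SimpleGraph V} {P Q P' Q' : Finset V} (h : Joined G P Q)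
    (hP : P' ⊆ P) (hQ : Q' ⊆ Q) : Joined G P' Q' :=
  fun x hx y hy => h x (hP hx) y (hQ hy)

/-- `S` is a disjoint union of complete bipartite graphs `K_{u,w}` of `G`, each of which has one
side in `X` and the other in `Y`. -/
inductive Tiled (G : SimpleGraph V) (X Y : Finset V) (u w : ℕ) : Finset V → Prop
  | nil : Tiled G X Y u w ∅
  | cons (P Q A : Finset V) : P ⊆ X → Q ⊆ Y →
      (P.card = u ∧ Q.card = w ∨ P.card = w ∧ Q.card = u) → Joined G P Q →
      Disjoint (P ∪ Q) A → Tiled G X Y u w A → Tiled G X Y u w (P ∪ Q ∪ A)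

variable {G : SimpleGraph V} {X Y : Finset V} {u w : ℕ}

lemma Tiled.single {P Q : Finset V} (hP : P ⊆ X) (hQ : Q ⊆ Y)
    (hc : P.card = u ∧ Q.card = w ∨ P.card = w ∧ Q.card = u) (hJ : Joined G P Q) :
    Tiled G X Y u w (P ∪ Q) := by
  simpa using Tiled.cons P Q ∅ hP hQ hc hJ (by simp) Tiled.nil

lemma Tiled.subset {S : Finset V} (h : Tiled G X Y u w S) : S ⊆ X ∪ Y := by
  induction h with
  | nil => simp
  | cons P Q A hP hQ _ _ _ _ ih =>
    exact union_subset (union_subset_union hP hQ) ih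

lemma Tiled.symm {S : Finset V} (h : Tiled G X Y u w S) : Tiled G Y X u w S := by
  induction h with
  | nil => exact Tiled.nil
  | cons P Q A hP hQ hc hJ hd _ ih =>
    rw [union_comm P Q] at hd ⊢
    exact Tiled.cons Q P A hQ hP (by tauto) hJ.symm hd ih

lemma Tiled.union {S S' : Finset V} (h : Tiled G X Y u w S) (h' : Tiled G X Y u w S')
    (hd : Disjoint S S') : Tiled G X Y u w (S ∪ S') := by
  induction h with
  | nil => simpa using h'
  | cons P Q A hP hQ hc hJ hPA _ ih =>
    rw [disjoint_union_left] at hd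
    rw [union_assoc]
    exact Tiled.cons P Q _ hP hQ hc hJ (disjoint_union_right.2 ⟨hPA, hd.1⟩) (ih hd.2)

/-- A complete bipartite graph with sides `au + bw` and `aw + bu` is tiled by `K_{u,w}`. -/
lemma tiled_of_joined (hXY : Disjoint X Y) {P Q : Finset V} (hP : P ⊆ X) (hQ : Q ⊆ Y)
    (hJ : Joined G P Q) (a b : ℕ) (hcP : P.card = a * u + b * w)
    (hcQ : Q.card = a * w + b * u) : Tiled G X Y u w (P ∪ Q) := by
  have key : ∀ (k : ℕ) (p q p' q' : ℕ) (P Q : Finset V), P ⊆ X → Q ⊆ Y → Joined G P Q →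
      (p = u ∧ q = w ∨ p = w ∧ q = u) → P.card = k * p + p' → Q.card = k * q + q' →
      (∀ P' Q' : Finset V, P' ⊆ P → Q' ⊆ Q → P'.card = p' → Q'.card = q' →
        Tiled G X Y u w (P' ∪ Q')) → Tiled G X Y u w (P ∪ Q) := by
    intro k p q p' q'
    induction k with
    | zero =>
      intro P Q hP hQ hJ _ h1 h2 h
      exact h P Q subset_rfl subset_rfl (by simpa using h1) (by simpa using h2)
    | succ k ih =>
      intro P Q hP hQ hJ hpq h1 h2 h
      rw [Nat.succ_mul] at h1 h2
      obtain ⟨P1, hP1, hcP1⟩ := exists_subset_card_eq (s := P) (n := p) (by omega)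
      obtain ⟨Q1, hQ1, hcQ1⟩ := exists_subset_card_eq (s := Q) (n := q) (by omega)
      have e : P ∪ Q = P1 ∪ Q1 ∪ (P \ P1 ∪ Q \ Q1) := by
        ext v
        have := @hP1 v
        have := @hQ1 v
        simp only [mem_union, mem_sdiff]
        tauto
      rw [e]
      refine Tiled.cons _ _ _ (hP1.trans hP) (hQ1.trans hQ) (by rw [hcP1, hcQ1]; exact hpq)
        (hJ.mono hP1 hQ1) ?_ (ih _ _ (sdiff_subset.trans hP) (sdiff_subset.trans hQ)
          (hJ.mono sdiff_subset sdiff_subset) hpq ?_ ?_ ?_)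
      · rw [disjoint_left] at hXY ⊢
        intro v hv
        have := @hP1 v
        have := @hQ1 v
        have := @hP v
        have := @hQ v
        have := @hXY v
        simp only [mem_union, mem_sdiff] at hv ⊢
        tauto
      · rw [card_sdiff_of_subset hP1]; omega
      · rw [card_sdiff_of_subset hQ1]; omega
      · exact fun P' Q' hP' hQ' => h P' Q' (hP'.trans sdiff_subset) (hQ'.trans sdiff_subset)
  refine key a u w (b * w) (b * u) P Q hP hQ hJ (Or.inl ⟨rfl, rfl⟩) hcP hcQ ?_
  intro P' Q' hP' hQ' h1 h2
  refine key b w u 0 0 P' Q' (hP'.trans hP) (hQ'.trans hQ) (hJ.mono hP' hQ') (Or.inr ⟨rfl, rfl⟩)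
    (by simpa using h1) (by simpa using h2) ?_
  intro P'' Q'' _ _ h3 h4
  rw [card_eq_zero] at h3 h4
  subst h3 h4
  simpa using Tiled.nil

/-- Arithmetic: sizes of a maximal `K_{u,w}`-tiling of a complete bipartite graph. -/
lemma exists_tile_counts {p q : ℕ} (hu : 1 ≤ u) (huw : u ≤ w) (h1 : u * q ≤ w * p)
    (h2 : u * p ≤ w * q) : ∃ a b : ℕ, a * u + b * w ≤ p ∧ a * w + b * u ≤ q ∧
      p + q + 1 ≤ (a * u + b * w) + (a * w + b * u) + 2 * (u + w) := by
  rcases huw.eq_or_lt with rfl | huw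
  · have hpq : p = q := le_antisymm (Nat.le_of_mul_le_mul_left h2 hu)
      (Nat.le_of_mul_le_mul_left h1 hu)
    subst hpq
    have := Nat.div_add_mod' p u
    have := Nat.mod_lt p hu
    exact ⟨p / u, 0, by omega, by omega, by omega⟩
  obtain ⟨m, hm⟩ := Nat.exists_eq_add_of_le (Nat.mul_le_mul huw.le huw.le)
  have hm0 : 0 < m := by nlinarith
  obtain ⟨D, hD⟩ := Nat.exists_eq_add_of_le h1
  have hd := Nat.div_add_mod D m
  have hr := Nat.mod_lt D hm0
  set b := D / m
  set r := D % m
  have hwb : w * b ≤ p := by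
    by_contra! hcon
    have h3 : m * p < m * (w * b) := Nat.mul_lt_mul_of_pos_left hcon hm0
    nlinarith
  have hub : u * b ≤ q := by
    by_contra! hcon
    have h3 : m * q < m * (u * b) := Nat.mul_lt_mul_of_pos_left hcon hm0
    nlinarith
  obtain ⟨p', hp'⟩ := Nat.exists_eq_add_of_le hwb
  obtain ⟨q', hq'⟩ := Nat.exists_eq_add_of_le hub
  have hpq' : w * p' = u * q' + r := by
    subst hp' hq'
    nlinarith
  have hq := Nat.div_add_mod q' w
  have hs := Nat.mod_lt q' (by omega : w > 0)
  set a := q' / w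
  set s := q' % w
  have hua : u * a ≤ p' := by
    by_contra! hcon
    have h3 : w * p' < w * (u * a) := Nat.mul_lt_mul_of_pos_left hcon (by omega)
    nlinarith
  obtain ⟨t, ht⟩ := Nat.exists_eq_add_of_le hua
  have hwt : w * t = u * s + r := by
    subst ht
    rw [← hq] at hpq'
    nlinarith
  have htl : t < w + u := by
    by_contra! hcon
    have h3 : w * (w + u) ≤ w * t := Nat.mul_le_mul_left _ hcon
    nlinarith
  have e1 : u * a = a * u := mul_comm _ _
  have e2 : w * a = a * w := mul_comm _ _
  have e3 : u * b = b * u := mul_comm _ _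
  have e4 : w * b = b * w := mul_comm _ _
  exact ⟨a, b, by omega, by omega, by omega⟩

/-- A complete pair with nearly admissible ratio is tiled up to `2 (u + w) - 1` vertices. -/
lemma exists_tiled_of_joined (hXY : Disjoint X Y) (hu : 1 ≤ u) (huw : u ≤ w) {P Q : Finset V}
    (hP : P ⊆ X) (hQ : Q ⊆ Y) (hJ : Joined G P Q) (h1 : u * #Q ≤ w * #P)
    (h2 : u * #P ≤ w * #Q) :
    ∃ A ⊆ P ∪ Q, Tiled G X Y u w A ∧ #((P ∪ Q) \ A) + 1 ≤ 2 * (u + w) := by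
  obtain ⟨a, b, ha, hb, hab⟩ := exists_tile_counts hu huw h1 h2
  obtain ⟨P', hP', hcP⟩ := exists_subset_card_eq ha
  obtain ⟨Q', hQ', hcQ⟩ := exists_subset_card_eq hb
  have hd : Disjoint P Q := disjoint_of_subset_left hP (disjoint_of_subset_right hQ hXY)
  refine ⟨P' ∪ Q', union_subset_union hP' hQ', tiled_of_joined hXY (hP'.trans hP) (hQ'.trans hQ)
    (hJ.mono hP' hQ') a b hcP hcQ, ?_⟩
  rw [card_sdiff_of_subset (union_subset_union hP' hQ'), card_union_of_disjoint hd,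
    card_union_of_disjoint (disjoint_of_subset_left hP' (disjoint_of_subset_right hQ' hd))]
  omega

/-! ### Families of disjoint complete pairs -/

/-- `T` is a family of disjoint complete bipartite graphs `K_{a,b}` between `X` and `Y`. -/
structure IsFam (G : SimpleGraph V) (X Y : Finset V) (a b : ℕ)
    (T : Finset (Finset V × Finset V)) : Prop where
  left : ∀ τ ∈ T, τ.1 ⊆ X
  right : ∀ τ ∈ T, τ.2 ⊆ Y
  size : ∀ τ ∈ T, #τ.1 = a ∧ #τ.2 = b ∨ #τ.1 = b ∧ #τ.2 = a
  joined : ∀ τ ∈ T, Joined G τ.1 τ.2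
  disj : ∀ τ ∈ T, ∀ τ' ∈ T, τ ≠ τ' → Disjoint (τ.1 ∪ τ.2) (τ'.1 ∪ τ'.2)

/-- The vertices covered by a family. -/
noncomputable def cov (T : Finset (Finset V × Finset V)) : Finset V :=
  T.biUnion fun τ => τ.1 ∪ τ.2

variable {a b : ℕ} {T S : Finset (Finset V × Finset V)}

lemma mem_cov {v : V} : v ∈ cov T ↔ ∃ τ ∈ T, v ∈ τ.1 ∨ v ∈ τ.2 := by
  simp [cov]

lemma cov_mono (h : S ⊆ T) : cov S ⊆ cov T := biUnion_subset_biUnion_of_subset_left _ h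

lemma subset_cov {τ : Finset V × Finset V} (h : τ ∈ T) : τ.1 ∪ τ.2 ⊆ cov T :=
  subset_biUnion_of_mem (fun τ : Finset V × Finset V => τ.1 ∪ τ.2) h

lemma cov_insert (τ : Finset V × Finset V) : cov (insert τ T) = τ.1 ∪ τ.2 ∪ cov T :=
  biUnion_insert

lemma cov_singleton (τ : Finset V × Finset V) : cov {τ} = τ.1 ∪ τ.2 := singleton_biUnion

lemma cov_empty : cov (∅ : Finset (Finset V × Finset V)) = ∅ := biUnion_empty

lemma cov_union : cov (S ∪ T) = cov S ∪ cov T := by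
  ext v; simp only [mem_cov, mem_union]; grind

lemma IsFam.subset (h : IsFam G X Y a b T) (hS : S ⊆ T) : IsFam G X Y a b S :=
  ⟨fun τ h' => h.left τ (hS h'), fun τ h' => h.right τ (hS h'), fun τ h' => h.size τ (hS h'),
    fun τ h' => h.joined τ (hS h'), fun τ h' τ' h'' => h.disj τ (hS h') τ' (hS h'')⟩

lemma IsFam.cov_subset (h : IsFam G X Y a b T) : cov T ⊆ X ∪ Y :=
  biUnion_subset.2 fun τ hτ => union_subset_union (h.left τ hτ) (h.right τ hτ)

lemma IsFam.disjoint_cov (h : IsFam G X Y a b T) {S S' : Finset (Finset V × Finset V)}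
    (hS : S ⊆ T) (hS' : S' ⊆ T) (hd : Disjoint S S') : Disjoint (cov S) (cov S') := by
  rw [cov, cov, disjoint_biUnion_left]
  intro τ hτ
  rw [disjoint_biUnion_right]
  intro τ' hτ'
  refine h.disj τ (hS hτ) τ' (hS' hτ') ?_
  rintro rfl
  exact disjoint_left.1 hd hτ hτ'

lemma IsFam.card_tile (h : IsFam G X Y a b T) (hXY : Disjoint X Y) {τ : Finset V × Finset V}
    (hτ : τ ∈ T) : #(τ.1 ∪ τ.2) = a + b := by
  rw [card_union_of_disjoint (disjoint_of_subset_left (h.left τ hτ)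
    (disjoint_of_subset_right (h.right τ hτ) hXY))]
  have := h.size τ hτ
  omega

lemma IsFam.card_cov (h : IsFam G X Y a b T) (hXY : Disjoint X Y) :
    #(cov T) = (a + b) * #T := by
  rw [cov, card_biUnion h.disj, sum_congr rfl fun τ hτ => h.card_tile hXY hτ, sum_const,
    smul_eq_mul, mul_comm]

lemma IsFam.swap (h : IsFam G X Y a b T) : IsFam G Y X a b (T.image Prod.swap) := by
  refine ⟨?_, ?_, ?_, ?_, ?_⟩
  · simp only [mem_image, forall_exists_index, and_imp]
    rintro _ τ hτ rfl; exact h.right τ hτ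
  · simp only [mem_image, forall_exists_index, and_imp]
    rintro _ τ hτ rfl; exact h.left τ hτ
  · simp only [mem_image, forall_exists_index, and_imp]
    rintro _ τ hτ rfl; have := h.size τ hτ; simp only [Prod.fst_swap, Prod.snd_swap]; omega
  · simp only [mem_image, forall_exists_index, and_imp]
    rintro _ τ hτ rfl; exact (h.joined τ hτ).symm
  · simp only [mem_image, forall_exists_index, and_imp]
    rintro _ τ hτ rfl _ τ' hτ' rfl hne
    have := h.disj τ hτ τ' hτ' (fun e => hne (by rw [e]))
    simpa only [Prod.fst_swap, Prod.snd_swap, union_comm] using this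

lemma cov_swap : cov (T.image Prod.swap) = cov T := by
  rw [cov, cov, image_biUnion]
  exact biUnion_congr rfl fun τ _ => union_comm _ _

/-- A family all of whose members are tiled is tiled. -/
lemma IsFam.tiled_cov (h : IsFam G X Y a b T)
    (ht : ∀ τ ∈ T, Tiled G X Y u w (τ.1 ∪ τ.2)) : Tiled G X Y u w (cov T) := by
  induction T using Finset.induction_on with
  | empty => rw [cov_empty]; exact Tiled.nil
  | insert τ T hτ ih =>
    rw [cov_insert]
    refine (ht τ (mem_insert_self _ _)).union (ih (h.subset (subset_insert _ _))
      fun τ' h' => ht τ' (mem_insert_of_mem h')) ?_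
    rw [← cov_singleton]
    exact h.disjoint_cov (singleton_subset_iff.2 (mem_insert_self _ _)) (subset_insert _ _)
      (disjoint_singleton_left.2 hτ)

/-- Every tiled set is covered by a family of tiles. -/
lemma Tiled.exists_fam {A : Finset V} (h : Tiled G X Y a b A) :
    ∃ T, IsFam G X Y a b T ∧ cov T = A := by
  induction h with
  | nil => exact ⟨∅, ⟨by simp, by simp, by simp, by simp, by simp⟩, cov_empty⟩
  | cons P Q A hP hQ hc hJ hd _ ih =>
    obtain ⟨T, hT, rfl⟩ := ih
    refine ⟨insert (P, Q) T, ⟨?_, ?_, ?_, ?_, ?_⟩, cov_insert _⟩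
    · simp only [forall_mem_insert]; exact ⟨hP, hT.left⟩
    · simp only [forall_mem_insert]; exact ⟨hQ, hT.right⟩
    · simp only [forall_mem_insert]; exact ⟨hc, hT.size⟩
    · simp only [forall_mem_insert]; exact ⟨hJ, hT.joined⟩
    · have key : ∀ τ ∈ T, Disjoint (P ∪ Q) (τ.1 ∪ τ.2) := fun τ hτ =>
        disjoint_of_subset_right (subset_cov hτ) hd
      simp only [forall_mem_insert]
      exact ⟨⟨by simp, fun τ hτ _ => key τ hτ⟩, fun τ hτ => ⟨fun _ => (key τ hτ).symm,
        fun τ' hτ' => hT.disj τ hτ τ' hτ'⟩⟩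

lemma IsFam.tiled_tile (h : IsFam G X Y (u * a) (w * a) T) (hXY : Disjoint X Y)
    {τ : Finset V × Finset V} (hτ : τ ∈ T) : Tiled G X Y u w (τ.1 ∪ τ.2) := by
  rcases h.size τ hτ with ⟨h1, h2⟩ | ⟨h1, h2⟩
  · exact tiled_of_joined hXY (h.left τ hτ) (h.right τ hτ) (h.joined τ hτ) a 0
      (by rw [h1]; ring) (by rw [h2]; ring)
  · exact tiled_of_joined hXY (h.left τ hτ) (h.right τ hτ) (h.joined τ hτ) 0 a
      (by rw [h1]; ring) (by rw [h2]; ring)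

/-- A tiling by `K_{ua,wa}` gives a tiling by `K_{u,w}`. -/
lemma Tiled.refine {A : Finset V} (h : Tiled G X Y (u * a) (w * a) A) (hXY : Disjoint X Y) :
    Tiled G X Y u w A := by
  induction h with
  | nil => exact Tiled.nil
  | cons P Q A hP hQ hc hJ hd _ ih =>
    refine Tiled.union ?_ ih hd
    rcases hc with ⟨h1, h2⟩ | ⟨h1, h2⟩
    · exact tiled_of_joined hXY hP hQ hJ a 0 (by rw [h1]; ring) (by rw [h2]; ring)
    · exact tiled_of_joined hXY hP hQ hJ 0 a (by rw [h1]; ring) (by rw [h2]; ring)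

/-! ### Pigeonhole and the augmentation loop -/

/-- If every `b ∈ B` is related to at least `k` elements of `A`, then a positive proportion of
`B` is related to all elements of one `k`-subset of `A`. -/
lemma exists_common_subset {ι κ : Type*} (r : ι → κ → Prop) (A : Finset ι) (B : Finset κ)
    (k : ℕ) (h : ∀ b ∈ B, k ≤ #(A.filter fun a => r a b)) (hk : k ≤ #A) :
    ∃ A' ⊆ A, #A' = k ∧ #B ≤ 2 ^ #A * #(B.filter fun b => ∀ a ∈ A', r a b) := by
  have hch : ∀ b : κ, ∃ A' ⊆ A, #A' = k ∧ (b ∈ B → ∀ a ∈ A', r a b) := by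
    intro b
    by_cases hb : b ∈ B
    · obtain ⟨A', hA', hc⟩ := exists_subset_card_eq (h b hb)
      exact ⟨A', hA'.trans (filter_subset _ _), hc, fun _ a ha => (mem_filter.1 (hA' ha)).2⟩
    · obtain ⟨A', hA', hc⟩ := exists_subset_card_eq hk
      exact ⟨A', hA', hc, fun h => absurd h hb⟩
  choose f hf1 hf2 hf3 using hch
  by_contra! hcon
  have hne : (A.powersetCard k).Nonempty := powersetCard_nonempty.2 hk
  have h1 : #B = ∑ A' ∈ A.powersetCard k, #(B.filter fun b => f b = A') :=
    card_eq_sum_card_fiberwise fun b _ => mem_coe.2 (mem_powersetCard.2 ⟨hf1 b, hf2 b⟩)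
  have h2 : ∀ A' ∈ A.powersetCard k, 2 ^ #A * #(B.filter fun b => f b = A') < #B := by
    intro A' hA'
    rw [mem_powersetCard] at hA'
    refine lt_of_le_of_lt (Nat.mul_le_mul_left _ (card_le_card ?_)) (hcon A' hA'.1 hA'.2)
    intro b hb
    rw [mem_filter] at hb ⊢
    exact ⟨hb.1, hb.2 ▸ hf3 b hb.1⟩
  have h3 := sum_lt_sum_of_nonempty hne h2
  rw [← mul_sum, ← h1, sum_const, smul_eq_mul] at h3
  have h4 : #(A.powersetCard k) ≤ 2 ^ #A := by
    rw [← card_powerset]; exact card_le_card fun s hs => mem_powerset.2 (mem_powersetCard.1 hs).1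
  exact absurd (lt_of_lt_of_le h3 (Nat.mul_le_mul_right _ h4)) (lt_irrefl _)

/-- Iterated augmentation: as long as the set `L` of uncovered vertices satisfies `Bad`, some
tiles of `T` are dissolved and retiled together with `L`. -/
lemma augment (hT : IsFam G X Y a b T) (hXY : Disjoint X Y)
    (ht : ∀ τ ∈ T, Tiled G X Y u w (τ.1 ∪ τ.2)) (g ρ : ℕ) (Bad : ℕ → Prop)
    (step : ∀ T' ⊆ T, ∀ C L : Finset V, Tiled G X Y u w C → Disjoint C L →
      Disjoint (C ∪ L) (cov T') → C ∪ L ∪ cov T' = X ∪ Y →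
      g * #(T \ T') + ρ * #L ≤ ρ * #((X ∪ Y) \ cov T) →
      #C + #L = #((X ∪ Y) \ cov T) + (a + b) * #(T \ T') → Bad #L →
      ∃ S ⊆ T', ∃ R ⊆ L ∪ cov S, Tiled G X Y u w R ∧ #((L ∪ cov S) \ R) < #L ∧
        g * #S + ρ * #((L ∪ cov S) \ R) ≤ ρ * #L) :
    ∃ R ⊆ X ∪ Y, Tiled G X Y u w R ∧ ¬ Bad #((X ∪ Y) \ R) := by
  have main : ∀ k, ∀ T' ⊆ T, ∀ C L : Finset V, #L ≤ k → Tiled G X Y u w C → Disjoint C L →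
      Disjoint (C ∪ L) (cov T') → C ∪ L ∪ cov T' = X ∪ Y →
      g * #(T \ T') + ρ * #L ≤ ρ * #((X ∪ Y) \ cov T) →
      #C + #L = #((X ∪ Y) \ cov T) + (a + b) * #(T \ T') →
      ∃ R ⊆ X ∪ Y, Tiled G X Y u w R ∧ ¬ Bad #((X ∪ Y) \ R) := by
    intro k
    induction k with
    | zero => ?_
    | succ k ih => ?_
    all_goals
      intro T' hT' C L hk hC hCL hCLT hall hg hcard
      by_cases hB : Bad #L
      swap
      · refine ⟨C ∪ cov T', ?_, hC.union ((hT.subset hT').tiled_cov fun τ h => ht τ (hT' h))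
          (disjoint_of_subset_left subset_union_left hCLT), ?_⟩
        · rw [← hall]; grind
        · have e : (X ∪ Y) \ (C ∪ cov T') = L := by
            rw [← hall, union_right_comm, union_sdiff_left]
            exact sdiff_eq_self_of_disjoint (disjoint_union_right.2 ⟨hCL.symm,
              disjoint_of_subset_left subset_union_right hCLT⟩)
          rwa [e]
      obtain ⟨S, hS, R, hR, hRt, hlt, hgain⟩ :=
        step T' hT' C L hC hCL hCLT hall hg hcard hB
    · omega
    · have hdS : Disjoint (cov S) (cov (T' \ S)) :=
        hT.disjoint_cov (hS.trans hT') (sdiff_subset.trans hT') disjoint_sdiff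
      have hcT : cov T' = cov S ∪ cov (T' \ S) := by
        rw [← cov_union, union_sdiff_of_subset hS]
      have hdC : Disjoint C R := by
        refine disjoint_of_subset_right hR ?_
        rw [hcT] at hCLT
        rw [disjoint_union_right]
        exact ⟨hCL, disjoint_of_subset_left subset_union_left
          (disjoint_of_subset_right subset_union_left hCLT)⟩
      have hTS : #(T \ (T' \ S)) = #(T \ T') + #S := by
        rw [← card_union_of_disjoint]
        · congr 1
          ext v
          have := @hS v
          have := @hT' v
          simp only [mem_sdiff, mem_union]
          tauto
        · rw [disjoint_left]
          intro v hv hv'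
          exact (mem_sdiff.1 hv).2 (hS hv')
      rw [hcT, disjoint_union_left, disjoint_union_right, disjoint_union_right] at hCLT
      have hLS : R ∪ (L ∪ cov S) \ R = L ∪ cov S := union_sdiff_of_subset hR
      refine ih (T' \ S) (sdiff_subset.trans hT') (C ∪ R) ((L ∪ cov S) \ R) (by omega)
        (hC.union hRt hdC) ?_ ?_ ?_ ?_ ?_
      · exact disjoint_union_left.2 ⟨disjoint_of_subset_right sdiff_subset
          (disjoint_union_right.2 ⟨hCL, hCLT.1.1⟩), disjoint_sdiff⟩
      · rw [union_assoc, hLS]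
        simp only [disjoint_union_left]
        exact ⟨hCLT.1.2, hCLT.2.2, hdS⟩
      · rw [union_assoc C, hLS, ← hall, hcT]
        simp only [union_assoc]
      · rw [hTS, mul_add]; omega
      · rw [hTS, mul_add, card_union_of_disjoint hdC]
        have h1 := card_sdiff_add_card_eq_card hR
        rw [card_union_of_disjoint (s := L), (hT.subset (hS.trans hT')).card_cov hXY] at h1
        · omega
        · exact hCLT.2.1
  refine main _ T subset_rfl ∅ ((X ∪ Y) \ cov T) le_rfl Tiled.nil (by simp) ?_ ?_ ?_ ?_
  · rw [empty_union]; exact sdiff_disjoint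
  · rw [empty_union]; exact sdiff_union_of_subset hT.cov_subset
  · simp
  · simp

/-! ### Counting edges -/

lemma degIn_le (x : V) (B : Finset V) : degIn G x B ≤ #B := card_filter_le _ _

lemma degIn_mono (x : V) {A B : Finset V} (h : A ⊆ B) : degIn G x A ≤ degIn G x B :=
  card_le_card (filter_subset_filter _ h)

lemma degIn_union_le (x : V) (A B : Finset V) :
    degIn G x (A ∪ B) ≤ degIn G x A + degIn G x B := by
  unfold degIn
  rw [filter_union]
  exact card_union_le _ _

lemma degIn_union (x : V) {A B : Finset V} (h : Disjoint A B) :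
    degIn G x (A ∪ B) = degIn G x A + degIn G x B := by
  unfold degIn
  rw [filter_union, card_union_of_disjoint (disjoint_filter_filter h)]

lemma degIn_biUnion_le {ι : Type*} (x : V) (s : Finset ι) (f : ι → Finset V) :
    degIn G x (s.biUnion f) ≤ ∑ i ∈ s, degIn G x (f i) := by
  unfold degIn
  rw [filter_biUnion]
  exact card_biUnion_le

lemma eAB_eq_sum (A B : Finset V) : eAB G A B = ∑ x ∈ A, degIn G x B := by
  unfold eAB degIn
  rw [card_filter, sum_product]
  exact sum_congr rfl fun x _ => (card_filter _ _).symm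

lemma eAB_comm (A B : Finset V) : eAB G A B = eAB G B A := by
  rw [eAB_eq_sum, eAB_eq_sum]
  unfold degIn
  rw [show (∑ x ∈ B, #(A.filter fun y => G.Adj x y)) = ∑ x ∈ B, #(A.filter fun y => G.Adj y x)
    from sum_congr rfl fun x _ => by simp only [G.adj_comm]]
  exact sum_card_bipartiteAbove_eq_sum_card_bipartiteBelow G.Adj

lemma eAB_le (A B : Finset V) : eAB G A B ≤ #A * #B := by
  unfold eAB
  exact (card_filter_le _ _).trans (card_product _ _).le

lemma eAB_mono {A B A' B' : Finset V} (hA : A ⊆ A') (hB : B ⊆ B') :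
    eAB G A B ≤ eAB G A' B' :=
  card_le_card (filter_subset_filter _ (product_subset_product hA hB))

/-- A function bounded by `q` with average at least `η q` is often at least `η q / 2`. -/
lemma card_large_of_sum {ι : Type*} (A : Finset ι) (f : ι → ℕ) (q : ℕ) {η : ℝ}
    (h0 : 0 ≤ η) (hf : ∀ a ∈ A, f a ≤ q) (hη : η * #A * q ≤ (∑ a ∈ A, f a : ℕ)) (hq : 0 < q) :
    η / 2 * #A ≤ #(A.filter fun a => η / 2 * q ≤ f a) := by
  have h1 : ((∑ a ∈ A, f a : ℕ) : ℝ) ≤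
      #(A.filter fun a => η / 2 * q ≤ f a) * (q : ℝ) + #A * (η / 2 * q) := by
    push_cast
    rw [← sum_filter_add_sum_filter_not A (fun a => η / 2 * q ≤ f a)]
    refine add_le_add ?_ ?_
    · rw [← nsmul_eq_mul]
      refine sum_le_card_nsmul _ _ _ fun a ha => ?_
      exact_mod_cast hf a (mem_filter.1 ha).1
    · refine le_trans (sum_le_card_nsmul _ _ (η / 2 * q) fun a ha => ?_) ?_
      · exact (not_le.1 (mem_filter.1 ha).2).le
      · rw [nsmul_eq_mul]
        refine mul_le_mul_of_nonneg_right ?_ (by positivity)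
        exact_mod_cast card_filter_le _ _
  have hq' : (0:ℝ) < q := by exact_mod_cast hq
  refine le_of_mul_le_mul_right ?_ hq'
  nlinarith

/-- A dense pair with one side of bounded size contains large complete pairs. -/
lemma exists_joined_of_dense (A Q : Finset V) {η : ℝ} (h0 : 0 < η) (k l : ℕ)
    (hη : η * #A * #Q ≤ eAB G A Q) (hk : k ≤ η / 2 * #Q) (hk0 : 0 < k) (hl0 : 0 < l)
    (hl : (2 ^ #Q * l : ℝ) ≤ η / 2 * #A) :
    ∃ S ⊆ A, ∃ Q' ⊆ Q, #S = l ∧ #Q' = k ∧ Joined G S Q' := by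
  have hA : (0:ℝ) < η / 2 * #A := lt_of_lt_of_le (by positivity) hl
  have hQ : 0 < #Q := by
    rcases Nat.eq_zero_or_pos #Q with h | h
    · rw [h] at hk; simp at hk; omega
    · exact h
  have h1 := card_large_of_sum A (fun x => degIn G x Q) #Q h0.le (fun x _ => degIn_le x Q)
    (by rw [← eAB_eq_sum]; exact hη) hQ
  set B := A.filter fun x => η / 2 * #Q ≤ degIn G x Q with hB
  have h2 : ∀ x ∈ B, k ≤ #(Q.filter fun y => G.Adj y x) := by
    intro x hx
    have h3 := (mem_filter.1 hx).2
    have h4 : (k : ℝ) ≤ degIn G x Q := hk.trans h3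
    have h5 : k ≤ degIn G x Q := by exact_mod_cast h4
    simpa only [degIn, G.adj_comm] using h5
  have hBne : B.Nonempty := by
    rw [← card_pos]
    have : (0:ℝ) < #B := lt_of_lt_of_le hA h1
    exact_mod_cast this
  have hkQ : k ≤ #Q := by
    obtain ⟨x, hx⟩ := hBne
    exact (h2 x hx).trans (card_filter_le _ _)
  obtain ⟨Q', hQ', hcQ, hbig⟩ := exists_common_subset (fun y x => G.Adj y x) Q B k h2 hkQ
  have h3 : l ≤ #(B.filter fun x => ∀ y ∈ Q', G.Adj y x) := by
    have h4 : (2 ^ #Q * l : ℝ) ≤ (2 ^ #Q * #(B.filter fun x => ∀ y ∈ Q', G.Adj y x) : ℕ) :=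
      (hl.trans h1).trans (by exact_mod_cast hbig)
    push_cast at h4
    have h5 := le_of_mul_le_mul_left h4 (by positivity)
    exact_mod_cast h5
  obtain ⟨S, hS, hcS⟩ := exists_subset_card_eq h3
  refine ⟨S, (hS.trans (filter_subset _ _)).trans (filter_subset _ _), Q', hQ', hcS, hcQ, ?_⟩
  intro x hx y hy
  exact ((mem_filter.1 (hS hx)).2 y hy).symm

/-- A form of the Kővári–Sós–Turán theorem. -/
lemma exists_joined_of_many_edges (η : ℝ) (h0 : 0 < η) (k : ℕ) (hk0 : 0 < k) :
    ∃ n0 : ℕ, ∀ n ≥ n0, ∀ {V : Type*} (G : SimpleGraph V) (A B : Finset V), #A ≤ n → #B ≤ n →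
      η * n ^ 2 ≤ eAB G A B → ∃ S ⊆ A, ∃ Q ⊆ B, #S = k ∧ #Q = k ∧ Joined G S Q := by
  obtain ⟨q, hq⟩ := exists_nat_gt (4 * k / η)
  obtain ⟨n0, hn0⟩ := exists_nat_gt (2 * q / η ^ 2 + 4 * (2 ^ q * k) / η ^ 2)
  refine ⟨n0 + 1, fun n hn V G A B hA hB he => ?_⟩
  have hn' : 2 * q / η ^ 2 + 4 * (2 ^ q * k) / η ^ 2 < n :=
    hn0.trans (by exact_mod_cast hn)
  have h1 : 2 * q / η ^ 2 < n := lt_of_le_of_lt (le_add_of_nonneg_right (by positivity)) hn'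
  have h2 : 4 * (2 ^ q * k) / η ^ 2 < n :=
    lt_of_le_of_lt (le_add_of_nonneg_left (by positivity)) hn'
  rw [div_lt_iff₀ (by positivity)] at h1 h2 hq
  have hnpos : (0:ℝ) < n := by exact_mod_cast (by omega : 0 < n)
  have hA' : (#A : ℝ) ≤ n := by exact_mod_cast hA
  have hB' : (#B : ℝ) ≤ n := by exact_mod_cast hB
  have heAB : (eAB G A B : ℝ) ≤ #A * #B := by exact_mod_cast eAB_le A B
  have hBη : η * n ≤ #B := by
    refine le_of_mul_le_mul_left ?_ hnpos
    nlinarith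
  have hAη : η * n ≤ #A := by
    refine le_of_mul_le_mul_right ?_ hnpos
    nlinarith
  have h3 := card_large_of_sum B (fun y => degIn G y A) n h0.le
    (fun y _ => (degIn_le y A).trans hA)
    (by
      rw [← eAB_eq_sum, eAB_comm]
      refine le_trans ?_ he
      rw [sq, ← mul_assoc]
      gcongr)
    (by omega)
  set B1 := B.filter fun y => η / 2 * n ≤ degIn G y A
  have h4 : q ≤ #B1 := by
    have : (q : ℝ) ≤ #B1 := by
      nlinarith
    exact_mod_cast this
  obtain ⟨Q, hQ, hcQ⟩ := exists_subset_card_eq h4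
  have h5 : η / 2 * #A * #Q ≤ eAB G A Q := by
    rw [eAB_comm, eAB_eq_sum]
    push_cast
    have : #Q • (η / 2 * n) ≤ ∑ x ∈ Q, (degIn G x A : ℝ) :=
      card_nsmul_le_sum _ _ _ fun x hx => (mem_filter.1 (hQ hx)).2
    rw [nsmul_eq_mul] at this
    refine le_trans ?_ this
    rw [mul_comm]
    gcongr
  obtain ⟨S, hS, Q', hQ', hcS, hcQ', hJ⟩ := exists_joined_of_dense A Q (half_pos h0) k k h5
    (by rw [hcQ]; linarith) hk0 hk0 (by rw [hcQ]; nlinarith)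
  exact ⟨S, hS, Q', hQ'.trans (hQ.trans (filter_subset _ _)), hcS, hcQ', hJ⟩

/-! ### Balanced bipartite graphs, layouts and improvements -/

/-- `X` and `Y` are disjoint sets of `n` vertices, each vertex of which has at least
`u n / (u + w)` neighbours in the other set. -/
structure Bal (G : SimpleGraph V) (X Y : Finset V) (u w n : ℕ) : Prop where
  disj : Disjoint X Y
  cardX : #X = n
  cardY : #Y = n
  degX : ∀ x ∈ X, u * n ≤ (u + w) * degIn G x Y
  degY : ∀ y ∈ Y, u * n ≤ (u + w) * degIn G y X

lemma Bal.swap {n : ℕ} (h : Bal G X Y u w n) : Bal G Y X u w n :=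
  ⟨h.disj.symm, h.cardY, h.cardX, h.degY, h.degX⟩

/-- The vertices are partitioned into the tiles of a family `T`, a set `C` and a set `L`. -/
structure Layout (G : SimpleGraph V) (X Y : Finset V) (a b : ℕ)
    (T : Finset (Finset V × Finset V)) (C L : Finset V) : Prop where
  fam : IsFam G X Y a b T
  disjCL : Disjoint C L
  disjT : Disjoint (C ∪ L) (cov T)
  all : C ∪ L ∪ cov T = X ∪ Y

/-- Some tiles of `T` can be dissolved and retiled together with `L`, covering more vertices. -/
def Improvable (G : SimpleGraph V) (X Y : Finset V) (u w : ℕ) (T : Finset (Finset V × Finset V))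
    (L : Finset V) (g ρ : ℕ) : Prop :=
  ∃ S ⊆ T, ∃ R ⊆ L ∪ cov S, Tiled G X Y u w R ∧ #((L ∪ cov S) \ R) < #L ∧
    g * #S + ρ * #((L ∪ cov S) \ R) ≤ ρ * #L

variable {C L : Finset V} {n : ℕ}

lemma Layout.swap (h : Layout G X Y a b T C L) :
    Layout G Y X a b (T.image Prod.swap) C L :=
  ⟨h.fam.swap, h.disjCL, by rw [cov_swap]; exact h.disjT,
    by rw [cov_swap, h.all, union_comm]⟩

lemma Layout.disjLT (h : Layout G X Y a b T C L) : Disjoint L (cov T) :=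
  disjoint_of_subset_left subset_union_right h.disjT

lemma Layout.subL (h : Layout G X Y a b T C L) : L ⊆ X ∪ Y := by
  rw [← h.all]; exact subset_union_right.trans subset_union_left

lemma Improvable.swap {g ρ : ℕ} (h : Improvable G Y X u w (T.image Prod.swap) L g ρ) :
    Improvable G X Y u w T L g ρ := by
  obtain ⟨S, hS, R, hR, ht, h1, h2⟩ := h
  have e : (S.image Prod.swap).image Prod.swap = S := by
    rw [image_image, Prod.swap_swap_eq, image_id]
  refine ⟨S.image Prod.swap, ?_, R, ?_, ht.symm, ?_, ?_⟩
  · refine (image_subset_image hS).trans ?_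
    rw [image_image, Prod.swap_swap_eq, image_id]
  · rwa [cov_swap]
  · rwa [cov_swap]
  · rwa [cov_swap, card_image_of_injective _ Prod.swap_injective]

lemma Layout.improvable (h : Layout G X Y a b T C L) (hXY : Disjoint X Y)
    {S : Finset (Finset V × Finset V)} (hS : S ⊆ T) {R : Finset V} (hR : R ⊆ L ∪ cov S)
    (ht : Tiled G X Y u w R) {g ρ : ℕ} (e : ℕ) (he : 0 < e) (hge : g * #S ≤ ρ * e)
    (hc : (a + b) * #S + e ≤ #R) : Improvable G X Y u w T L g ρ := by
  have h1 := card_sdiff_add_card_eq_card hR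
  rw [card_union_of_disjoint (disjoint_of_subset_right (cov_mono hS) h.disjLT),
    (h.fam.subset hS).card_cov hXY] at h1
  refine ⟨S, hS, R, hR, ht, by omega, ?_⟩
  have h2 : #((L ∪ cov S) \ R) + e ≤ #L := by omega
  have h3 := Nat.mul_le_mul_left ρ h2
  rw [mul_add] at h3
  omega

lemma Layout.cover_right (h : Layout G X Y a b T C L) (hXY : Disjoint X Y) :
    Y = (L ∩ Y) ∪ (C ∩ Y) ∪ T.biUnion Prod.snd := by
  ext y
  have h1 : y ∈ C ∪ L ∪ cov T ↔ y ∈ X ∪ Y := by rw [h.all]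
  simp only [mem_union, mem_inter, mem_biUnion, mem_cov] at h1 ⊢
  constructor
  · intro hy
    rcases h1.2 (Or.inr hy) with (h2 | h2) | ⟨τ, hτ, h2 | h2⟩
    · tauto
    · tauto
    · exact absurd hy (disjoint_left.1 hXY (h.fam.left τ hτ h2))
    · exact Or.inr ⟨τ, hτ, h2⟩
  · rintro ((h2 | h2) | ⟨τ, hτ, h2⟩)
    · exact h2.2
    · exact h2.2
    · exact h.fam.right τ hτ h2

lemma IsFam.disj_snd (h : IsFam G X Y a b T) {τ τ' : Finset V × Finset V} (hτ : τ ∈ T)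
    (hτ' : τ' ∈ T) (hne : τ ≠ τ') : Disjoint τ.2 τ'.2 :=
  disjoint_of_subset_left subset_union_right
    (disjoint_of_subset_right subset_union_right (h.disj τ hτ τ' hτ' hne))

lemma IsFam.disj_fst (h : IsFam G X Y a b T) {τ τ' : Finset V × Finset V} (hτ : τ ∈ T)
    (hτ' : τ' ∈ T) (hne : τ ≠ τ') : Disjoint τ.1 τ'.1 :=
  disjoint_of_subset_left subset_union_left
    (disjoint_of_subset_right subset_union_left (h.disj τ hτ τ' hτ' hne))

lemma Layout.card_right (h : Layout G X Y a b T C L) (hXY : Disjoint X Y) :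
    #Y = #(L ∩ Y) + #(C ∩ Y) + ∑ τ ∈ T, #τ.2 := by
  conv_lhs => rw [h.cover_right hXY]
  rw [card_union_of_disjoint, card_union_of_disjoint, card_biUnion]
  · exact fun τ hτ τ' hτ' hne => h.fam.disj_snd hτ hτ' hne
  · exact disjoint_of_subset_left inter_subset_left
      (disjoint_of_subset_right inter_subset_left h.disjCL.symm)
  · refine Disjoint.mono ?_ ?_ h.disjT
    · intro v; simp only [mem_union, mem_inter]; tauto
    · exact biUnion_subset.2 fun τ hτ => subset_union_right.trans (subset_cov hτ)

lemma Layout.card_left (h : Layout G X Y a b T C L) (hXY : Disjoint X Y) :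
    #X = #(L ∩ X) + #(C ∩ X) + ∑ τ ∈ T, #τ.1 := by
  have := h.swap.card_right hXY.symm
  rwa [sum_image fun _ _ _ _ e => Prod.swap_injective e] at this

/-- If a set `A` has few edges to `L` and to many of the sets `f i`, then the remaining sets are
large. -/
lemma bound_of_sparse {ι : Type*} [DecidableEq ι] {A L C Y : Finset V} {S S1 : Finset ι} {f : ι → Finset V}
    (hdeg : ∀ x ∈ A, u * n ≤ (u + w) * degIn G x Y) (hY : Y ⊆ L ∪ C ∪ S.biUnion f)
    (hS : S1 ⊆ S) {η δ α : ℝ} (hη : 0 < η) (hα : 0 < α) (hn : 0 < n)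
    (hsp : ∀ i ∈ S1, (eAB G A (f i) : ℝ) ≤ η * #A * #(f i)) (hsum : ∑ i ∈ S, #(f i) ≤ n)
    (hL : (eAB G A L : ℝ) ≤ η * n ^ 2) (hC : (#C : ℝ) ≤ δ * n) (hA : α * n ≤ #A) :
    (u * n : ℝ) ≤ (u + w) * ((∑ i ∈ S \ S1, #(f i) : ℕ) + (η / α + δ + η) * n) := by
  have hn' : (0:ℝ) < n := by exact_mod_cast hn
  have hA0 : (0:ℝ) < #A := lt_of_lt_of_le (by positivity) hA
  have h1 : #A * (u * n) ≤ (u + w) * (eAB G A L + #A * #C + ∑ i ∈ S, eAB G A (f i)) := by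
    have h2 : #A * (u * n) ≤ ∑ x ∈ A, (u + w) * degIn G x Y := by
      simpa using card_nsmul_le_sum A (fun x => (u + w) * degIn G x Y) (u * n) hdeg
    refine h2.trans ?_
    rw [← mul_sum]
    refine Nat.mul_le_mul_left _ ?_
    have h3 : ∀ x ∈ A, degIn G x Y ≤ degIn G x L + #C + ∑ i ∈ S, degIn G x (f i) := by
      intro x _
      refine (degIn_mono x hY).trans ((degIn_union_le _ _ _).trans ?_)
      exact add_le_add ((degIn_union_le _ _ _).trans (Nat.add_le_add_left (degIn_le _ _) _))
        (degIn_biUnion_le _ _ _)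
    refine (sum_le_sum h3).trans (le_of_eq ?_)
    rw [sum_add_distrib, sum_add_distrib, ← eAB_eq_sum, sum_const, smul_eq_mul, sum_comm]
    simp only [eAB_eq_sum]
  have h4 : (∑ i ∈ S, eAB G A (f i) : ℕ) ≤ #A * ((∑ i ∈ S \ S1, #(f i) : ℕ) + η * n : ℝ) := by
    rw [← sum_sdiff hS, Nat.cast_add, mul_add]
    refine add_le_add ?_ ?_
    · rw [← Nat.cast_mul, mul_sum]
      exact_mod_cast sum_le_sum fun i _ => eAB_le A (f i)
    · push_cast
      refine (sum_le_sum hsp).trans ?_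
      rw [← mul_sum]
      have h5 : (∑ i ∈ S1, (#(f i) : ℝ)) ≤ n := by
        exact_mod_cast (sum_le_sum_of_subset hS).trans hsum
      calc η * #A * ∑ i ∈ S1, (#(f i) : ℝ) ≤ η * #A * n := by gcongr
        _ = _ := by ring
  have h5 : η * n ^ 2 ≤ #A * (η / α * n) := by
    have : η / α * n * (α * n) ≤ η / α * n * #A := by gcongr
    have e : η / α * n * (α * n) = η * n ^ 2 := by field_simp
    linarith
  have h6 : (#A * (u * n) : ℝ) ≤
      (u + w) * (eAB G A L + #A * #C + (∑ i ∈ S, eAB G A (f i) : ℕ)) := by exact_mod_cast h1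
  refine le_of_mul_le_mul_left (h6.trans ?_) hA0
  rw [mul_left_comm]
  refine mul_le_mul_of_nonneg_left ?_ (by positivity)
  nlinarith

/-- The exchange of part of a tile against outside vertices joined to it. -/
lemma exists_exchange (hXY : Disjoint X Y) {N M : ℕ} (huw : u ≤ w)
    {P Q S : Finset V} (hP : P ⊆ X) (hQ : Q ⊆ Y) (hJ : Joined G P Q)
    (hcP : #P = u * N * M) (hcQ : #Q = w * N * M) {Q' : Finset V} (hQ' : Q' ⊆ Q)
    (hS : S ⊆ X) (hSP : Disjoint S P) (hSQ : Joined G S Q') (hcS : #S = w * (w * N))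
    (hcQ' : #Q' = w * (u * N)) (hM : u ≤ M) :
    ∃ R ⊆ S ∪ (P ∪ Q), Tiled G X Y (u * N) (w * N) R ∧
      (u * N * M + w * N * M) + (w * w - u * u) * N ≤ #R := by
  obtain ⟨k, rfl⟩ := Nat.exists_eq_add_of_le hM
  obtain ⟨P', hP', hcP'⟩ := exists_subset_card_eq (s := P) (n := k * (u * N))
    (by
      rw [hcP]
      have : u * N * (u + k) = k * (u * N) + u * N * u := by ring
      omega)
  have hcQQ : #(Q \ Q') = k * (w * N) := by
    rw [card_sdiff_of_subset hQ', hcQ, hcQ']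
    have : w * N * (u + k) = k * (w * N) + w * (u * N) := by ring
    omega
  have hdPQ : Disjoint P Q := disjoint_of_subset_left hP (disjoint_of_subset_right hQ hXY)
  have hdSQ : Disjoint S Q := disjoint_of_subset_left hS (disjoint_of_subset_right hQ hXY)
  have t1 : Tiled G X Y (u * N) (w * N) (S ∪ Q') :=
    tiled_of_joined hXY hS (hQ'.trans hQ) hSQ 0 w (by rw [hcS]; ring) (by rw [hcQ']; ring)
  have t2 : Tiled G X Y (u * N) (w * N) (P' ∪ Q \ Q') :=
    tiled_of_joined hXY (hP'.trans hP) (sdiff_subset.trans hQ) (hJ.mono hP' sdiff_subset) k 0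
      (by rw [hcP']; ring) (by rw [hcQQ]; ring)
  have hd : Disjoint (S ∪ Q') (P' ∪ Q \ Q') := by
    simp only [disjoint_union_left, disjoint_union_right]
    exact ⟨⟨disjoint_of_subset_right hP' hSP, (disjoint_of_subset_left hP'
      (disjoint_of_subset_right hQ' hdPQ)).symm⟩, disjoint_of_subset_right sdiff_subset hdSQ,
      disjoint_sdiff⟩
  refine ⟨_, ?_, t1.union t2 hd, ?_⟩
  · intro v
    have := @hQ' v
    have := @hP' v
    simp only [mem_union, mem_sdiff]
    tauto
  · rw [card_union_of_disjoint hd, card_union_of_disjoint (disjoint_of_subset_right hQ' hdSQ),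
      card_union_of_disjoint (disjoint_of_subset_left hP' (disjoint_of_subset_right sdiff_subset
        hdPQ)), hcS, hcQ', hcP', hcQQ]
    obtain ⟨d, rfl⟩ := Nat.exists_eq_add_of_le huw
    have : (u + d) * (u + d) - u * u = 2 * u * d + d * d := by
      rw [Nat.sub_eq_iff_eq_add (by nlinarith)]; ring
    rw [this]
    ring_nf
    omega

private lemma unbal_contra {u w n κ η ε p q lx ly cx cy : ℝ} (hu : 1 ≤ u) (huw : u + 1 ≤ w)
    (hn : 0 < n) (hκ : 0 < κ) (hη : 0 < η) (h0 : η * (u + (u + w) * κ) = ε / 4) (hε : 0 < ε)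
    (h1 : n = lx + cx + (w * p + u * q)) (h2 : n = ly + cy + (u * p + w * q))
    (h3 : u * n ≤ (u + w) * (u * p + η * κ * n)) (hcy : cy ≤ η * n) (hcx : 0 ≤ cx)
    (hl : ly ≤ lx) (hlx : ε / 2 * n ≤ lx) : False := by
  have hu0 : 0 < u := by linarith
  have hw0 : 0 < w := by linarith
  have h5 : n ≤ (u + w) * p + (u + w) * (η * κ * n) := by
    have : (u + w) * (η * κ * n) ≤ u * ((u + w) * (η * κ * n)) :=
      le_mul_of_one_le_left (by positivity) hu
    refine le_of_mul_le_mul_left ?_ (by linarith : 0 < u)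
    nlinarith
  have h6 : (w - u) * n = (w - u) * ((w + u) * p) + w * cx + w * lx - u * cy - u * ly := by
    have e1 : w * n = w * (lx + cx + (w * p + u * q)) := by rw [← h1]
    have e2 : u * n = u * (ly + cy + (u * p + w * q)) := by rw [← h2]
    linear_combination e1 - e2
  have h7 : (w - u) * n ≤ (w - u) * ((u + w) * p + (u + w) * (η * κ * n)) :=
    mul_le_mul_of_nonneg_left h5 (by linarith)
  have h8 : 0 ≤ w * cx := by positivity
  have h9 : u * cy ≤ u * (η * n) := by gcongr
  have h10 : u * ly ≤ u * lx := by gcongr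
  have h11 : u * (η * n) ≤ (w - u) * (u * (η * n)) :=
    le_mul_of_one_le_left (by positivity) (by linarith)
  have h12 : (w - u) * lx ≤ (w - u) * (η * (u + (u + w) * κ) * n) := by nlinarith
  have h13 := le_of_mul_le_mul_left h12 (by linarith)
  rw [h0] at h13
  have : 0 < ε * n := by positivity
  linarith

set_option maxHeartbeats 800000 in
/-- Almost-tilings can be improved: the case `u < w`. -/
lemma core_of_lt_aux (hu : 1 ≤ u) (huw : u < w) {ε : ℝ} (hε : 0 < ε) :
    ∃ M : ℕ, 1 ≤ M ∧ ∃ δ : ℝ, 0 < δ ∧ ∀ N : ℕ, 1 ≤ N → ∃ n0 : ℕ, ∀ n ≥ n0, ∀ {V : Type}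
      (G : SimpleGraph V) (X Y : Finset V) (T : Finset (Finset V × Finset V)) (C L : Finset V),
      Bal G X Y u w n → Layout G X Y (u * N * M) (w * N * M) T C L → (#C : ℝ) ≤ δ * n →
      ε * n ≤ #L → #(L ∩ Y) ≤ #(L ∩ X) → Improvable G X Y (u * N) (w * N) T L N 1 := by
  have hu0 : 0 < u := hu
  have hw0 : 0 < w := by omega
  set κ : ℝ := 2 / ε + 2 with hκ
  set η : ℝ := ε / (4 * (u + (u + w) * κ)) with hη
  have hu' : (1:ℝ) ≤ u := by exact_mod_cast hu
  have hw' : (u:ℝ) + 1 ≤ w := by exact_mod_cast huw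
  have hκ0 : 0 < κ := by positivity
  have hη0 : 0 < η := by positivity
  have hηε : η * (u + (u + w) * κ) = ε / 4 := by
    rw [hη]; field_simp
  obtain ⟨M, hM⟩ := exists_nat_gt (2 * u / η + u)
  have hM1 : (u : ℝ) < M := lt_of_le_of_lt (le_add_of_nonneg_left (by positivity)) hM
  have hM2 : 2 * u / η < M := lt_of_le_of_lt (by simp) hM
  have hMu : u ≤ M := by exact_mod_cast hM1.le
  rw [div_lt_iff₀ hη0] at hM2
  refine ⟨M, hu.trans hMu, η, hη0, fun N hN => ?_⟩
  have hN0 : 0 < N := hN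
  obtain ⟨n1, hn1⟩ := exists_joined_of_many_edges η hη0 (w * N) (by positivity)
  obtain ⟨n2, hn2⟩ := exists_nat_gt (2 ^ (w * N * M) * (w * (w * N)) / (η / 2 * (ε / 2)))
  rw [div_lt_iff₀ (by positivity)] at hn2
  refine ⟨n1 + n2 + 1, fun n hn V G X Y T C L hB hLay hC hL hLL => ?_⟩
  have hn' : (0:ℝ) < n := by exact_mod_cast (by omega : 0 < n)
  have hn2' : (2 ^ (w * N * M) * (w * (w * N)) : ℝ) ≤ η / 2 * (ε / 2 * n) := by
    have : (n2 : ℝ) ≤ n := by exact_mod_cast (by omega : n2 ≤ n)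
    have h1 : (n2 : ℝ) * (η / 2 * (ε / 2)) ≤ n * (η / 2 * (ε / 2)) := by gcongr
    linarith
  by_contra hno
  have hdLXY : Disjoint (L ∩ X) (L ∩ Y) :=
    Disjoint.mono inter_subset_right inter_subset_right hB.disj
  have hLsum : #L = #(L ∩ X) + #(L ∩ Y) := by
    rw [← card_union_of_disjoint hdLXY, ← inter_union_distrib_left,
      inter_eq_left.2 hLay.subL]
  have hLX : ε / 2 * n ≤ #(L ∩ X) := by
    have : (#L : ℝ) = #(L ∩ X) + #(L ∩ Y) := by exact_mod_cast hLsum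
    have : (#(L ∩ Y) : ℝ) ≤ #(L ∩ X) := by exact_mod_cast hLL
    linarith
  -- no dense leftover
  have hLL' : (eAB G (L ∩ X) (L ∩ Y) : ℝ) ≤ η * n ^ 2 := by
    by_contra! hcon
    obtain ⟨S, hS, Q, hQ, hcS, hcQ, hJ⟩ := hn1 n (by omega) G (L ∩ X) (L ∩ Y)
      (by rw [← hB.cardX]; exact card_le_card inter_subset_right)
      (by rw [← hB.cardY]; exact card_le_card inter_subset_right) hcon.le
    obtain ⟨S', hS', hcS'⟩ := exists_subset_card_eq (s := S) (n := u * N)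
      (by rw [hcS]; exact Nat.mul_le_mul_right _ huw.le)
    have hS'L := hS'.trans hS
    refine hno (hLay.improvable hB.disj (S := ∅) (empty_subset _) (R := S' ∪ Q) ?_
      (Tiled.single (hS'L.trans inter_subset_right) (hQ.trans inter_subset_right)
        (Or.inl ⟨hcS', hcQ⟩) (hJ.mono hS' subset_rfl)) (u * N + w * N) (by positivity) (by simp) ?_)
    · exact (union_subset (hS'L.trans inter_subset_left)
        (hQ.trans inter_subset_left)).trans subset_union_left
    · rw [card_union_of_disjoint (Disjoint.mono hS'L hQ hdLXY), hcS', hcQ]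
      simp
  set T1 := T.filter fun τ => #τ.1 = u * N * M with hT1
  have hlt : u * N * M < w * N * M := by
    have : 0 < N * M := Nat.mul_pos (by omega) (by omega)
    have := Nat.mul_lt_mul_of_pos_right huw this
    rwa [← mul_assoc, ← mul_assoc] at this
  have hs1 : ∀ τ ∈ T1, #τ.1 = u * N * M ∧ #τ.2 = w * N * M := by
    intro τ hτ
    rw [hT1, mem_filter] at hτ
    have := hLay.fam.size τ hτ.1
    omega
  have hs2 : ∀ τ ∈ T \ T1, #τ.1 = w * N * M ∧ #τ.2 = u * N * M := by
    intro τ hτ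
    rw [hT1, mem_sdiff, mem_filter] at hτ
    have := hLay.fam.size τ hτ.1
    tauto
  have hsp : ∀ τ ∈ T1, (eAB G (L ∩ X) τ.2 : ℝ) ≤ η * #(L ∩ X) * #τ.2 := by
    intro τ hτ
    by_contra! hcon
    obtain ⟨h1, h2⟩ := hs1 τ hτ
    have hτT : τ ∈ T := (mem_filter.1 hτ).1
    obtain ⟨S, hS, Q', hQ', hcS, hcQ', hJ⟩ := exists_joined_of_dense (L ∩ X) τ.2 hη0 (w * (u * N))
      (w * (w * N)) hcon.le
      (by
        rw [h2]; push_cast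
        have : (0:ℝ) ≤ w * N := by positivity
        nlinarith) (by positivity) (by positivity)
      (by
        rw [h2]; push_cast
        refine hn2'.trans ?_
        gcongr)
    have hdLτ : Disjoint (L ∩ X) (τ.1 ∪ τ.2) :=
      Disjoint.mono inter_subset_left (subset_cov hτT) hLay.disjLT
    obtain ⟨R, hR, hRt, hRc⟩ := exists_exchange hB.disj huw.le (hLay.fam.left τ hτT)
      (hLay.fam.right τ hτT) (hLay.fam.joined τ hτT) h1 h2 hQ' (hS.trans inter_subset_right)
      (Disjoint.mono hS subset_union_left hdLτ) hJ hcS hcQ' hMu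
    refine hno (hLay.improvable hB.disj (S := {τ}) (singleton_subset_iff.2 hτT) (R := R) ?_ hRt
      ((w * w - u * u) * N) ?_ ?_ ?_)
    · rw [cov_singleton]
      exact hR.trans (union_subset_union (hS.trans inter_subset_left) subset_rfl)
    · exact Nat.mul_pos (Nat.sub_pos_of_lt (by nlinarith)) (by omega)
    · rw [card_singleton, mul_one, one_mul]
      exact Nat.le_mul_of_pos_left _ (Nat.sub_pos_of_lt (by nlinarith))
    · rw [card_singleton, mul_one]; exact hRc
  have hcr := hLay.card_right hB.disj
  have hcl := hLay.card_left hB.disj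
  have hb := bound_of_sparse (A := L ∩ X) (L := L ∩ Y) (C := C ∩ Y) (Y := Y) (S := T) (S1 := T1)
    (f := Prod.snd) (n := n) (u := u) (w := w) (G := G) (η := η) (δ := η) (α := ε / 2)
    (fun x hx => hB.degX x (mem_inter.1 hx).2) (hLay.cover_right hB.disj).subset
    (filter_subset _ _) hη0 (by positivity) (by omega) hsp (by rw [← hB.cardY, hcr]; omega) hLL'
    (le_trans (by exact_mod_cast card_le_card inter_subset_left) hC) hLX
  rw [hB.cardX, ← sum_sdiff (filter_subset _ _ : T1 ⊆ T),
    sum_congr rfl fun τ hτ => (hs2 τ hτ).1, sum_congr rfl fun τ hτ => (hs1 τ hτ).1,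
    sum_const, sum_const, smul_eq_mul, smul_eq_mul] at hcl
  rw [hB.cardY, ← sum_sdiff (filter_subset _ _ : T1 ⊆ T),
    sum_congr rfl fun τ hτ => (hs2 τ hτ).2, sum_congr rfl fun τ hτ => (hs1 τ hτ).2,
    sum_const, sum_const, smul_eq_mul, smul_eq_mul] at hcr
  rw [sum_congr rfl fun τ hτ => (hs2 τ hτ).2, sum_const, smul_eq_mul] at hb
  have hcl' : (n : ℝ) = #(L ∩ X) + #(C ∩ X) + (#(T \ T1) * (w * N * M) + #T1 * (u * N * M)) := by
    exact_mod_cast hcl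
  have hcr' : (n : ℝ) = #(L ∩ Y) + #(C ∩ Y) + (#(T \ T1) * (u * N * M) + #T1 * (w * N * M)) := by
    exact_mod_cast hcr
  push_cast at hb
  have hCY : (#(C ∩ Y) : ℝ) ≤ η * n :=
    le_trans (by exact_mod_cast card_le_card inter_subset_left) hC
  have hCX : (0 : ℝ) ≤ #(C ∩ X) := by positivity
  have hLL2 : (#(L ∩ Y) : ℝ) ≤ #(L ∩ X) := by exact_mod_cast hLL
  have hκ' : η / (ε / 2) + η + η = η * κ := by rw [hκ]; field_simp; ring
  rw [hκ'] at hb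
  exact unbal_contra hu' hw' hn' hκ0 hη0 hηε hε (p := #(T \ T1) * N * M) (q := #T1 * N * M)
    (by rw [hcl']; ring) (by rw [hcr']; ring) (by linarith) hCY hCX hLL2 hLX

lemma card_eq_inter_add_inter (hXY : Disjoint X Y) (hL : L ⊆ X ∪ Y) :
    #L = #(L ∩ X) + #(L ∩ Y) := by
  rw [← card_union_of_disjoint (Disjoint.mono inter_subset_right inter_subset_right hXY),
    ← inter_union_distrib_left, inter_eq_left.2 hL]

/-- Almost-tilings can be improved: the case `u < w`. -/
lemma core_of_lt (hu : 1 ≤ u) (huw : u < w) {ε : ℝ} (hε : 0 < ε) :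
    ∃ M : ℕ, 1 ≤ M ∧ ∃ δ : ℝ, 0 < δ ∧ ∀ N : ℕ, 1 ≤ N → ∃ n0 : ℕ, ∀ n ≥ n0, ∀ {V : Type}
      (G : SimpleGraph V) (X Y : Finset V) (T : Finset (Finset V × Finset V)) (C L : Finset V),
      Bal G X Y u w n → Layout G X Y (u * N * M) (w * N * M) T C L → (#C : ℝ) ≤ δ * n →
      ε * n ≤ #L → Improvable G X Y (u * N) (w * N) T L N 1 := by
  obtain ⟨M, hM, δ, hδ, h⟩ := core_of_lt_aux hu huw hε
  refine ⟨M, hM, δ, hδ, fun N hN => ?_⟩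
  obtain ⟨n0, h0⟩ := h N hN
  refine ⟨n0, fun n hn V G X Y T C L hB hLay hC hL => ?_⟩
  rcases le_total #(L ∩ Y) #(L ∩ X) with h1 | h1
  · exact h0 n hn G X Y T C L hB hLay hC hL h1
  · exact (h0 n hn G Y X _ C L hB.swap hLay.swap hC hL h1).swap

/-- The exchange of parts of both sides of a balanced tile. -/
lemma exists_exchange_balanced (hXY : Disjoint X Y) {k M : ℕ} (hM : 1 ≤ M)
    {P Q S S' P' Q' : Finset V} (hP : P ⊆ X) (hQ : Q ⊆ Y) (hJ : Joined G P Q)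
    (hcP : #P = k * M) (hcQ : #Q = k * M) (hQ' : Q' ⊆ Q) (hP' : P' ⊆ P)
    (hS : S ⊆ X) (hSP : Disjoint S P) (hSQ : Joined G S Q') (hcS : #S = k) (hcQ' : #Q' = k)
    (hS' : S' ⊆ Y) (hSQ' : Disjoint S' Q) (hSP' : Joined G P' S') (hcS' : #S' = k)
    (hcP' : #P' = k) :
    ∃ R ⊆ S ∪ S' ∪ (P ∪ Q), Tiled G X Y k k R ∧ #R = (k * M + k * M) + 2 * k := by
  obtain ⟨m, rfl⟩ := Nat.exists_eq_add_of_le hM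
  have hcQQ : #(Q \ Q') = m * k := by
    rw [card_sdiff_of_subset hQ', hcQ, hcQ', mul_add, mul_one, Nat.add_sub_cancel_left, mul_comm]
  have hcPP : #(P \ P') = m * k := by
    rw [card_sdiff_of_subset hP', hcP, hcP', mul_add, mul_one, Nat.add_sub_cancel_left, mul_comm]
  have hd : ∀ A B : Finset V, A ⊆ X → B ⊆ Y → Disjoint A B := fun A B hA hB =>
    Disjoint.mono hA hB hXY
  have t1 : Tiled G X Y k k (S ∪ Q') :=
    Tiled.single hS (hQ'.trans hQ) (Or.inl ⟨hcS, hcQ'⟩) hSQ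
  have t2 : Tiled G X Y k k (P' ∪ S') :=
    Tiled.single (hP'.trans hP) hS' (Or.inl ⟨hcP', hcS'⟩) hSP'
  have t3 : Tiled G X Y k k (P \ P' ∪ Q \ Q') :=
    tiled_of_joined hXY (sdiff_subset.trans hP) (sdiff_subset.trans hQ)
      (hJ.mono sdiff_subset sdiff_subset) m 0 (by rw [hcPP]; ring) (by rw [hcQQ]; ring)
  have d1 : Disjoint (S ∪ Q') (P' ∪ S') := by
    simp only [disjoint_union_left, disjoint_union_right]
    exact ⟨⟨disjoint_of_subset_right hP' hSP, (hd _ _ (hP'.trans hP) (hQ'.trans hQ)).symm⟩,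
      hd _ _ hS hS', (disjoint_of_subset_right hQ' hSQ').symm⟩
  have d2 : Disjoint (S ∪ Q' ∪ (P' ∪ S')) (P \ P' ∪ Q \ Q') := by
    simp only [disjoint_union_left, disjoint_union_right]
    exact ⟨⟨⟨disjoint_of_subset_right sdiff_subset hSP,
      (hd _ _ (sdiff_subset.trans hP) (hQ'.trans hQ)).symm⟩, disjoint_sdiff,
      (hd _ _ (sdiff_subset.trans hP) hS').symm⟩,
      ⟨hd _ _ hS (sdiff_subset.trans hQ), disjoint_sdiff⟩,
      hd _ _ (hP'.trans hP) (sdiff_subset.trans hQ), disjoint_of_subset_right sdiff_subset hSQ'⟩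
  refine ⟨_, ?_, (t1.union t2 d1).union t3 d2, ?_⟩
  · intro v
    have := @hQ' v
    have := @hP' v
    simp only [mem_union, mem_sdiff]
    tauto
  · rw [card_union_of_disjoint d2, card_union_of_disjoint d1,
      card_union_of_disjoint (hd _ _ hS (hQ'.trans hQ)),
      card_union_of_disjoint (hd _ _ (hP'.trans hP) hS'),
      card_union_of_disjoint (hd _ _ (sdiff_subset.trans hP) (sdiff_subset.trans hQ)),
      hcS, hcS', hcP', hcQ', hcPP, hcQQ]
    ring

set_option maxHeartbeats 800000 in
/-- Almost-tilings can be improved: the case `u = w`. -/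
lemma core_of_eq (hu : 1 ≤ u) {ε : ℝ} (hε : 0 < ε) :
    ∃ M : ℕ, 1 ≤ M ∧ ∃ δ : ℝ, 0 < δ ∧ ∀ N : ℕ, 1 ≤ N → ∃ n0 : ℕ, ∀ n ≥ n0, ∀ {V : Type}
      (G : SimpleGraph V) (X Y : Finset V) (T : Finset (Finset V × Finset V)) (C L : Finset V),
      Bal G X Y u u n → Layout G X Y (u * N * M) (u * N * M) T C L → (#C : ℝ) ≤ δ * n →
      ε * n ≤ #L → Improvable G X Y (u * N) (u * N) T L N 1 := by
  have hu0 : 0 < u := hu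
  have hu' : (0:ℝ) < u := by exact_mod_cast hu
  set κ : ℝ := 4 / ε + 2 with hκ
  set η : ℝ := ε / (16 * κ) with hη
  have hκ0 : 0 < κ := by positivity
  have hη0 : 0 < η := by positivity
  have hηε : η * κ = ε / 16 := by
    rw [hη]; field_simp
  have hη2 : η * 2 ≤ ε / 16 := by
    rw [← hηε]
    refine mul_le_mul_of_nonneg_left ?_ hη0.le
    rw [hκ]
    exact le_add_of_nonneg_left (by positivity)
  obtain ⟨M, hM⟩ := exists_nat_gt (2 / η + 1)
  have hM1 : (1 : ℝ) < M := lt_of_le_of_lt (le_add_of_nonneg_left (by positivity)) hM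
  have hM2 : 2 / η < M := lt_of_le_of_lt (by simp) hM
  have hMu : 1 ≤ M := by exact_mod_cast hM1.le
  rw [div_lt_iff₀ hη0] at hM2
  refine ⟨M, hMu, η, hη0, fun N hN => ?_⟩
  have hN0 : 0 < N := hN
  obtain ⟨n1, hn1⟩ := exists_joined_of_many_edges η hη0 (u * N) (by positivity)
  obtain ⟨n2, hn2⟩ := exists_nat_gt (2 ^ (u * N * M) * (u * N) / (η / 2 * (ε / 4)))
  rw [div_lt_iff₀ (by positivity)] at hn2
  refine ⟨n1 + n2 + 1, fun n hn V G X Y T C L hB hLay hC hL => ?_⟩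
  have hn' : (0:ℝ) < n := by exact_mod_cast (by omega : 0 < n)
  have hn2' : (2 ^ (u * N * M) * (u * N) : ℝ) ≤ η / 2 * (ε / 4 * n) := by
    have : (n2 : ℝ) ≤ n := by exact_mod_cast (by omega : n2 ≤ n)
    have h1 : (n2 : ℝ) * (η / 2 * (ε / 4)) ≤ n * (η / 2 * (ε / 4)) := by gcongr
    linarith
  by_contra hno
  have hdLXY : Disjoint (L ∩ X) (L ∩ Y) :=
    Disjoint.mono inter_subset_right inter_subset_right hB.disj
  have hLsum := card_eq_inter_add_inter hB.disj hLay.subL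
  have hs : ∀ τ ∈ T, #τ.1 = u * N * M ∧ #τ.2 = u * N * M := by
    intro τ hτ
    have := hLay.fam.size τ hτ
    omega
  have hcr := hLay.card_right hB.disj
  have hcl := hLay.card_left hB.disj
  have hcr0 := hcr
  have hcl0 := hcl
  rw [hB.cardX, sum_congr rfl fun τ hτ => (hs τ hτ).1, sum_const, smul_eq_mul] at hcl
  rw [hB.cardY, sum_congr rfl fun τ hτ => (hs τ hτ).2, sum_const, smul_eq_mul] at hcr
  have hcl' : (n : ℝ) = #(L ∩ X) + #(C ∩ X) + #T * (u * N * M) := by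
    exact_mod_cast hcl
  have hcr' : (n : ℝ) = #(L ∩ Y) + #(C ∩ Y) + #T * (u * N * M) := by
    exact_mod_cast hcr
  have hCY : (#(C ∩ Y) : ℝ) ≤ η * n :=
    le_trans (by exact_mod_cast card_le_card inter_subset_left) hC
  have hCX : (#(C ∩ X) : ℝ) ≤ η * n :=
    le_trans (by exact_mod_cast card_le_card inter_subset_left) hC
  have hCX0 : (0 : ℝ) ≤ #(C ∩ X) := by positivity
  have hCY0 : (0 : ℝ) ≤ #(C ∩ Y) := by positivity
  have hηn : η * n * 2 ≤ ε / 16 * n := by nlinarith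
  have hεn : 0 < ε * n := by positivity
  have hLsum' : (#L : ℝ) = #(L ∩ X) + #(L ∩ Y) := by exact_mod_cast hLsum
  have hLX : ε / 4 * n ≤ #(L ∩ X) := by linarith
  have hLY : ε / 4 * n ≤ #(L ∩ Y) := by linarith
  have hLL' : (eAB G (L ∩ X) (L ∩ Y) : ℝ) ≤ η * n ^ 2 := by
    by_contra! hcon
    obtain ⟨S, hS, Q, hQ, hcS, hcQ, hJ⟩ := hn1 n (by omega) G (L ∩ X) (L ∩ Y)
      (by rw [← hB.cardX]; exact card_le_card inter_subset_right)
      (by rw [← hB.cardY]; exact card_le_card inter_subset_right) hcon.le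
    refine hno (hLay.improvable hB.disj (S := ∅) (empty_subset _) (R := S ∪ Q) ?_
      (Tiled.single (hS.trans inter_subset_right) (hQ.trans inter_subset_right)
        (Or.inl ⟨hcS, hcQ⟩) hJ) (u * N + u * N) (by positivity) (by simp) ?_)
    · exact (union_subset (hS.trans inter_subset_left)
        (hQ.trans inter_subset_left)).trans subset_union_left
    · rw [card_union_of_disjoint (Disjoint.mono hS hQ hdLXY), hcS, hcQ]
      simp
  set T1 := T.filter fun τ => (eAB G (L ∩ X) τ.2 : ℝ) ≤ η * #(L ∩ X) * #τ.2 with hT1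
  set T2 := T.filter fun τ => (eAB G (L ∩ Y) τ.1 : ℝ) ≤ η * #(L ∩ Y) * #τ.1 with hT2
  have hkM : (u * N : ℝ) ≤ η / 2 * (u * N * M) := by
    have : (0:ℝ) ≤ u * N := by positivity
    nlinarith
  have hcov : Disjoint (T \ T1) (T \ T2) := by
    rw [disjoint_left]
    intro τ h1 h2
    rw [hT1, mem_sdiff, mem_filter, not_and, not_le] at h1
    rw [hT2, mem_sdiff, mem_filter, not_and, not_le] at h2
    have hτT := h1.1
    obtain ⟨hc1, hc2⟩ := hs τ hτT
    obtain ⟨S, hS, Q', hQ', hcS, hcQ', hJ⟩ := exists_joined_of_dense (L ∩ X) τ.2 hη0 (u * N)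
      (u * N) (h1.2 hτT).le
      (by rw [hc2]; push_cast; exact hkM) (by positivity) (by positivity)
      (by
        rw [hc2]; push_cast
        refine hn2'.trans ?_
        gcongr)
    obtain ⟨S', hS', P', hP', hcS', hcP', hJ'⟩ := exists_joined_of_dense (L ∩ Y) τ.1 hη0 (u * N)
      (u * N) (h2.2 hτT).le
      (by rw [hc1]; push_cast; exact hkM) (by positivity) (by positivity)
      (by
        rw [hc1]; push_cast
        refine hn2'.trans ?_
        gcongr)
    have hdLτ : Disjoint L (τ.1 ∪ τ.2) := disjoint_of_subset_right (subset_cov hτT) hLay.disjLT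
    obtain ⟨R, hR, hRt, hRc⟩ := exists_exchange_balanced hB.disj hMu (hLay.fam.left τ hτT)
      (hLay.fam.right τ hτT) (hLay.fam.joined τ hτT) hc1 hc2 hQ' hP' (hS.trans inter_subset_right)
      (Disjoint.mono (hS.trans inter_subset_left) subset_union_left hdLτ) hJ hcS hcQ'
      (hS'.trans inter_subset_right)
      (Disjoint.mono (hS'.trans inter_subset_left) subset_union_right hdLτ) hJ'.symm hcS' hcP'
    refine hno (hLay.improvable hB.disj (S := {τ}) (singleton_subset_iff.2 hτT) (R := R) ?_ hRt
      (2 * (u * N)) (by positivity) ?_ ?_)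
    · rw [cov_singleton]
      exact hR.trans (union_subset_union (union_subset (hS.trans inter_subset_left)
        (hS'.trans inter_subset_left)) subset_rfl)
    · rw [card_singleton, mul_one, one_mul]
      nlinarith
    · rw [card_singleton, mul_one, hRc]
  have hb := bound_of_sparse (A := L ∩ X) (L := L ∩ Y) (C := C ∩ Y) (Y := Y) (S := T) (S1 := T1)
    (f := Prod.snd) (n := n) (u := u) (w := u) (G := G) (η := η) (δ := η) (α := ε / 4)
    (fun x hx => hB.degX x (mem_inter.1 hx).2) (hLay.cover_right hB.disj).subset
    (filter_subset _ _) hη0 (by positivity) (by omega) (fun τ hτ => (mem_filter.1 hτ).2)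
    (by rw [← hB.cardY, hcr0]; omega) hLL' hCY hLX
  have hcov' := hLay.swap.cover_right hB.disj.symm
  have hb' := bound_of_sparse (A := L ∩ Y) (L := L ∩ X) (C := C ∩ X) (Y := X) (S := T) (S1 := T2)
    (f := Prod.fst) (n := n) (u := u) (w := u) (G := G) (η := η) (δ := η) (α := ε / 4)
    (fun x hx => hB.degY x (mem_inter.1 hx).2)
    (by
      rw [image_biUnion] at hcov'
      exact hcov'.subset)
    (filter_subset _ _) hη0 (by positivity) (by omega) (fun τ hτ => (mem_filter.1 hτ).2)
    (by rw [← hB.cardX, hcl0]; omega) (by rw [eAB_comm]; exact hLL') hCX hLY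
  rw [sum_congr rfl fun τ hτ => (hs τ (mem_sdiff.1 hτ).1).2, sum_const, smul_eq_mul] at hb
  rw [sum_congr rfl fun τ hτ => (hs τ (mem_sdiff.1 hτ).1).1, sum_const, smul_eq_mul] at hb'
  have hκ' : η / (ε / 4) + η + η = η * κ := by rw [hκ]; field_simp; ring
  rw [hκ', hηε] at hb hb'
  have hc : #(T \ T1) + #(T \ T2) ≤ #T := by
    rw [← card_union_of_disjoint hcov]
    exact card_le_card (union_subset sdiff_subset sdiff_subset)
  have hc' : (#(T \ T1) : ℝ) + #(T \ T2) ≤ #T := by exact_mod_cast hc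
  have hc2 : ((#(T \ T1) : ℝ) + #(T \ T2)) * (u * N * M) ≤ #T * (u * N * M) := by gcongr
  push_cast at hb hb'
  have e1 : (n : ℝ) ≤ 2 * (#(T \ T1) * (u * N * M) + ε / 16 * n) := by
    refine le_of_mul_le_mul_left ?_ hu'
    linarith
  have e2 : (n : ℝ) ≤ 2 * (#(T \ T2) * (u * N * M) + ε / 16 * n) := by
    refine le_of_mul_le_mul_left ?_ hu'
    linarith
  linarith

/-- Almost-tilings can be improved. -/
lemma core_improvable (hu : 1 ≤ u) (huw : u ≤ w) {ε : ℝ} (hε : 0 < ε) :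
    ∃ M : ℕ, 1 ≤ M ∧ ∃ δ : ℝ, 0 < δ ∧ ∀ N : ℕ, 1 ≤ N → ∃ n0 : ℕ, ∀ n ≥ n0, ∀ {V : Type}
      (G : SimpleGraph V) (X Y : Finset V) (T : Finset (Finset V × Finset V)) (C L : Finset V),
      Bal G X Y u w n → Layout G X Y (u * N * M) (w * N * M) T C L → (#C : ℝ) ≤ δ * n →
      ε * n ≤ #L → Improvable G X Y (u * N) (w * N) T L N 1 := by
  rcases huw.eq_or_lt with rfl | h
  · exact core_of_eq hu hε
  · exact core_of_lt hu h hε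

/-- `G` always has a `K_{uN,wN}`-tiling leaving at most `lam n` vertices uncovered. -/
def AlmostTiling (u w : ℕ) (lam : ℝ) : Prop :=
  ∀ N : ℕ, 1 ≤ N → ∃ n0 : ℕ, ∀ n ≥ n0, ∀ {V : Type} (G : SimpleGraph V) (X Y : Finset V),
    Bal G X Y u w n → ∃ A ⊆ X ∪ Y, Tiled G X Y (u * N) (w * N) A ∧
      (#((X ∪ Y) \ A) : ℝ) ≤ lam * n

lemma AlmostTiling.mono {lam lam' : ℝ} (h : AlmostTiling u w lam) (hl : lam ≤ lam') :
    AlmostTiling u w lam' := by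
  intro N hN
  obtain ⟨n0, h0⟩ := h N hN
  refine ⟨n0, fun n hn V G X Y hB => ?_⟩
  obtain ⟨A, hA, ht, hc⟩ := h0 n hn G X Y hB
  exact ⟨A, hA, ht, hc.trans (by gcongr)⟩

lemma AlmostTiling.two : AlmostTiling u w 2 := by
  intro N _
  refine ⟨0, fun n _ V G X Y hB => ⟨∅, empty_subset _, Tiled.nil, ?_⟩⟩
  rw [sdiff_empty, card_union_of_disjoint hB.disj, hB.cardX, hB.cardY]
  push_cast
  linarith

lemma exists_improvement (hu : 1 ≤ u) (huw : u ≤ w) {ε : ℝ} (hε : 0 < ε) :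
    ∃ c : ℝ, 0 < c ∧ ∀ lam, ε ≤ lam → AlmostTiling u w lam → AlmostTiling u w (lam - c) := by
  obtain ⟨M, hM, δ, hδ, hcore⟩ := core_improvable hu huw (half_pos hε)
  refine ⟨min (ε / 2) (δ / ((u + w) * M + 1)), by positivity, fun lam hlam h N hN => ?_⟩
  set c := min (ε / 2) (δ / ((u + w) * M + 1))
  have hc1 : c ≤ ε / 2 := min_le_left _ _
  have hc2 : c * ((u + w) * M + 1) ≤ δ := by
    rw [← le_div_iff₀ (by positivity)]; exact min_le_right _ _
  obtain ⟨n1, h1⟩ := hcore N hN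
  obtain ⟨n2, h2⟩ := h (N * M) (Nat.mul_pos hN hM)
  refine ⟨n1 + n2, fun n hn V G X Y hB => ?_⟩
  obtain ⟨A, hA, ht, hc⟩ := h2 n (by omega) G X Y hB
  rw [← mul_assoc, ← mul_assoc] at ht
  obtain ⟨T, hT, rfl⟩ := ht.exists_fam
  obtain ⟨R, hR, hRt, hRc⟩ := augment hT hB.disj (fun τ hτ => hT.tiled_tile hB.disj hτ) N 1
    (fun k => (lam - c) * n < k) (fun T' hT' C L _ hCL hCLT hall hg hcard hbad => by
      refine h1 n (by omega) G X Y T' C L hB ⟨hT.subset hT', hCL, hCLT, hall⟩ ?_ ?_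
      · have g1 : (N * #(T \ T') + 1 * #L : ℝ) ≤ 1 * #((X ∪ Y) \ cov T) := by exact_mod_cast hg
        have g2 : (#C + #L : ℝ) = #((X ∪ Y) \ cov T) +
          (u * N * M + w * N * M) * #(T \ T') := by exact_mod_cast hcard
        have g3 : (N * #(T \ T') : ℝ) ≤ c * n := by linarith
        have g4 : ((u + w) * M) * (N * #(T \ T') : ℝ) ≤ ((u + w) * M) * (c * n) := by gcongr
        have g5 : c * ((u + w) * M + 1) * n ≤ δ * n := by gcongr
        linarith
      · refine le_trans ?_ hbad.le
        gcongr
        linarith)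
  exact ⟨R, hR, hRt, not_lt.1 hRc⟩

/-- Almost perfect tilings exist. -/
theorem almostTiling (hu : 1 ≤ u) (huw : u ≤ w) {ε : ℝ} (hε : 0 < ε) : AlmostTiling u w ε := by
  obtain ⟨c, hc, hstep⟩ := exists_improvement hu huw hε
  have key : ∀ k : ℕ, AlmostTiling u w (max ε (2 - k * c)) := by
    intro k
    induction k with
    | zero => exact AlmostTiling.two.mono (by simp)
    | succ k ih =>
      by_cases h : 2 - k * c ≤ ε
      · rw [max_eq_left h] at ih
        exact ih.mono (le_max_left _ _)
      · rw [max_eq_right (not_le.1 h).le] at ih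
        refine (hstep _ (not_le.1 h).le ih).mono (le_trans ?_ (le_max_right _ _))
        push_cast
        linarith
  obtain ⟨k, hk⟩ := exists_nat_gt (2 / c)
  rw [div_lt_iff₀ hc] at hk
  exact (key k).mono (max_le le_rfl (by linarith))

/-! ### Inserting vertices into tiles -/

/-- Vertices of `S` with many neighbours in `Q` are covered using part of a complete pair. -/
lemma exists_insertion (hXY : Disjoint X Y) {p q : ℕ} (hpq : p = u ∧ q = w ∨ p = w ∧ q = u)
    (hp : 1 ≤ p) (S : Finset V) : ∀ {P Q : Finset V}, P ⊆ X → Q ⊆ Y → Joined G P Q → S ⊆ X →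
    Disjoint S P → (∀ x ∈ S, q * #S ≤ degIn G x Q) → (p - 1) * #S ≤ #P →
    ∃ P' ⊆ P, ∃ Q' ⊆ Q, #P' = (p - 1) * #S ∧ #Q' = q * #S ∧ Tiled G X Y u w (S ∪ P' ∪ Q') := by
  induction S using Finset.induction_on with
  | empty =>
    intro P Q _ _ _ _ _ _ _
    exact ⟨∅, empty_subset _, ∅, empty_subset _, by simp, by simp, by simpa using Tiled.nil⟩
  | insert v S hv ih =>
    intro P Q hP hQ hJ hS hSP hdeg hcP
    rw [card_insert_of_notMem hv, mul_add, mul_one] at hcP hdeg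
    rw [card_insert_of_notMem hv, mul_add, mul_one, mul_add, mul_one]
    have hvd := hdeg v (mem_insert_self _ _)
    obtain ⟨B, hB, hcB⟩ := exists_subset_card_eq (s := Q.filter fun y => G.Adj v y) (n := q)
      (by unfold degIn at hvd; omega)
    have hBQ : B ⊆ Q := hB.trans (filter_subset _ _)
    obtain ⟨A, hA, hcA⟩ := exists_subset_card_eq (s := P) (n := p - 1) (by omega)
    rw [disjoint_insert_left] at hSP
    have hvX : v ∈ X := hS (mem_insert_self _ _)
    have hSX : S ⊆ X := (subset_insert _ _).trans hS
    obtain ⟨P', hP', Q', hQ', hcP', hcQ', ht⟩ := ih (P := P \ A) (Q := Q \ B)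
      (sdiff_subset.trans hP) (sdiff_subset.trans hQ) (hJ.mono sdiff_subset sdiff_subset) hSX
      (disjoint_of_subset_right sdiff_subset hSP.2)
      (by
        intro x hx
        have h1 := hdeg x (mem_insert_of_mem hx)
        have h2 : degIn G x Q ≤ degIn G x B + degIn G x (Q \ B) := by
          refine le_trans (degIn_mono x ?_) (degIn_union_le _ _ _)
          rw [union_sdiff_of_subset hBQ]
        have h3 := degIn_le (G := G) x B
        omega)
      (by rw [card_sdiff_of_subset hA]; omega)
    have hvA : v ∉ A := fun h => hSP.1 (hA h)
    have t1 : Tiled G X Y u w (insert v A ∪ B) := by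
      refine Tiled.single (insert_subset hvX (hA.trans hP)) (hBQ.trans hQ) ?_ ?_
      · rw [card_insert_of_notMem hvA, hcA, hcB]; omega
      · intro x hx y hy
        rcases mem_insert.1 hx with rfl | hx
        · exact (mem_filter.1 (hB hy)).2
        · exact hJ x (hA hx) y (hBQ hy)
    have hd : ∀ A B : Finset V, A ⊆ X → B ⊆ Y → Disjoint A B := fun A B hA hB =>
      Disjoint.mono hA hB hXY
    have hvY : v ∉ Y := disjoint_left.1 hXY hvX
    have d1 : Disjoint A P' := (disjoint_of_subset_left hP' sdiff_disjoint).symm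
    have d2 : Disjoint B Q' := (disjoint_of_subset_left hQ' sdiff_disjoint).symm
    refine ⟨A ∪ P', union_subset hA (hP'.trans sdiff_subset), B ∪ Q',
      union_subset hBQ (hQ'.trans sdiff_subset), ?_, ?_, ?_⟩
    · rw [card_union_of_disjoint d1, hcA, hcP', add_comm]
    · rw [card_union_of_disjoint d2, hcB, hcQ', add_comm]
    · have e : insert v S ∪ (A ∪ P') ∪ (B ∪ Q') = (insert v A ∪ B) ∪ (S ∪ P' ∪ Q') := by
        ext z; simp only [mem_union, mem_insert]; tauto
      rw [e]
      refine t1.union ht ?_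
      have hP'P := hP'.trans sdiff_subset
      have hQ'Y := (hQ'.trans sdiff_subset).trans hQ
      have f1 := disjoint_of_subset_left hA hSP.2.symm
      have f2 : v ∉ P' := fun h => hSP.1 (hP'P h)
      have f3 : v ∉ Q' := fun h => hvY (hQ'Y h)
      have f4 := hd _ _ (hA.trans hP) hQ'Y
      have f5 := (hd _ _ hSX (hBQ.trans hQ)).symm
      have f6 := (hd _ _ (hP'P.trans hP) (hBQ.trans hQ)).symm
      simp only [disjoint_union_left, disjoint_union_right, disjoint_insert_left, hv, d1, d2, f1, f2,
        f3, f4, f5, f6, not_false_eq_true, and_self]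

variable {N K : ℕ}

/-- In a tile, one vertex may be exchanged for a vertex with enough neighbours. -/
lemma IsFam.tiled_exchange (hT : IsFam G X Y (u * N) (w * N) T) (hXY : Disjoint X Y) (hu : 1 ≤ u)
    (huw : u ≤ w) (hN : 1 ≤ N) {τ : Finset V × Finset V} (hτ : τ ∈ T) {v x : V} (hv : v ∈ X)
    (hvτ : v ∉ τ.1) (hd : w ≤ degIn G v τ.2) (hx : x ∈ τ.1) :
    Tiled G X Y u w ((insert v (τ.1 ∪ τ.2)).erase x) := by
  obtain ⟨k, rfl⟩ := Nat.exists_eq_add_of_le hN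
  have main : ∀ p q : ℕ, (p = u ∧ q = w ∨ p = w ∧ q = u) → 1 ≤ p → q ≤ w → #τ.1 = p * (1 + k) →
      #τ.2 = q * (1 + k) → Tiled G X Y u w ((insert v (τ.1 ∪ τ.2)).erase x) := by
    intro p q hpq hp hqw hc1 hc2
    rw [mul_add, mul_one] at hc1 hc2
    have hPX := hT.left τ hτ
    have hQY := hT.right τ hτ
    have hce : #(τ.1.erase x) = p - 1 + p * k := by
      rw [card_erase_of_mem hx, hc1]; omega
    obtain ⟨P', hP', Q', hQ', hcP', hcQ', ht⟩ := exists_insertion (G := G) hXY hpq hp {v}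
      ((erase_subset x _).trans hPX) hQY ((hT.joined τ hτ).mono (erase_subset x _) subset_rfl)
      (singleton_subset_iff.2 hv)
      (disjoint_singleton_left.2 fun h => hvτ (erase_subset _ _ h))
      (by
        intro z hz
        rw [mem_singleton] at hz
        subst hz
        simpa using hqw.trans hd)
      (by rw [hce]; simp)
    rw [card_singleton, mul_one] at hcP' hcQ'
    have hvY : v ∉ Y := disjoint_left.1 hXY hv
    have hxY : x ∉ Y := disjoint_left.1 hXY (hPX hx)
    have hP'X := (hP'.trans (erase_subset x _)).trans hPX
    have t2 : Tiled G X Y u w (τ.1.erase x \ P' ∪ τ.2 \ Q') := by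
      have h1 : #(τ.1.erase x \ P') = p * k := by rw [card_sdiff_of_subset hP']; omega
      have h2 : #(τ.2 \ Q') = q * k := by rw [card_sdiff_of_subset hQ']; omega
      have hJ : Joined G (τ.1.erase x \ P') (τ.2 \ Q') :=
        (hT.joined τ hτ).mono (sdiff_subset.trans (erase_subset _ _)) sdiff_subset
      have hsX : τ.1.erase x \ P' ⊆ X := sdiff_subset.trans ((erase_subset x _).trans hPX)
      have hsY : τ.2 \ Q' ⊆ Y := sdiff_subset.trans hQY
      rcases hpq with ⟨rfl, rfl⟩ | ⟨rfl, rfl⟩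
      · exact tiled_of_joined hXY hsX hsY hJ k 0 (by rw [h1]; ring) (by rw [h2]; ring)
      · exact tiled_of_joined hXY hsX hsY hJ 0 k (by rw [h1]; ring) (by rw [h2]; ring)
    have hvx : v ≠ x := fun h => hvτ (h ▸ hx)
    have hxQ : x ∉ τ.2 := fun h => hxY (hQY h)
    have e : (insert v (τ.1 ∪ τ.2)).erase x = ({v} ∪ P' ∪ Q') ∪ (τ.1.erase x \ P' ∪ τ.2 \ Q') := by
      rw [erase_insert_of_ne hvx, erase_union_distrib, erase_eq_of_notMem hxQ]
      conv_lhs => rw [← union_sdiff_of_subset hP', ← union_sdiff_of_subset hQ']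
      rw [union_union_union_comm, ← insert_union, ← insert_union, insert_eq]
    rw [e]
    refine ht.union t2 ?_
    have hdd : ∀ A B : Finset V, A ⊆ X → B ⊆ Y → Disjoint A B := fun A B hA hB =>
      Disjoint.mono hA hB hXY
    have f1 : v ∉ τ.1.erase x \ P' := fun h => hvτ (erase_subset _ _ (sdiff_subset h))
    have f2 : Disjoint P' (τ.1.erase x \ P') := disjoint_sdiff
    have f3 : Disjoint Q' (τ.1.erase x \ P') :=
      (hdd _ _ (sdiff_subset.trans ((erase_subset x _).trans hPX)) (hQ'.trans hQY)).symm
    have f4 : v ∉ τ.2 \ Q' := fun h => hvY (hQY (sdiff_subset h))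
    have f5 : Disjoint P' (τ.2 \ Q') := hdd _ _ hP'X (sdiff_subset.trans hQY)
    have f6 : Disjoint Q' (τ.2 \ Q') := disjoint_sdiff
    simp only [disjoint_union_left, disjoint_union_right, disjoint_singleton_left, f1, f2, f3, f4,
      f5, f6, not_false_eq_true, and_self]
  rcases hT.size τ hτ with ⟨h1, h2⟩ | ⟨h1, h2⟩
  · exact main u w (Or.inl ⟨rfl, rfl⟩) hu le_rfl h1 h2
  · exact main w u (Or.inr ⟨rfl, rfl⟩) (hu.trans huw) huw h1 h2

/-- Some vertex on the left of `τ` has at least `K` neighbours on the right of `τ'`. -/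
def Arc (G : SimpleGraph V) (K : ℕ) (τ τ' : Finset V × Finset V) : Prop :=
  ∃ x ∈ τ.1, K ≤ degIn G x τ'.2

/-- Avoiding any `r` given tiles, `v` can be exchanged, using at most two tiles of `T`, for a
vertex with at least `K` neighbours on the right of `τ`. -/
def Reach (G : SimpleGraph V) (X Y : Finset V) (u w : ℕ) (T : Finset (Finset V × Finset V))
    (K r : ℕ) (v : V) (τ : Finset V × Finset V) : Prop :=
  ∀ F : Finset (Finset V × Finset V), #F ≤ r → ∃ S ⊆ T, Disjoint S F ∧ #S ≤ 2 ∧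
    ∃ x ∈ insert v (cov S), x ∈ X ∧ K ≤ degIn G x τ.2 ∧
      Tiled G X Y u w ((insert v (cov S)).erase x)

variable {r : ℕ} {v : V} {τ : Finset V × Finset V}

lemma Reach.of_arc (hT : IsFam G X Y (u * N) (w * N) T) (hXY : Disjoint X Y) (hu : 1 ≤ u)
    (huw : u ≤ w) (hN : 1 ≤ N) (hK : w ≤ K) (hv : v ∈ X) (hvT : v ∉ cov T)
    (h : ∀ F : Finset (Finset V × Finset V), #F ≤ r →
      ∃ σ ∈ T, σ ∉ F ∧ K ≤ degIn G v σ.2 ∧ Arc G K σ τ) : Reach G X Y u w T K r v τ := by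
  intro F hF
  obtain ⟨σ, hσ, hσF, hd, x, hx, hxd⟩ := h F hF
  have hvσ : v ∉ σ.1 ∪ σ.2 := fun h => hvT (subset_cov hσ h)
  refine ⟨{σ}, singleton_subset_iff.2 hσ, disjoint_singleton_left.2 hσF, by simp, x, ?_,
    hT.left σ hσ hx, hxd, ?_⟩
  · rw [cov_singleton]; exact mem_insert_of_mem (mem_union_left _ hx)
  · rw [cov_singleton]
    exact hT.tiled_exchange hXY hu huw hN hσ hv (fun h => hvσ (mem_union_left _ h)) (hK.trans hd) hx

lemma Reach.of_arc_arc (hT : IsFam G X Y (u * N) (w * N) T) (hXY : Disjoint X Y) (hu : 1 ≤ u)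
    (huw : u ≤ w) (hN : 1 ≤ N) (hK : w ≤ K) (hv : v ∈ X) (hvT : v ∉ cov T)
    (h : ∀ F : Finset (Finset V × Finset V), #F ≤ r →
      ∃ σ ∈ T, ∃ σ' ∈ T, σ ∉ F ∧ σ' ∉ F ∧ σ ≠ σ' ∧ K ≤ degIn G v σ.2 ∧ Arc G K σ σ' ∧
        Arc G K σ' τ) : Reach G X Y u w T K r v τ := by
  intro F hF
  obtain ⟨σ, hσ, σ', hσ', hσF, hσF', hne, hd, ⟨x, hx, hxd⟩, y, hy, hyd⟩ := h F hF
  have hvσ : v ∉ σ.1 ∪ σ.2 := fun h => hvT (subset_cov hσ h)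
  have hvσ' : v ∉ σ'.1 ∪ σ'.2 := fun h => hvT (subset_cov hσ' h)
  have hdis := hT.disj σ hσ σ' hσ' hne
  have hxσ : x ∈ σ.1 ∪ σ.2 := mem_union_left _ hx
  have hxσ' : x ∉ σ'.1 ∪ σ'.2 := disjoint_left.1 hdis hxσ
  have hyσ' : y ∈ σ'.1 ∪ σ'.2 := mem_union_left _ hy
  have hyσ : y ∉ σ.1 ∪ σ.2 := disjoint_right.1 hdis hyσ'
  have t1 := hT.tiled_exchange hXY hu huw hN hσ hv (fun h => hvσ (mem_union_left _ h))
    (hK.trans hd) hx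
  have t2 := hT.tiled_exchange hXY hu huw hN hσ' (hT.left σ hσ hx)
    (fun h => hxσ' (mem_union_left _ h)) (hK.trans hxd) hy
  refine ⟨{σ, σ'}, insert_subset hσ (singleton_subset_iff.2 hσ'), ?_, card_le_two, y, ?_,
    hT.left σ' hσ' hy, hyd, ?_⟩
  · rw [disjoint_insert_left, disjoint_singleton_left]; exact ⟨hσF, hσF'⟩
  · rw [cov_insert, cov_singleton]; exact mem_insert_of_mem (mem_union_right _ hyσ')
  · rw [cov_insert, cov_singleton]
    generalize σ.1 ∪ σ.2 = A at t1 hvσ hxσ hyσ hdis ⊢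
    generalize σ'.1 ∪ σ'.2 = B at t2 hvσ' hxσ' hyσ' hdis ⊢
    have hvx : v ≠ x := fun h => hvσ (h ▸ hxσ)
    have hvy : v ≠ y := fun h => hvσ' (h ▸ hyσ')
    have hxy : x ≠ y := fun h => hyσ (h ▸ hxσ)
    have e : (insert v (A ∪ B)).erase y = (insert v A).erase x ∪ (insert x B).erase y := by
      ext z
      simp only [mem_union, mem_erase, mem_insert]
      by_cases h1 : z = x
      · subst h1; tauto
      · by_cases h2 : z = y
        · subst h2; tauto
        · tauto
    rw [e]
    refine t1.union t2 ?_
    rw [disjoint_left] at hdis ⊢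
    intro z hz
    have := @hdis z
    simp only [mem_erase, mem_insert] at hz ⊢
    rintro ⟨h1, h2 | h2⟩
    · exact hz.1 h2
    · rcases hz.2 with rfl | h3
      · exact hvσ' h2
      · exact this h3 h2

lemma union_insert_sdiff {A B A' : Finset V} {x : V} (hd : Disjoint A B) (hA' : A' ⊆ A)
    (hx : x ∈ B) : (A ∪ B) \ insert x A' = A \ A' ∪ B.erase x := by
  ext z
  have h1 : z ∈ A → z ∉ B := fun h => disjoint_left.1 hd h
  have h2 : z ∈ A' → z ∈ A := fun h => hA' h
  simp only [mem_sdiff, mem_union, mem_insert, mem_erase]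
  by_cases hzx : z = x
  · subst hzx; tauto
  · tauto

/-- Several vertices are simultaneously exchanged. -/
lemma exists_exchange_all (hT : IsFam G X Y a b T)
    (F : Finset (Finset V × Finset V)) (A : Finset V) : A ⊆ X → Disjoint A (cov T) →
    (∀ v ∈ A, Reach G X Y u w T K r v τ) → #F + 2 * #A ≤ r + 2 →
    ∃ S ⊆ T, Disjoint S F ∧ #S ≤ 2 * #A ∧ ∃ A' ⊆ X, A' ⊆ A ∪ cov S ∧ #A' = #A ∧
      (∀ x ∈ A', K ≤ degIn G x τ.2) ∧ Tiled G X Y u w ((A ∪ cov S) \ A') := by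
  induction A using Finset.induction_on with
  | empty =>
    intro _ _ _ _
    exact ⟨∅, empty_subset _, disjoint_empty_left _, by simp, ∅, empty_subset _, empty_subset _,
      rfl, by simp, by simpa [cov_empty] using Tiled.nil⟩
  | insert v A hv ih =>
    intro hA hd hR hF
    rw [card_insert_of_notMem hv] at hF ⊢
    rw [disjoint_insert_left] at hd
    obtain ⟨S, hS, hSF, hSc, A', hA'X, hA', hA'c, hdeg, ht⟩ := ih ((subset_insert _ _).trans hA)
      hd.2 (fun v hv => hR v (mem_insert_of_mem hv)) (by omega)
    obtain ⟨S', hS', hSF', hSc', x, hx, hxX, hxd, ht'⟩ := hR v (mem_insert_self _ _) (F ∪ S)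
      ((card_union_le _ _).trans (by omega))
    rw [disjoint_union_right] at hSF'
    have hdis : Disjoint (cov S') (cov S) := hT.disjoint_cov hS' hS hSF'.2
    have hdd : Disjoint (A ∪ cov S) (insert v (cov S')) := by
      simp only [disjoint_union_left, disjoint_insert_right]
      have f1 := disjoint_of_subset_right (cov_mono hS') hd.2
      have f2 : v ∉ cov S := fun h => hd.1 (cov_mono hS h)
      simp only [mem_union, hv, f1, f2, hdis.symm, or_self, not_false_eq_true, and_self]
    have hxn : x ∉ A' := fun h => disjoint_left.1 hdd (hA' h) hx
    refine ⟨S ∪ S', union_subset hS hS', disjoint_union_left.2 ⟨hSF, hSF'.1⟩,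
      (card_union_le _ _).trans (by omega), insert x A', insert_subset hxX hA'X, ?_, ?_, ?_, ?_⟩
    · rw [cov_union]
      intro z hz
      rcases mem_insert.1 hz with rfl | hz
      · rcases mem_insert.1 hx with rfl | hx
        · simp
        · simp [hx]
      · have := hA' hz
        simp only [mem_union, mem_insert] at this ⊢
        tauto
    · rw [card_insert_of_notMem hxn, hA'c]
    · intro z hz
      rcases mem_insert.1 hz with rfl | hz
      · exact hxd
      · exact hdeg z hz
    · have e : (insert v A ∪ cov (S ∪ S')) \ insert x A' =
          (A ∪ cov S) \ A' ∪ (insert v (cov S')).erase x := by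
        rw [← union_insert_sdiff hdd hA' hx, cov_union]
        congr 1
        ext z
        simp only [mem_union, mem_insert]
        tauto
      rw [e]
      exact ht.union ht' (Disjoint.mono sdiff_subset (erase_subset _ _) hdd)

/-- An improvement is available when `2(u+w)` uncovered vertices reach a tile with the smaller
side on the left. -/
lemma Layout.improvable_of_reach_lt {S : Finset V} (hL : Layout G X Y (u * N) (w * N) T C L) (hXY : Disjoint X Y)
    (hu : 1 ≤ u) (huw : u < w) (hN : 4 * (u + w) ^ 2 ≤ N) (hτ : τ ∈ T) (hc1 : #τ.1 = u * N)
    (hc2 : #τ.2 = w * N) (hS : S ⊆ L ∩ X) (hSc : #S = 2 * (u + w))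
    (hR : ∀ v ∈ S, Reach G X Y u w T (2 * (u + w) * w) (4 * (u + w)) v τ) :
    Improvable G X Y u w T L 1 (4 * (u + w) + 1) := by
  have hSL : S ⊆ L := hS.trans inter_subset_left
  have hT := hL.fam
  obtain ⟨U, hU, hUF, hUc, A, hAX, hA, hAc, hAd, ht⟩ := exists_exchange_all hT {τ} S
    (hS.trans inter_subset_right)
    (Disjoint.mono_left (hSL.trans subset_union_right) hL.disjT) hR
    (by rw [hSc, card_singleton]; omega)
  rw [disjoint_singleton_right] at hUF
  have hτU : Disjoint (S ∪ cov U) (τ.1 ∪ τ.2) := by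
    rw [disjoint_union_left]
    refine ⟨Disjoint.mono (hSL.trans subset_union_right) (subset_cov hτ) hL.disjT, ?_⟩
    have := hT.disjoint_cov hU (singleton_subset_iff.2 hτ) (disjoint_singleton_right.2 hUF)
    rwa [cov_singleton] at this
  have hPX := hT.left τ hτ
  have hQY := hT.right τ hτ
  have hJ := hT.joined τ hτ
  rw [hSc] at hAc hUc
  obtain ⟨P', hP', Q', hQ', hcP', hcQ', ht'⟩ := exists_insertion (u := u) (w := w) hXY
    (Or.inl ⟨rfl, rfl⟩) hu A hPX hQY hJ hAX
    (Disjoint.mono hA subset_union_left hτU)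
    (by intro x hx; rw [hAc, mul_comm]; exact hAd x hx)
    (by rw [hAc, hc1]; nlinarith [Nat.sub_le u 1])
  rw [hAc] at hcP' hcQ'
  obtain ⟨k, rfl⟩ := Nat.exists_eq_add_of_le' hu
  obtain ⟨l, rfl⟩ := Nat.exists_eq_add_of_lt huw
  have h1 : #(τ.1 \ P') + k * (2 * (k + 1 + (k + 1 + l + 1))) = (k + 1) * N := by
    rw [card_sdiff_of_subset hP', hc1, hcP']
    refine Nat.sub_add_cancel ?_
    rw [← hcP', ← hc1]; exact card_le_card hP'
  have h2 : #(τ.2 \ Q') + (k + 1 + l + 1) * (2 * (k + 1 + (k + 1 + l + 1))) =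
      (k + 1 + l + 1) * N := by
    rw [card_sdiff_of_subset hQ', hc2, hcQ']
    refine Nat.sub_add_cancel ?_
    rw [← hcQ', ← hc2]; exact card_le_card hQ'
  obtain ⟨A'', hA'', ht'', hleft⟩ := exists_tiled_of_joined (G := G) hXY hu huw.le
    (sdiff_subset.trans hPX) (sdiff_subset.trans hQY)
    (hJ.mono (sdiff_subset (t := P')) (sdiff_subset (t := Q'))) (by nlinarith) (by nlinarith)
  have hd1 : Disjoint (A ∪ P' ∪ Q') A'' := by
    have hAτ : Disjoint A (τ.1 ∪ τ.2) := Disjoint.mono_left hA hτU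
    have f1 : Disjoint P' (τ.2 \ Q') := Disjoint.mono (hP'.trans hPX) (sdiff_subset.trans hQY) hXY
    have f2 : Disjoint Q' (τ.1 \ P') :=
      (Disjoint.mono (sdiff_subset.trans hPX) (hQ'.trans hQY) hXY).symm
    refine Disjoint.mono_right hA'' ?_
    have f3 : Disjoint A (τ.1 \ P') := hAτ.mono_right (sdiff_subset.trans subset_union_left)
    have f4 : Disjoint A (τ.2 \ Q') := hAτ.mono_right (sdiff_subset.trans subset_union_right)
    simp only [disjoint_union_left, disjoint_union_right, f1, f2, f3, f4, disjoint_sdiff, and_self]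
  have hsub : A'' ⊆ τ.1 ∪ τ.2 := hA''.trans (union_subset_union sdiff_subset sdiff_subset)
  have hsub2 : A ∪ P' ∪ Q' ∪ A'' ⊆ A ∪ (τ.1 ∪ τ.2) := by
    refine union_subset (union_subset (union_subset subset_union_left ?_) ?_) ?_
    · exact hP'.trans (subset_union_left.trans subset_union_right)
    · exact hQ'.trans (subset_union_right.trans subset_union_right)
    · exact hsub.trans subset_union_right
  have hd2 : Disjoint ((S ∪ cov U) \ A) (A ∪ P' ∪ Q' ∪ A'') := by
    refine Disjoint.mono_right hsub2 ?_
    rw [disjoint_union_right]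
    exact ⟨sdiff_disjoint, hτU.mono_left sdiff_subset⟩
  have hcov : cov (insert τ U) = τ.1 ∪ τ.2 ∪ cov U := by rw [cov_insert]
  refine hL.improvable hXY (S := insert τ U) (insert_subset hτ hU)
    (R := (S ∪ cov U) \ A ∪ (A ∪ P' ∪ Q' ∪ A'')) ?_ (ht.union (ht'.union ht'' hd1) hd2) 1 one_pos
    (by rw [card_insert_of_notMem hUF]; omega) ?_
  · rw [hcov]
    have a1 : S ∪ cov U ⊆ L ∪ (τ.1 ∪ τ.2 ∪ cov U) :=
      union_subset_union hSL subset_union_right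
    exact union_subset (sdiff_subset.trans a1) (hsub2.trans (union_subset (hA.trans a1)
      (subset_union_left.trans subset_union_right)))
  · have hSU : Disjoint S (cov U) := Disjoint.mono (hSL.trans subset_union_right) (cov_mono hU) hL.disjT
    have c1 : #((S ∪ cov U) \ A) + #A = #S + #(cov U) := by
      rw [card_sdiff_of_subset hA, Nat.sub_add_cancel (card_le_card hA), card_union_of_disjoint hSU]
    have c2 := (hT.subset hU).card_cov hXY
    have c3 : #(A ∪ P' ∪ Q') = #A + #P' + #Q' := by
      rw [card_union_of_disjoint, card_union_of_disjoint]
      · exact Disjoint.mono hA (hP'.trans subset_union_left) hτU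
      · rw [disjoint_union_left]
        exact ⟨Disjoint.mono hA (hQ'.trans subset_union_right) hτU,
          Disjoint.mono (hP'.trans hPX) (hQ'.trans hQY) hXY⟩
    have c4 : #((τ.1 \ P' ∪ τ.2 \ Q') \ A'') + #A'' = #(τ.1 \ P') + #(τ.2 \ Q') := by
      rw [card_sdiff_of_subset hA'', Nat.sub_add_cancel (card_le_card hA''), card_union_of_disjoint]
      exact Disjoint.mono (sdiff_subset.trans hPX) (sdiff_subset.trans hQY) hXY
    rw [card_union_of_disjoint hd2, card_union_of_disjoint hd1, card_insert_of_notMem hUF, c3,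
      hcP', hcQ', mul_add, mul_one, ← c2]
    simp only [Nat.add_sub_cancel] at *
    omega

/-- An improvement is available when `u` uncovered vertices on each side reach the same tile. -/
lemma Layout.improvable_of_reach_eq {S S' : Finset V} (hL : Layout G X Y (u * N) (u * N) T C L)
    (hXY : Disjoint X Y) (hu : 1 ≤ u) (hN : 4 * (u + u) ^ 2 ≤ N) (hτ : τ ∈ T)
    (hS : S ⊆ L ∩ X) (hS' : S' ⊆ L ∩ Y) (hSc : #S = u) (hSc' : #S' = u)
    (hR : ∀ v ∈ S, Reach G X Y u u T (2 * (u + u) * u) (4 * (u + u)) v τ)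
    (hR' : ∀ v ∈ S', Reach G Y X u u (T.image Prod.swap) (2 * (u + u) * u) (4 * (u + u)) v τ.swap) :
    Improvable G X Y u u T L 1 (4 * (u + u) + 1) := by
  have hSL : S ⊆ L := hS.trans inter_subset_left
  have hSL' : S' ⊆ L := hS'.trans inter_subset_left
  have hT := hL.fam
  have hLT : Disjoint L (cov T) := hL.disjT.mono_left subset_union_right
  obtain ⟨U, hU, hUF, hUc, A, hAX, hA, hAc, hAd, ht⟩ := exists_exchange_all hT {τ} S
    (hS.trans inter_subset_right) (hLT.mono_left hSL) hR (by rw [hSc, card_singleton]; omega)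
  rw [disjoint_singleton_right] at hUF
  obtain ⟨U₁, hU₁, hUF₁, hUc₁, B, hBY, hB, hBc, hBd, htB⟩ := exists_exchange_all hT.swap
    ((insert τ U).image Prod.swap) S' (hS'.trans inter_subset_right)
    (by rw [cov_swap]; exact hLT.mono_left hSL') hR' (by
      have h1 : #((insert τ U).image Prod.swap) ≤ #U + 1 := card_image_le.trans (card_insert_le _ _)
      rw [hSc']; omega)
  obtain ⟨U', hU', rfl⟩ : ∃ U' ⊆ T, U'.image Prod.swap = U₁ := by
    obtain ⟨U', h1, h2⟩ := subset_image_iff.1 hU₁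
    exact ⟨U', h1, h2⟩
  rw [cov_swap] at hB htB
  have hUU : Disjoint U' (insert τ U) := by
    rw [disjoint_left]
    intro z hz hz'
    exact disjoint_left.1 hUF₁ (mem_image_of_mem _ hz) (mem_image_of_mem _ hz')
  have hUc' : #U' ≤ 2 * u := by
    rw [card_image_of_injective _ Prod.swap_injective] at hUc₁
    rwa [hSc'] at hUc₁
  rw [disjoint_insert_right] at hUU
  have hcτ : ∀ {W : Finset (Finset V × Finset V)}, W ⊆ T → τ ∉ W →
      Disjoint (cov W) (τ.1 ∪ τ.2) := by
    intro W hW hτW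
    have := hT.disjoint_cov hW (singleton_subset_iff.2 hτ) (disjoint_singleton_right.2 hτW)
    rwa [cov_singleton] at this
  have hLτ := hLT.mono_right (subset_cov hτ)
  have hSS : Disjoint S S' :=
    Disjoint.mono (hS.trans inter_subset_right) (hS'.trans inter_subset_right) hXY
  have d1 : Disjoint (S ∪ cov U) (τ.1 ∪ τ.2) :=
    disjoint_union_left.2 ⟨hLτ.mono_left hSL, hcτ hU hUF⟩
  have d2 : Disjoint (S' ∪ cov U') (τ.1 ∪ τ.2) :=
    disjoint_union_left.2 ⟨hLτ.mono_left hSL', hcτ hU' hUU.1⟩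
  have d3 : Disjoint (S ∪ cov U) (S' ∪ cov U') := by
    rw [disjoint_union_left, disjoint_union_right, disjoint_union_right]
    exact ⟨⟨hSS, Disjoint.mono hSL (cov_mono hU') hLT⟩,
      ⟨(Disjoint.mono hSL' (cov_mono hU) hLT).symm, (hT.disjoint_cov hU' hU hUU.2).symm⟩⟩
  have hPX := hT.left τ hτ
  have hQY := hT.right τ hτ
  have hJ := hT.joined τ hτ
  obtain ⟨hc1, hc2⟩ : #τ.1 = u * N ∧ #τ.2 = u * N := by
    rcases hT.size τ hτ with h | h <;> exact h
  rw [hSc] at hAc hUc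
  rw [hSc'] at hBc
  have hPQ : Disjoint τ.1 τ.2 := Disjoint.mono hPX hQY hXY
  obtain ⟨P', hP', Q', hQ', hcP', hcQ', ht'⟩ := exists_insertion (u := u) (w := u) hXY
    (Or.inl ⟨rfl, rfl⟩) hu A hPX hQY hJ hAX (Disjoint.mono hA subset_union_left d1)
    (by intro x hx; rw [hAc]; exact le_trans (by nlinarith) (hAd x hx))
    (by rw [hAc, hc1]; nlinarith [Nat.sub_le u 1])
  rw [hAc] at hcP' hcQ'
  have hNu : u * (8 * u) ≤ u * N := Nat.mul_le_mul_left _ (by nlinarith)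
  have hu1 : (u - 1) * u + u = u * u := by
    rw [← Nat.succ_mul, Nat.succ_eq_add_one, Nat.sub_add_cancel hu]
  have hQY' : τ.2 \ Q' ⊆ Y := sdiff_subset.trans hQY
  have hPX' : τ.1 \ P' ⊆ X := sdiff_subset.trans hPX
  have hJ' : Joined G (τ.2 \ Q') (τ.1 \ P') := (hJ.mono sdiff_subset sdiff_subset).symm
  obtain ⟨Q'', hQ'', P'', hP'', hcQ'', hcP'', ht''⟩ := exists_insertion (u := u) (w := u) hXY.symm
    (Or.inl ⟨rfl, rfl⟩) hu B hQY' hPX' hJ' hBY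
    (Disjoint.mono hB (sdiff_subset.trans subset_union_right) d2)
    (by
      intro x hx
      have h1 := hBd x hx
      have h2 : degIn G x τ.1 ≤ degIn G x P' + degIn G x (τ.1 \ P') := by
        refine le_trans (degIn_mono x ?_) (degIn_union_le _ _ _)
        rw [union_sdiff_of_subset hP']
      have h3 := degIn_le (G := G) x P'
      change 2 * (u + u) * u ≤ degIn G x τ.1 at h1
      rw [hBc]
      nlinarith)
    (by
      have h1 : u * u ≤ u * N := by nlinarith
      rw [hBc, card_sdiff_of_subset hQ', hcQ', hc2]
      refine Nat.le_sub_of_add_le (le_trans ?_ hNu)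
      nlinarith)
  rw [hBc] at hcP'' hcQ''
  obtain ⟨k, hk⟩ := Nat.exists_eq_add_of_le (show 2 * u ≤ N + 1 by nlinarith)
  have hrest : (u - 1) * u + u * u + u * k = u * N := by
    have h1 : u * (N + 1) = u * (2 * u + k) := by rw [hk]
    have h2 : u * (2 * u + k) = 2 * (u * u) + u * k := by ring
    rw [mul_add, mul_one] at h1
    omega
  have hr1 : #((τ.1 \ P') \ P'') = k * u := by
    rw [card_sdiff_of_subset hP'', card_sdiff_of_subset hP', hc1, hcP', hcP'', mul_comm k u]; omega
  have hr2 : #((τ.2 \ Q') \ Q'') = k * u := by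
    rw [card_sdiff_of_subset hQ'', card_sdiff_of_subset hQ', hc2, hcQ', hcQ'', mul_comm k u]; omega
  have htr := tiled_of_joined (u := u) (w := u) hXY
    (sdiff_subset.trans hPX' : (τ.1 \ P') \ P'' ⊆ X)
    (sdiff_subset.trans hQY' : (τ.2 \ Q') \ Q'' ⊆ Y)
    (hJ.mono (sdiff_subset.trans sdiff_subset) (sdiff_subset.trans sdiff_subset)) k 0
    (by rw [hr1]; ring) (by rw [hr2]; ring)
  have hP''τ := hP''.trans sdiff_subset
  have hQ''τ := hQ''.trans sdiff_subset
  have t12 := ht'.union ht''.symm (by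
    have f1 : Disjoint A B := Disjoint.mono hA hB d3
    have f2 : Disjoint A P'' := d1.mono hA (hP''τ.trans subset_union_left)
    have f3 : Disjoint A Q'' := d1.mono hA (hQ''τ.trans subset_union_right)
    have f4 : Disjoint P' B := (d2.mono hB (hP'.trans subset_union_left)).symm
    have f5 : Disjoint Q' B := (d2.mono hB (hQ'.trans subset_union_right)).symm
    have f6 : Disjoint P' P'' := (disjoint_of_subset_left hP'' sdiff_disjoint).symm
    have f7 : Disjoint Q' Q'' := (disjoint_of_subset_left hQ'' sdiff_disjoint).symm
    have f8 : Disjoint P' Q'' := hPQ.mono hP' hQ''τ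
    have f9 : Disjoint Q' P'' := (hPQ.mono hP''τ hQ').symm
    simp only [disjoint_union_left, disjoint_union_right, f1, f2, f3, f4, f5, f6, f7, f8, f9,
      and_self])
  have t123 := t12.union htr (by
    have f1 : Disjoint A τ.1 := d1.mono hA subset_union_left
    have f2 : Disjoint A τ.2 := d1.mono hA subset_union_right
    have f3 : Disjoint B τ.1 := d2.mono hB subset_union_left
    have f4 : Disjoint B τ.2 := d2.mono hB subset_union_right
    have s1 : (τ.1 \ P') \ P'' ⊆ τ.1 := sdiff_subset.trans sdiff_subset
    have s2 : (τ.2 \ Q') \ Q'' ⊆ τ.2 := sdiff_subset.trans sdiff_subset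
    have f5 : Disjoint P' ((τ.1 \ P') \ P'') := disjoint_of_subset_right sdiff_subset disjoint_sdiff
    have f6 : Disjoint Q' ((τ.2 \ Q') \ Q'') := disjoint_of_subset_right sdiff_subset disjoint_sdiff
    have f7 : Disjoint P'' ((τ.1 \ P') \ P'') := disjoint_sdiff
    have f8 : Disjoint Q'' ((τ.2 \ Q') \ Q'') := disjoint_sdiff
    have g1 := hPQ.mono hP' s2
    have g2 := hPQ.mono hP''τ s2
    have g3 := (hPQ.mono s1 hQ').symm
    have g4 := (hPQ.mono s1 hQ''τ).symm
    simp only [disjoint_union_left, disjoint_union_right, f1.mono_right s1, f2.mono_right s2,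
      f3.mono_right s1, f4.mono_right s2, f5, f6, f7, f8, g1, g2, g3, g4, and_self])
  have tZ := ht.union htB.symm (Disjoint.mono sdiff_subset sdiff_subset d3)
  have eτ : A ∪ P' ∪ Q' ∪ (B ∪ Q'' ∪ P'') ∪ ((τ.1 \ P') \ P'' ∪ (τ.2 \ Q') \ Q'') =
      A ∪ B ∪ (τ.1 ∪ τ.2) := by
    conv_rhs => rw [← union_sdiff_of_subset hP', ← union_sdiff_of_subset hP'',
      ← union_sdiff_of_subset hQ', ← union_sdiff_of_subset hQ'']
    simp only [union_left_comm, union_comm]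
  rw [eτ] at t123
  have t := tZ.union t123 (by
    rw [disjoint_union_right]
    constructor
    · have f1 : Disjoint ((S ∪ cov U) \ A) B := d3.mono sdiff_subset hB
      have f2 : Disjoint ((S' ∪ cov U') \ B) A := d3.symm.mono sdiff_subset hA
      simp only [disjoint_union_left, disjoint_union_right, f1, f2, sdiff_disjoint, and_self]
    · exact disjoint_union_left.2 ⟨d1.mono_left sdiff_subset, d2.mono_left sdiff_subset⟩)
  have e : (S ∪ cov U) \ A ∪ (S' ∪ cov U') \ B ∪ (A ∪ B ∪ (τ.1 ∪ τ.2)) =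
      (S ∪ S') ∪ cov (insert τ (U ∪ U')) := by
    rw [← union_assoc ((S ∪ cov U) \ A ∪ (S' ∪ cov U') \ B),
      union_union_union_comm ((S ∪ cov U) \ A), sdiff_union_of_subset hA, sdiff_union_of_subset hB,
      cov_insert, cov_union]
    simp only [union_left_comm, union_comm]
  rw [e] at t
  have hW : insert τ (U ∪ U') ⊆ T := insert_subset hτ (union_subset hU hU')
  refine hL.improvable hXY hW (union_subset_union (union_subset hSL hSL') subset_rfl) t 1 one_pos
    ?_ ?_
  · have h1 := card_insert_le τ (U ∪ U')
    have h2 := card_union_le U U'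
    omega
  · have c := (hT.subset hW).card_cov hXY
    rw [card_union_of_disjoint (hLT.mono (union_subset hSL hSL') (cov_mono hW)),
      card_union_of_disjoint hSS, c]
    omega

/-! ### Counting short chains of tiles -/

lemma Layout.sum_out (hL : Layout G X Y a b T C L) (hB : Bal G X Y u w n) (K : ℕ) {x : V}
    (hx : x ∈ X) {ζ : ℝ} (hCL : (#C + #L : ℝ) ≤ ζ * n) :
    (u : ℝ) / (u + w) * n - K * #T - ζ * n ≤
      ∑ τ ∈ T with K ≤ degIn G x τ.2, (#τ.2 : ℝ) := by
  have h1 := hB.degX x hx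
  have h2 : degIn G x Y ≤ #L + #C + ∑ τ ∈ T, degIn G x τ.2 := by
    rw [hL.cover_right hB.disj]
    refine (degIn_union_le _ _ _).trans (add_le_add ((degIn_union_le _ _ _).trans (add_le_add
      ((degIn_le _ _).trans (card_le_card inter_subset_left))
      ((degIn_le _ _).trans (card_le_card inter_subset_left)))) (degIn_biUnion_le _ _ _))
  have h3 : ∑ τ ∈ T, degIn G x τ.2 ≤ (∑ τ ∈ T with K ≤ degIn G x τ.2, #τ.2) + #T * K := by
    rw [← sum_filter_add_sum_filter_not T (fun τ => K ≤ degIn G x τ.2)]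
    refine add_le_add (sum_le_sum fun τ _ => degIn_le _ _) ?_
    refine (sum_le_card_nsmul _ _ K fun τ hτ => ?_).trans ?_
    · exact (not_le.1 (mem_filter.1 hτ).2).le
    · rw [smul_eq_mul]; exact Nat.mul_le_mul_right _ (card_filter_le _ _)
  have h4 : (u : ℝ) / (u + w) * n ≤ degIn G x Y := by
    have h5 : (u * n : ℝ) ≤ (u + w) * degIn G x Y := by exact_mod_cast h1
    rcases Nat.eq_zero_or_pos (u + w) with h0 | h0
    · have : (u + w : ℝ) = 0 := by exact_mod_cast h0
      rw [this]; simp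
    · have : (0 : ℝ) < u + w := by exact_mod_cast h0
      rw [div_mul_eq_mul_div, div_le_iff₀ this]; linarith
  have h6 : (degIn G x Y : ℝ) ≤ #L + #C + ((∑ τ ∈ T with K ≤ degIn G x τ.2, (#τ.2 : ℝ)) + #T * K) := by
    exact_mod_cast h2.trans (Nat.add_le_add_left h3 _)
  linarith

lemma Layout.card_mul_le (hL : Layout G X Y (u * N) (w * N) T C L) (hB : Bal G X Y u w n)
    (hu : 1 ≤ u) (huw : u ≤ w) : #T * N ≤ n := by
  have h1 := hL.fam.card_cov hB.disj
  have h2 : #(cov T) ≤ #(X ∪ Y) := card_le_card (by rw [← hL.all]; exact subset_union_right)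
  rw [card_union_of_disjoint hB.disj, hB.cardX, hB.cardY, h1] at h2
  have h3 : 2 * N * #T ≤ (u * N + w * N) * #T := Nat.mul_le_mul_right _ (by nlinarith)
  nlinarith

lemma IsFam.eAB_le_arcs (hT : IsFam G X Y a b T) {M : ℕ} (ha : a ≤ M) (hb : b ≤ M)
    {D E : Finset (Finset V × Finset V)} (hD : D ⊆ T) (hE : E ⊆ T) (K : ℕ) :
    eAB G (D.biUnion Prod.fst) (E.biUnion Prod.snd) ≤
      M ^ 2 * #{p ∈ D ×ˢ E | Arc G K p.1 p.2} + M * K * (#D * #E) := by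
  have hs : ∀ τ ∈ T, #τ.1 ≤ M ∧ #τ.2 ≤ M := by
    intro τ hτ
    rcases hT.size τ hτ with ⟨h1, h2⟩ | ⟨h1, h2⟩ <;> omega
  rw [eAB_eq_sum, sum_biUnion fun σ hσ τ hτ hne => hT.disj_fst (hD hσ) (hD hτ) hne]
  calc ∑ σ ∈ D, ∑ x ∈ σ.1, degIn G x (E.biUnion Prod.snd)
      ≤ ∑ σ ∈ D, ∑ τ ∈ E, (M ^ 2 * (if Arc G K σ τ then 1 else 0) + M * K) := by
        refine sum_le_sum fun σ hσ => ?_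
        refine (sum_le_sum fun x _ => degIn_biUnion_le x E Prod.snd).trans ?_
        rw [sum_comm]
        refine sum_le_sum fun τ hτ => ?_
        obtain ⟨h1, -⟩ := hs σ (hD hσ)
        obtain ⟨-, h2⟩ := hs τ (hE hτ)
        by_cases h : Arc G K σ τ
        · refine (sum_le_card_nsmul _ _ M fun x _ => (degIn_le x _).trans h2).trans ?_
          rw [if_pos h, smul_eq_mul]
          nlinarith
        · refine (sum_le_card_nsmul _ _ K fun x hx => ?_).trans ?_
          · by_contra h3
            exact h ⟨x, hx, (not_le.1 h3).le⟩
          · rw [smul_eq_mul, if_neg h, mul_zero, zero_add]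
            exact Nat.mul_le_mul_right _ h1
    _ = M ^ 2 * #{p ∈ D ×ˢ E | Arc G K p.1 p.2} + M * K * (#D * #E) := by
        rw [card_filter, sum_product, mul_sum]
        simp only [sum_add_distrib, mul_sum, sum_const, smul_eq_mul]
        ring

/-- If many two-step chains from `A` meet many `R'`-successors of `B`, then some common endpoint is
reached often. -/
lemma exists_common_endpoint {ι κ : Type*} (A T : Finset ι) (B : Finset κ) (R : ι → ι → Prop)
    (R' : κ → ι → Prop) {t : ℝ} (s₁ s₂ : ℕ)
    (h : ∀ τ ∈ A, ∀ σ ∈ B, t ≤ #{p ∈ T ×ˢ T | R τ p.1 ∧ R p.1 p.2 ∧ R' σ p.2})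
    (hlt : (#T * (s₁ * #B + s₂ * (#A * #T)) : ℝ) < #A * #B * t) :
    ∃ ρ ∈ T, s₁ < #{p ∈ A ×ˢ T | R p.1 p.2 ∧ R p.2 ρ} ∧ s₂ < #{σ ∈ B | R' σ ρ} := by
  by_contra! hcon
  have h1 : ∑ ρ ∈ T, #{p ∈ A ×ˢ T | R p.1 p.2 ∧ R p.2 ρ} * #{σ ∈ B | R' σ ρ} =
      ∑ τ ∈ A, ∑ σ ∈ B, #{p ∈ T ×ˢ T | R τ p.1 ∧ R p.1 p.2 ∧ R' σ p.2} := by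
    have e : ∀ ρ, #{p ∈ A ×ˢ T | R p.1 p.2 ∧ R p.2 ρ} * #{σ ∈ B | R' σ ρ} =
        ∑ τ ∈ A, ∑ σ ∈ B, ∑ τ' ∈ T, if R τ τ' ∧ R τ' ρ ∧ R' σ ρ then 1 else 0 := by
      intro ρ
      rw [card_filter, card_filter, sum_product, sum_mul_sum]
      refine sum_congr rfl fun τ _ => sum_congr rfl fun σ _ => ?_
      rw [sum_mul]
      refine sum_congr rfl fun τ' _ => ?_
      by_cases h1 : R τ τ' <;> by_cases h2 : R τ' ρ <;> by_cases h3 : R' σ ρ <;> simp [h1, h2, h3]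
    simp_rw [e]
    rw [sum_comm]
    refine sum_congr rfl fun τ _ => ?_
    rw [sum_comm]
    refine sum_congr rfl fun σ _ => ?_
    rw [card_filter, sum_product, sum_comm]
  have h2 : ∑ ρ ∈ T, #{p ∈ A ×ˢ T | R p.1 p.2 ∧ R p.2 ρ} * #{σ ∈ B | R' σ ρ} ≤
      #T * (s₁ * #B + s₂ * (#A * #T)) := by
    rw [← smul_eq_mul]
    refine sum_le_card_nsmul _ _ _ fun ρ hρ => ?_
    have h3 : #{p ∈ A ×ˢ T | R p.1 p.2 ∧ R p.2 ρ} ≤ #A * #T := by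
      rw [← card_product]; exact card_filter_le _ _
    have h4 : #{σ ∈ B | R' σ ρ} ≤ #B := card_filter_le _ _
    by_cases h5 : #{p ∈ A ×ˢ T | R p.1 p.2 ∧ R p.2 ρ} ≤ s₁
    · exact (Nat.mul_le_mul h5 h4).trans (Nat.le_add_right _ _)
    · refine le_trans ?_ (Nat.le_add_left _ _)
      rw [mul_comm s₂]
      exact Nat.mul_le_mul h3 (hcon ρ hρ (not_le.1 h5))
  have h3 : (#A * #B * t : ℝ) ≤
      ((∑ τ ∈ A, ∑ σ ∈ B, #{p ∈ T ×ˢ T | R τ p.1 ∧ R p.1 p.2 ∧ R' σ p.2} : ℕ) : ℝ) := by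
    push_cast
    have h4 : ∀ τ ∈ A, (#B * t : ℝ) ≤
        ∑ σ ∈ B, (#{p ∈ T ×ˢ T | R τ p.1 ∧ R p.1 p.2 ∧ R' σ p.2} : ℝ) := by
      intro τ hτ
      rw [← nsmul_eq_mul]
      exact card_nsmul_le_sum _ _ _ fun σ hσ => h τ hτ σ hσ
    have h5 := card_nsmul_le_sum _ _ _ h4
    rw [nsmul_eq_mul] at h5
    linarith
  rw [← h1] at h3
  have h4 : ((∑ ρ ∈ T, #{p ∈ A ×ˢ T | R p.1 p.2 ∧ R p.2 ρ} * #{σ ∈ B | R' σ ρ} : ℕ) : ℝ) ≤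
      #T * (s₁ * #B + s₂ * (#A * #T)) := by exact_mod_cast h2
  linarith

/-- Many pairs contain a pair of distinct entries avoiding a given small set. -/
lemma exists_pair_avoiding {ι : Type*} {A T F : Finset ι} {p : ι × ι → Prop} (hA : A ⊆ T) {r : ℕ}
    (hF : #F ≤ r) (h : (2 * r + 1) * #T < #{x ∈ A ×ˢ T | p x}) :
    ∃ σ ∈ A, ∃ σ' ∈ T, σ ∉ F ∧ σ' ∉ F ∧ σ ≠ σ' ∧ p (σ, σ') := by
  by_contra! hcon
  have h1 : ({x ∈ A ×ˢ T | p x}) ⊆ F ×ˢ T ∪ T ×ˢ F ∪ T.image fun x => (x, x) := by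
    rintro ⟨σ, σ'⟩ hx
    obtain ⟨hx, hp⟩ := mem_filter.1 hx
    obtain ⟨h1, h2⟩ := mem_product.1 hx
    have h3 := hcon σ h1 σ' h2
    simp only [mem_union, mem_product, mem_image, Prod.mk.injEq]
    by_cases h4 : σ ∈ F
    · exact Or.inl (Or.inl ⟨h4, h2⟩)
    by_cases h5 : σ' ∈ F
    · exact Or.inl (Or.inr ⟨hA h1, h5⟩)
    by_cases h6 : σ = σ'
    · exact Or.inr ⟨σ, hA h1, rfl, h6⟩
    · exact absurd hp (h3 h4 h5 h6)
  have h2 := card_le_card h1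
  have h3 : #(F ×ˢ T ∪ T ×ˢ F ∪ T.image fun x => (x, x)) ≤ #F * #T + #T * #F + #T := by
    refine (card_union_le _ _).trans (add_le_add ((card_union_le _ _).trans ?_) card_image_le)
    rw [card_product, card_product]
  nlinarith

/-- Many tiles are simultaneously adjacent to several vertices. -/
lemma exists_common_tiles {S : Finset V} (hu : 1 ≤ u) (hS : #S = 4 * (u + w) ^ 2) {M : ℕ}
    (hM : ∀ τ ∈ T, #τ.2 ≤ M) (hsum : ∑ τ ∈ T, #τ.2 ≤ n) {κ : ℝ} (hκ : κ ≤ 1 / (4 * (u + w)))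
    (hout : ∀ v ∈ S, ((u : ℝ) / (u + w) - κ) * n ≤ ∑ τ ∈ T with K ≤ degIn G v τ.2, (#τ.2 : ℝ)) :
    ∃ S' ⊆ S, #S' = 2 * (u + w) ∧ n ≤ 4 * (u + w) ^ 2 * M * 2 ^ (4 * (u + w) ^ 2) *
      #{τ ∈ T | ∀ v ∈ S', K ≤ degIn G v τ.2} := by
  obtain ⟨c, hc⟩ : ∃ c : Finset V × Finset V → ℕ, ∀ τ, c τ = #{v ∈ S | K ≤ degIn G v τ.2} :=
    ⟨_, fun _ => rfl⟩
  obtain ⟨S', hS', hc', hcard⟩ := exists_common_subset (fun v (τ : Finset V × Finset V) =>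
    K ≤ degIn G v τ.2) S {τ ∈ T | 2 * (u + w) ≤ c τ} (2 * (u + w))
    (fun τ hτ => by
      have h := (mem_filter.1 hτ).2
      rw [hc] at h
      convert h) (by rw [hS]; nlinarith)
  refine ⟨S', hS', hc', ?_⟩
  have hcard' : #{τ ∈ T | 2 * (u + w) ≤ c τ} ≤ 2 ^ (4 * (u + w) ^ 2) *
      #{τ ∈ T | ∀ v ∈ S', K ≤ degIn G v τ.2} := by
    rw [hS] at hcard
    refine hcard.trans (Nat.mul_le_mul_left _ (card_le_card ?_))
    intro τ
    simp only [mem_filter]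
    exact fun h => ⟨h.1.1, h.2⟩
  have hu' : (1 : ℝ) ≤ u := by exact_mod_cast hu
  have hh : (0 : ℝ) < u + w := by positivity
  have h1 : (∑ τ ∈ T, #τ.2 * c τ : ℕ) ≤ M * (4 * (u + w) ^ 2) * #{τ ∈ T | 2 * (u + w) ≤ c τ} +
      2 * (u + w) * n := by
    rw [← sum_filter_add_sum_filter_not T (fun τ => 2 * (u + w) ≤ c τ)]
    refine add_le_add ?_ ?_
    · rw [mul_comm _ #_, ← smul_eq_mul #_]
      refine sum_le_card_nsmul _ _ _ fun τ hτ => ?_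
      refine Nat.mul_le_mul (hM τ (mem_filter.1 hτ).1) ?_
      rw [← hS, hc]; exact card_filter_le _ _
    · refine le_trans ?_ (Nat.mul_le_mul_left _ hsum)
      rw [mul_sum]
      refine (sum_le_sum fun τ hτ => ?_).trans (sum_le_sum_of_subset (filter_subset _ _))
      rw [mul_comm]
      exact Nat.mul_le_mul_right _ (not_le.1 (mem_filter.1 hτ).2).le
  have h2 : ∑ v ∈ S, ∑ τ ∈ T with K ≤ degIn G v τ.2, (#τ.2 : ℝ) = ∑ τ ∈ T, (#τ.2 : ℝ) * c τ := by
    simp only [sum_filter, hc]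
    rw [sum_comm]
    refine sum_congr rfl fun τ _ => ?_
    rw [← sum_filter, sum_const, nsmul_eq_mul, mul_comm]
  have h3 := card_nsmul_le_sum _ _ _ hout
  rw [h2, hS, nsmul_eq_mul] at h3
  have h4 : (∑ τ ∈ T, (#τ.2 : ℝ) * c τ) ≤ M * (4 * (u + w) ^ 2) * #{τ ∈ T | 2 * (u + w) ≤ c τ} +
      2 * (u + w) * n := by exact_mod_cast h1
  have h5 : 3 * (u + w) * (n : ℝ) ≤ ((4 * (u + w) ^ 2 : ℕ) : ℝ) * (((u : ℝ) / (u + w) - κ) * n) := by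
    have h6 : 3 / (4 * (u + w)) ≤ (u : ℝ) / (u + w) - κ := by
      have : (1 : ℝ) / (u + w) ≤ u / (u + w) := by gcongr
      have e : (3 : ℝ) / (4 * (u + w)) = 1 / (u + w) - 1 / (4 * (u + w)) := by field_simp; norm_num
      rw [e]; linarith
    have h7 : (3 : ℝ) / (4 * (u + w)) * n ≤ ((u : ℝ) / (u + w) - κ) * n := by gcongr
    push_cast
    calc 3 * (u + w) * (n : ℝ) = (4 * (u + w) ^ 2) * (3 / (4 * (u + w)) * n) := by field_simp
      _ ≤ _ := by gcongr
  have h8 : (u + w) * (n : ℝ) ≤ M * (4 * (u + w) ^ 2) * #{τ ∈ T | 2 * (u + w) ≤ c τ} := by linarith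
  have h9 : (u + w) * n ≤ M * (4 * (u + w) ^ 2) * #{τ ∈ T | 2 * (u + w) ≤ c τ} := by exact_mod_cast h8
  calc n ≤ (u + w) * n := Nat.le_mul_of_pos_left _ (by omega)
    _ ≤ _ := h9
    _ ≤ M * (4 * (u + w) ^ 2) * (2 ^ (4 * (u + w) ^ 2) *
      #{τ ∈ T | ∀ v ∈ S', K ≤ degIn G v τ.2}) := Nat.mul_le_mul_left _ hcard'
    _ = _ := by ring

/-- `G` contains a sparse pair of sets of sizes about `wn/(u+w)`. -/
def Extremal (G : SimpleGraph V) (X Y : Finset V) (u w : ℕ) (γ : ℝ) (n : ℕ) : Prop :=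
  ∃ A ⊆ X, ∃ B ⊆ Y, ((w : ℝ) / (u + w) - γ) * n ≤ #A ∧ ((w : ℝ) / (u + w) - γ) * n ≤ #B ∧
    (eAB G A B : ℝ) ≤ γ * n ^ 2

lemma Extremal.swap {γ : ℝ} (h : Extremal G Y X u w γ n) : Extremal G X Y u w γ n := by
  obtain ⟨A, hA, B, hB, h1, h2, h3⟩ := h
  exact ⟨B, hB, A, hA, h2, h1, by rwa [eAB_comm]⟩

lemma IsFam.card_arcs_ge (hT : IsFam G X Y (u * N) (w * N) T) (hN : 1 ≤ N) (hw : 1 ≤ w)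
    (huw : u ≤ w) (hTN : #T * N ≤ n) {γ : ℝ} (hK : 2 * (w * K) ≤ γ * N)
    (hE : ¬ Extremal G X Y u w γ n) {D E : Finset (Finset V × Finset V)} (hD : D ⊆ T) (hE' : E ⊆ T)
    (hDs : ((w : ℝ) / (u + w) - γ) * n ≤ ∑ τ ∈ D, (#τ.1 : ℝ))
    (hEs : ((w : ℝ) / (u + w) - γ) * n ≤ ∑ τ ∈ E, (#τ.2 : ℝ)) {μ : ℝ} (hμ : μ * N = n) :
    γ / (2 * w ^ 2) * μ ^ 2 ≤ #{p ∈ D ×ˢ E | Arc G K p.1 p.2} := by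
  have h1 : γ * n ^ 2 < (eAB G (D.biUnion Prod.fst) (E.biUnion Prod.snd) : ℝ) := by
    by_contra! hcon
    refine hE ⟨D.biUnion Prod.fst, biUnion_subset.2 fun τ hτ => hT.left τ (hD hτ),
      E.biUnion Prod.snd, biUnion_subset.2 fun τ hτ => hT.right τ (hE' hτ), ?_, ?_, hcon⟩
    · rw [card_biUnion fun σ hσ τ hτ hne => hT.disj_fst (hD hσ) (hD hτ) hne]
      exact_mod_cast hDs
    · rw [card_biUnion fun σ hσ τ hτ hne => hT.disj_snd (hE' hσ) (hE' hτ) hne]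
      exact_mod_cast hEs
  have h2 := hT.eAB_le_arcs (M := w * N) (Nat.mul_le_mul_right _ huw) le_rfl hD hE' K
  have h3 : #D * #E ≤ #T * #T := Nat.mul_le_mul (card_le_card hD) (card_le_card hE')
  have h4 : (eAB G (D.biUnion Prod.fst) (E.biUnion Prod.snd) : ℝ) ≤
      (w * N) ^ 2 * #{p ∈ D ×ˢ E | Arc G K p.1 p.2} + w * N * K * (#T * #T) := by
    exact_mod_cast h2.trans (Nat.add_le_add_left (Nat.mul_le_mul_left _ h3) _)
  have h5 : (#T * N : ℝ) ≤ n := by exact_mod_cast hTN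
  have h6 : w * N * K * (#T * #T : ℝ) * 2 ≤ γ * n ^ 2 := by
    have h7 : (#T * N : ℝ) ^ 2 ≤ n ^ 2 := by gcongr
    have h8 : 0 ≤ γ := by
      have : 0 < (N : ℝ) := by exact_mod_cast hN
      have h9 : 0 ≤ γ * N := le_trans (by positivity) hK
      exact nonneg_of_mul_nonneg_left h9 this
    calc w * N * K * (#T * #T : ℝ) * 2 = 2 * (w * K) * (N * (#T * #T)) := by ring
      _ ≤ γ * N * (N * (#T * #T)) := by gcongr
      _ = γ * (#T * N) ^ 2 := by ring
      _ ≤ γ * n ^ 2 := by gcongr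
  have hw' : (0 : ℝ) < w := by exact_mod_cast hw
  have hN' : (0 : ℝ) < N := by exact_mod_cast hN
  have h9 : γ * n ^ 2 / 2 ≤ (w * N) ^ 2 * (#{p ∈ D ×ˢ E | Arc G K p.1 p.2} : ℝ) := by linarith
  rw [← hμ] at h9
  rw [div_mul_eq_mul_div, div_le_iff₀ (by positivity)]
  have h10 : N ^ 2 * (γ * μ ^ 2) ≤ N ^ 2 * ((#{p ∈ D ×ˢ E | Arc G K p.1 p.2} : ℝ) * (2 * w ^ 2)) := by
    linarith
  exact le_of_mul_le_mul_left h10 (by positivity)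

lemma Layout.sum_out_ge (hL : Layout G X Y (u * N) (w * N) T C L) (hB : Bal G X Y u w n)
    (hu : 1 ≤ u) (huw : u ≤ w) {κ : ℝ} (hK : 2 * K ≤ κ * N) (hCL : (#C + #L : ℝ) ≤ κ / 2 * n)
    {x : V} (hx : x ∈ X) :
    ((u : ℝ) / (u + w) - κ) * n ≤ ∑ τ ∈ T with K ≤ degIn G x τ.2, (#τ.2 : ℝ) := by
  have h1 := hL.sum_out hB K hx hCL
  have h2 : (#T * N : ℝ) ≤ n := by exact_mod_cast hL.card_mul_le hB hu huw
  have h3 : K * (#T : ℝ) ≤ κ / 2 * n := by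
    rcases Nat.eq_zero_or_pos #T with h0 | h0
    · have : 0 ≤ κ / 2 * (n : ℝ) := le_trans (by positivity) hCL
      rw [h0]; simpa using this
    · have h0' : (0 : ℝ) < #T := by exact_mod_cast h0
      have hκN : 0 ≤ κ * N := le_trans (by positivity) hK
      by_cases hκ : 0 ≤ κ
      · calc K * (#T : ℝ) = (2 * K) / 2 * #T := by ring
          _ ≤ (κ * N) / 2 * #T := by gcongr
          _ = κ / 2 * (#T * N) := by ring
          _ ≤ κ / 2 * n := by gcongr
      · have h4 : (N : ℝ) = 0 := by
          have := Nat.cast_nonneg (α := ℝ) N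
          nlinarith
        have h5 : (K : ℝ) = 0 := by
          have := Nat.cast_nonneg (α := ℝ) K
          rw [h4] at hK; linarith
        have : 0 ≤ κ / 2 * (n : ℝ) := le_trans (by positivity) hCL
        rw [h5, zero_mul]; exact this
  linarith

/-- Two vertices sets of linearly many tiles are adjacent to a few uncovered vertices. -/
lemma Layout.exists_start (hL : Layout G X Y (u * N) (w * N) T C L) (hB : Bal G X Y u w n)
    (hu : 1 ≤ u) (huw : u ≤ w) {κ : ℝ} (hκ : κ ≤ 1 / (4 * (u + w))) (hK : 2 * K ≤ κ * N)
    (hCL : (#C + #L : ℝ) ≤ κ / 2 * n) (hLX : 4 * (u + w) ^ 2 ≤ #(L ∩ X)) (hN : 1 ≤ N) {μ : ℝ}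
    (hμ : μ * N = n) :
    ∃ S ⊆ L ∩ X, #S = 2 * (u + w) ∧ 1 / (4 * (u + w) ^ 2 * w * 2 ^ (4 * (u + w) ^ 2)) * μ ≤
      (#{τ ∈ T | ∀ v ∈ S, K ≤ degIn G v τ.2} : ℝ) := by
  obtain ⟨S, hS, hSc⟩ := exists_subset_card_eq hLX
  have hM : ∀ τ ∈ T, #τ.2 ≤ w * N := by
    intro τ hτ
    have := Nat.mul_le_mul_right N huw
    rcases hL.fam.size τ hτ with ⟨h1, h2⟩ | ⟨h1, h2⟩ <;> omega
  have hsum : ∑ τ ∈ T, #τ.2 ≤ n := by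
    have := hL.card_right hB.disj
    rw [hB.cardY] at this
    omega
  obtain ⟨S', hS', hc, hcard⟩ := exists_common_tiles (G := G) (K := K) hu hSc hM hsum hκ
    (fun v hv => hL.sum_out_ge hB hu huw hK hCL (inter_subset_right (hS hv)))
  refine ⟨S', hS'.trans hS, hc, ?_⟩
  have hcard' : (n : ℝ) ≤ 4 * (u + w) ^ 2 * (w * N) * 2 ^ (4 * (u + w) ^ 2) *
      #{τ ∈ T | ∀ v ∈ S', K ≤ degIn G v τ.2} := by exact_mod_cast hcard
  have hN' : (0 : ℝ) < N := by exact_mod_cast hN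
  have hu' : (0 : ℝ) < u := by exact_mod_cast hu
  have hw' : (0 : ℝ) < w := by exact_mod_cast hu.trans huw
  rw [← hμ] at hcard'
  rw [div_mul_eq_mul_div, one_mul, div_le_iff₀ (by positivity)]
  refine le_of_mul_le_mul_right (hcard'.trans (le_of_eq ?_)) hN'
  ring

lemma Layout.sum_small_ge (hL : Layout G X Y (u * N) (w * N) T C L) (hB : Bal G X Y u w n)
    (hu : 1 ≤ u) (huw : u < w) {κ : ℝ} (hCL : (#C + #L : ℝ) ≤ κ / 2 * n) :
    ((w : ℝ) / (u + w) - w * κ) * n ≤ ∑ τ ∈ T with #τ.1 = u * N, (#τ.2 : ℝ) := by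
  have h1 : ∀ τ ∈ T, (w * #τ.2 : ℝ) - u * #τ.1 =
      if #τ.1 = u * N then ((w : ℝ) - u) * (u + w) * N else 0 := by
    intro τ hτ
    rcases hL.fam.size τ hτ with ⟨h1, h2⟩ | ⟨h1, h2⟩
    · rw [if_pos h1, h1, h2]; push_cast; ring
    · split_ifs with h3
      · have h4 : w * N = u * N := h1.symm.trans h3
        have h5 : (w * N : ℝ) = u * N := by exact_mod_cast h4
        rw [h1, h2]; push_cast
        linear_combination -(u + w) * h5
      · rw [h1, h2]; push_cast; ring
  have h2 : ∀ τ ∈ T.filter (fun τ => #τ.1 = u * N), (#τ.2 : ℝ) = w * N := by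
    intro τ hτ
    obtain ⟨hτ, h3⟩ := mem_filter.1 hτ
    rcases hL.fam.size τ hτ with ⟨-, h2⟩ | ⟨h1, h2⟩
    · rw [h2]; push_cast; ring
    · rw [h2, ← h3, h1]; push_cast; ring
  have h3 := sum_congr rfl h1
  rw [← sum_filter, sum_const, nsmul_eq_mul, sum_sub_distrib, ← mul_sum, ← mul_sum] at h3
  rw [sum_congr rfl h2, sum_const, nsmul_eq_mul]
  have h4 := hL.card_right hB.disj
  have h5 := hL.card_left hB.disj
  rw [hB.cardY] at h4
  rw [hB.cardX] at h5
  have h6 : #(L ∩ Y) + #(C ∩ Y) ≤ #C + #L := by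
    rw [add_comm]
    exact add_le_add (card_le_card inter_subset_left) (card_le_card inter_subset_left)
  have h4' : (n : ℝ) ≤ #C + #L + ∑ τ ∈ T, (#τ.2 : ℝ) := by
    have : n ≤ #C + #L + ∑ τ ∈ T, #τ.2 := by omega
    exact_mod_cast this
  have h5' : ∑ τ ∈ T, (#τ.1 : ℝ) ≤ n := by
    have : ∑ τ ∈ T, #τ.1 ≤ n := by omega
    exact_mod_cast this
  generalize (#(T.filter fun τ => #τ.1 = u * N) : ℝ) = m at h3 ⊢
  have hu' : (0 : ℝ) < u := by exact_mod_cast hu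
  have huw' : (u : ℝ) + 1 ≤ w := by exact_mod_cast huw
  have hw' : (0 : ℝ) < w := by linarith
  have h7 : w * ((1 - κ / 2) * n) - u * n ≤ m * ((w - u) * (u + w) * N) := by
    rw [← h3]
    refine sub_le_sub (mul_le_mul_of_nonneg_left ?_ hw'.le) (mul_le_mul_of_nonneg_left h5' hu'.le)
    linarith
  have h8 : 0 ≤ κ / 2 * (n : ℝ) := le_trans (by positivity) hCL
  have h9 : (w - u) * (n - w * (κ / 2 * n)) ≤ (w - u) * (m * ((u + w) * N)) := by
    have : 0 ≤ (w - u - 1) * (w * (κ / 2 * n)) := mul_nonneg (by linarith) (by positivity)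
    linarith
  have h10 : n - w * (κ / 2 * n) ≤ m * ((u + w) * N) := le_of_mul_le_mul_left h9 (by linarith)
  have h11 : (u + w) * (((w : ℝ) / (u + w) - w * κ) * n) ≤ (u + w) * (m * (w * N)) := by
    have e : (u + w) * (((w : ℝ) / (u + w) - w * κ) * n) = w * (n - (u + w) * (κ * n)) := by
      field_simp
    rw [e]
    have h12 : w * (κ / 2 * n) ≤ (u + w) * (κ * n) := by nlinarith
    calc w * (n - (u + w) * (κ * n)) ≤ w * (m * ((u + w) * N)) := by
          gcongr; linarith
      _ = _ := by ring
  exact le_of_mul_le_mul_left h11 (by positivity)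

lemma half_le_card_filter {ι : Type*} {A T₁ : Finset ι} {R : ι → ι → Prop} {α κ μ : ℝ}
    (hκ : 0 < κ) (hμ0 : 0 < μ) (hμ1 : 2 * r ≤ κ * (α * μ)) (hA : α * μ ≤ #A) (hT : (#T₁ : ℝ) ≤ μ)
    (hb : ∀ τ ∈ T₁, #{σ ∈ A | R σ τ} ≤ r) :
    α * μ / 2 ≤ #(A.filter fun σ => (#{τ ∈ T₁ | R σ τ} : ℝ) ≤ κ * μ) := by
  have h1 : ∑ σ ∈ A, #{τ ∈ T₁ | R σ τ} ≤ #T₁ * r := by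
    rw [← smul_eq_mul]
    have := sum_card_bipartiteAbove_eq_sum_card_bipartiteBelow (s := A) (t := T₁) R
    simp only [bipartiteAbove, bipartiteBelow] at this
    rw [this]
    exact sum_le_card_nsmul _ _ _ hb
  have h2 : (#A - #(A.filter fun σ => (#{τ ∈ T₁ | R σ τ} : ℝ) ≤ κ * μ) : ℝ) * (κ * μ) ≤
      ∑ σ ∈ A, (#{τ ∈ T₁ | R σ τ} : ℝ) := by
    have h3 := card_filter_add_card_filter_not (s := A)
      (fun σ => (#{τ ∈ T₁ | R σ τ} : ℝ) ≤ κ * μ)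
    have h4 : (#A - #(A.filter fun σ => (#{τ ∈ T₁ | R σ τ} : ℝ) ≤ κ * μ) : ℝ) =
        #{σ ∈ A | ¬ (#{τ ∈ T₁ | R σ τ} : ℝ) ≤ κ * μ} := by
      rw [← h3]; push_cast; ring
    rw [h4, ← nsmul_eq_mul]
    refine (card_nsmul_le_sum _ (fun σ => (#{τ ∈ T₁ | R σ τ} : ℝ)) _ fun σ hσ =>
      (not_le.1 (mem_filter.1 hσ).2).le).trans ?_
    exact sum_le_sum_of_subset_of_nonneg (filter_subset _ _) fun _ _ _ => by positivity
  have h3 : (∑ σ ∈ A, (#{τ ∈ T₁ | R σ τ} : ℝ)) ≤ #T₁ * r := by exact_mod_cast h1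
  generalize (#(A.filter fun σ => (#{τ ∈ T₁ | R σ τ} : ℝ) ≤ κ * μ) : ℝ) = m at *
  have h4 : ((#A - m : ℝ) * κ) * μ ≤ r * μ := by
    have : (#T₁ * r : ℝ) ≤ μ * r := by gcongr
    linarith
  have h5 : (#A - m : ℝ) * κ ≤ r := le_of_mul_le_mul_right h4 hμ0
  have h6 : κ * (α * μ / 2) ≤ κ * m := by nlinarith
  exact le_of_mul_le_mul_left h6 hκ

lemma Layout.arcs_small_ge (hL : Layout G X Y (u * N) (w * N) T C L) (hB : Bal G X Y u w n)
    (hu : 1 ≤ u) (huw : u < w) {κ γ μ : ℝ} (hκ0 : 0 < κ) (hκγ : w * (1 + w) * κ ≤ γ) (hN1 : 1 ≤ N)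
    (hKκ : 2 * K ≤ κ * N) (hKγ : 2 * (w * K) ≤ γ * N) (hCL : (#C + #L : ℝ) ≤ κ / 2 * n)
    (hμ : μ * N = n) (hE : ¬ Extremal G X Y u w γ n) {σ : Finset V × Finset V} (hσT : σ ∈ T)
    (hσ1 : (#{τ ∈ {τ ∈ T | #τ.1 = u * N} | Arc G K σ τ} : ℝ) ≤ κ * μ) :
    γ / (2 * w ^ 2) * μ ^ 2 ≤ (#{p ∈ T ×ˢ T | Arc G K σ p.1 ∧ Arc G K p.1 p.2 ∧
      p.2 ∈ {τ ∈ T | #τ.1 = u * N}} : ℝ) := by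
  have hT := hL.fam
  have hw1 : 1 ≤ w := by omega
  have hTN := hL.card_mul_le hB hu huw.le
  have hu' : (1 : ℝ) ≤ u := by exact_mod_cast hu
  have hw' : (1 : ℝ) ≤ w := by exact_mod_cast hw1
  have hne : σ.1.Nonempty := by
    rw [← card_pos]
    have h1 : 0 < u * N := by positivity
    have h2 : 0 < w * N := by positivity
    rcases hT.size σ hσT with ⟨h, -⟩ | ⟨h, -⟩ <;> omega
  obtain ⟨x, hx⟩ := hne
  have hout := hL.sum_out_ge hB hu huw.le hKκ hCL (hT.left σ hσT hx)
  obtain ⟨T₁, hT₁⟩ : ∃ T₁, T₁ = {τ ∈ T | #τ.1 = u * N} := ⟨_, rfl⟩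
  have hsmall := hL.sum_small_ge hB hu huw hCL
  rw [← hT₁] at hσ1 hsmall ⊢
  have hT₁T : T₁ ⊆ T := hT₁ ▸ filter_subset _ _
  obtain ⟨D, hD⟩ : ∃ D, D = {τ ∈ T | Arc G K σ τ ∧ τ ∉ T₁} := ⟨_, rfl⟩
  have hDT : D ⊆ T := hD ▸ filter_subset _ _
  have hmD : ∀ τ, τ ∈ D ↔ τ ∈ T ∧ Arc G K σ τ ∧ τ ∉ T₁ := by
    intro τ; rw [hD, mem_filter]
  have h1 : ∑ τ ∈ T with K ≤ degIn G x τ.2, (#τ.2 : ℝ) ≤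
      ∑ τ ∈ T₁ with Arc G K σ τ, (#τ.2 : ℝ) + ∑ τ ∈ D, (#τ.2 : ℝ) := by
    rw [← sum_union]
    · refine sum_le_sum_of_subset_of_nonneg ?_ fun _ _ _ => by positivity
      intro τ hτ
      obtain ⟨hτ, hd⟩ := mem_filter.1 hτ
      have hA : Arc G K σ τ := ⟨x, hx, hd⟩
      rw [mem_union]
      by_cases h : τ ∈ T₁
      · exact Or.inl (mem_filter.2 ⟨h, hA⟩)
      · exact Or.inr ((hmD τ).2 ⟨hτ, hA, h⟩)
    · rw [disjoint_left]
      intro τ h1 h2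
      exact ((hmD τ).1 h2).2.2 (mem_filter.1 h1).1
  have h2 : ∑ τ ∈ T₁ with Arc G K σ τ, (#τ.2 : ℝ) ≤ κ * μ * (w * N) := by
    refine (sum_le_card_nsmul _ _ (w * N : ℝ) fun τ hτ => ?_).trans ?_
    · have h3 := Nat.mul_le_mul_right N huw.le
      have h4 : #τ.2 ≤ w * N := by
        rcases hT.size τ (hT₁T (mem_filter.1 hτ).1) with ⟨-, h⟩ | ⟨-, h⟩ <;> omega
      exact_mod_cast h4
    · rw [nsmul_eq_mul]
      gcongr
  have h3 : (u : ℝ) * ∑ τ ∈ D, (#τ.1 : ℝ) = w * ∑ τ ∈ D, (#τ.2 : ℝ) := by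
    rw [mul_sum, mul_sum]
    refine sum_congr rfl fun τ hτ => ?_
    obtain ⟨hτT, -, hτ1⟩ := (hmD τ).1 hτ
    rcases hT.size τ hτT with ⟨h, -⟩ | ⟨h, h'⟩
    · rw [hT₁] at hτ1
      exact absurd (mem_filter.2 ⟨hτT, h⟩) hτ1
    · rw [h, h']; push_cast; ring
  have hn0 : (0 : ℝ) ≤ n := by positivity
  have hγ0 : 0 < γ := lt_of_lt_of_le (by positivity) hκγ
  have h4 : ((w : ℝ) / (u + w) - γ) * n ≤ ∑ τ ∈ D, (#τ.1 : ℝ) := by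
    have h5 : (((u : ℝ) / (u + w) - κ) - w * κ) * n ≤ ∑ τ ∈ D, (#τ.2 : ℝ) := by
      have : κ * μ * (w * N) = w * κ * n := by rw [← hμ]; ring
      linarith
    have h6 : (w : ℝ) * ((((u : ℝ) / (u + w) - κ) - w * κ) * n) ≤ u * ∑ τ ∈ D, (#τ.1 : ℝ) := by
      rw [h3]; gcongr
    have h7 : (u : ℝ) * (((w : ℝ) / (u + w) - γ) * n) ≤
        (w : ℝ) * ((((u : ℝ) / (u + w) - κ) - w * κ) * n) := by
      have e : (w : ℝ) * (((u : ℝ) / (u + w) - κ) - w * κ) =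
          u * (w / (u + w)) - w * (1 + w) * κ := by ring
      rw [← mul_assoc, ← mul_assoc, e]
      have h8 : 1 * γ ≤ u * γ := by gcongr
      have h9 : (u : ℝ) * (w / (u + w) - γ) ≤ u * (w / (u + w)) - w * (1 + w) * κ := by
        rw [mul_sub]; linarith
      exact mul_le_mul_of_nonneg_right h9 hn0
    exact le_of_mul_le_mul_left (h7.trans h6) (by linarith)
  have h5 : ((w : ℝ) / (u + w) - γ) * n ≤ ∑ τ ∈ T₁, (#τ.2 : ℝ) := by
    refine le_trans (mul_le_mul_of_nonneg_right ?_ hn0) hsmall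
    have h6 : 0 ≤ w * w * κ := by positivity
    linarith
  refine (hT.card_arcs_ge hN1 hw1 huw.le hTN hKγ hE hDT hT₁T h4 h5 hμ).trans ?_
  refine Nat.cast_le.2 (card_le_card ?_)
  rintro ⟨τ, τ'⟩ hp
  obtain ⟨hp, hp'⟩ := mem_filter.1 hp
  obtain ⟨hp1, hp2⟩ := mem_product.1 hp
  obtain ⟨hp3, hp4, -⟩ := (hmD _).1 hp1
  exact mem_filter.2 ⟨mem_product.2 ⟨hp3, hT₁T hp2⟩, hp4, hp', hp2⟩

/-- If there are enough uncovered vertices in `X`, then an improvement exists unless `G` is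
extremal; the case of different class sizes. -/
lemma Layout.improvable_lt (hL : Layout G X Y (u * N) (w * N) T C L) (hB : Bal G X Y u w n)
    (hu : 1 ≤ u) (huw : u < w) {κ γ α μ : ℝ} (hκ0 : 0 < κ) (hκ : κ ≤ 1 / (4 * (u + w)))
    (hκγ : w * (1 + w) * κ ≤ γ) (hN : 4 * (u + w) ^ 2 ≤ N) (hK : K = 2 * (u + w) * w)
    (hKκ : 2 * K ≤ κ * N) (hKγ : 2 * (w * K) ≤ γ * N) (hCL : (#C + #L : ℝ) ≤ κ / 2 * n)
    (hLX : 4 * (u + w) ^ 2 ≤ #(L ∩ X)) (hμ0 : 0 < μ) (hμ : μ * N = n)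
    (hα : α = 1 / (4 * (u + w) ^ 2 * w * 2 ^ (4 * (u + w) ^ 2))) (hr : r = 4 * (u + w))
    (hμ1 : 2 * r ≤ κ * (α * μ)) (hμ2 : 4 * w ^ 2 * (2 * r + 1) < α * γ * μ)
    (hE : ¬ Extremal G X Y u w γ n) : Improvable G X Y u w T L 1 (r + 1) := by
  have hT := hL.fam
  have hN1 : 1 ≤ N := by nlinarith
  have hw1 : 1 ≤ w := by omega
  have hwK : w ≤ K := by rw [hK]; nlinarith
  have hTN := hL.card_mul_le hB hu huw.le
  have hu' : (1 : ℝ) ≤ u := by exact_mod_cast hu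
  have hw' : (1 : ℝ) ≤ w := by exact_mod_cast hw1
  have hN' : (1 : ℝ) ≤ N := by exact_mod_cast hN1
  have hTμ : (#T : ℝ) ≤ μ := by
    have h1 : (#T * N : ℝ) ≤ n := by exact_mod_cast hTN
    rw [← hμ] at h1
    exact le_of_mul_le_mul_right h1 (by linarith)
  obtain ⟨S, hS, hSc, hA⟩ := hL.exists_start hB hu huw.le hκ hKκ hCL hLX hN1 hμ
  rw [← hα] at hA
  set A := {τ ∈ T | ∀ v ∈ S, K ≤ degIn G v τ.2} with hAdef
  have hAT : A ⊆ T := filter_subset _ _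
  have hAd : ∀ τ ∈ A, ∀ v ∈ S, K ≤ degIn G v τ.2 := fun τ hτ => (mem_filter.1 hτ).2
  by_contra hI
  have hSX : S ⊆ X := hS.trans inter_subset_right
  have hST : ∀ v ∈ S, v ∉ cov T := fun v hv =>
    disjoint_left.1 hL.disjT (mem_union_right _ (inter_subset_left (hS hv)))
  have hNR : ∀ τ ∈ T, #τ.1 = u * N → ¬ ∀ v ∈ S, Reach G X Y u w T K r v τ := by
    intro τ hτ hc hR
    refine hI ?_
    subst hK hr
    refine hL.improvable_of_reach_lt hB.disj hu huw hN hτ hc ?_ hS hSc hR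
    rcases hT.size τ hτ with ⟨-, h2⟩ | ⟨h1, h2⟩
    · exact h2
    · rw [h2, ← hc, h1]
  set T₁ := {τ ∈ T | #τ.1 = u * N} with hT₁
  have hT₁T : T₁ ⊆ T := filter_subset _ _
  have hb : ∀ τ ∈ T₁, #{σ ∈ A | Arc G K σ τ} ≤ r := by
    intro τ hτ
    by_contra! hlt
    refine hNR τ (hT₁T hτ) (mem_filter.1 hτ).2 fun v hv =>
      Reach.of_arc hT hB.disj hu huw.le hN1 hwK (hSX hv) (hST v hv) fun F hF => ?_
    obtain ⟨σ, hσ, hσF⟩ := exists_mem_notMem_of_card_lt_card (hF.trans_lt hlt)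
    obtain ⟨hσA, hσa⟩ := mem_filter.1 hσ
    exact ⟨σ, hAT hσA, hσF, hAd σ hσA v hv, hσa⟩
  have hc : ∀ τ ∈ T₁, #{p ∈ A ×ˢ T | Arc G K p.1 p.2 ∧ Arc G K p.2 τ} ≤ (2 * r + 1) * #T := by
    intro τ hτ
    by_contra! hlt
    refine hNR τ (hT₁T hτ) (mem_filter.1 hτ).2 fun v hv =>
      Reach.of_arc_arc hT hB.disj hu huw.le hN1 hwK (hSX hv) (hST v hv) fun F hF => ?_
    obtain ⟨σ, hσ, σ', hσ', h1, h2, h3, h4, h5⟩ := exists_pair_avoiding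
      (p := fun x => Arc G K x.1 x.2 ∧ Arc G K x.2 τ) hAT hF 
        (hlt.trans_eq (congrArg card (by congr)))
    exact ⟨σ, hAT hσ, σ', hσ', h1, h2, h3, hAd σ hσ v hv, h4, h5⟩
  obtain ⟨A', hA', hA'c⟩ : ∃ A' ⊆ A.filter (fun σ => (#{τ ∈ T₁ | Arc G K σ τ} : ℝ) ≤ κ * μ),
      α * μ / 2 ≤ (#A' : ℝ) :=
    ⟨_, Subset.rfl, half_le_card_filter (R := Arc G K) hκ0 hμ0 hμ1 hA
      (le_trans (by exact_mod_cast card_le_card hT₁T) hTμ) hb⟩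
  have hγ0 : 0 < γ := lt_of_lt_of_le (by positivity) hκγ
  have hα0 : 0 < α := by rw [hα]; positivity
  clear hα hA
  have ht : ∀ σ ∈ A', γ / (2 * w ^ 2) * μ ^ 2 ≤
      (#{p ∈ T ×ˢ T | Arc G K σ p.1 ∧ Arc G K p.1 p.2 ∧ p.2 ∈ T₁} : ℝ) := by
    intro σ hσ
    obtain ⟨hσA, hσ1⟩ := mem_filter.1 (hA' hσ)
    exact hL.arcs_small_ge hB hu huw hκ0 hκγ hN1 hKκ hKγ hCL hμ hE (hAT hσA) hσ1
  obtain ⟨ρ, hρ, h1, h2⟩ := exists_common_endpoint A' T ({()} : Finset Unit) (Arc G K)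
    (fun _ τ => τ ∈ T₁) ((2 * r + 1) * #T) 0 (fun σ hσ _ _ => by convert ht σ hσ) (by
      simp only [card_singleton, Nat.cast_mul, Nat.cast_add, Nat.cast_ofNat, Nat.cast_one,
        Nat.cast_zero, zero_mul, add_zero, mul_one]
      calc (#T : ℝ) * ((2 * r + 1) * #T) ≤ μ * ((2 * r + 1) * μ) := by gcongr
        _ = (4 * w ^ 2 * (2 * r + 1)) * μ ^ 2 / (4 * w ^ 2) := by field_simp
        _ < (α * γ * μ) * μ ^ 2 / (4 * w ^ 2) := by gcongr
        _ = α * μ / 2 * (γ / (2 * w ^ 2) * μ ^ 2) := by field_simp; norm_num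
        _ ≤ #A' * (γ / (2 * w ^ 2) * μ ^ 2) := by gcongr)
  have hρ1 : ρ ∈ T₁ := by
    by_contra hρ1
    simp [hρ1] at h2
  refine absurd (hc ρ hρ1) (not_le.2 (h1.trans_le (card_le_card ?_)))
  exact filter_subset_filter _ (product_subset_product_left (hA'.trans (filter_subset _ _)))

lemma Layout.sum_arc_ge (hL : Layout G X Y (u * N) (w * N) T C L) (hB : Bal G X Y u w n)
    (hu : 1 ≤ u) (huw : u ≤ w) {κ : ℝ} (hN1 : 1 ≤ N) (hK : 2 * K ≤ κ * N)
    (hCL : (#C + #L : ℝ) ≤ κ / 2 * n) {σ : Finset V × Finset V} (hσ : σ ∈ T) :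
    ((u : ℝ) / (u + w) - κ) * n ≤ ∑ τ ∈ T with Arc G K σ τ, (#τ.2 : ℝ) := by
  have hw1 : 1 ≤ w := hu.trans huw
  have hne : σ.1.Nonempty := by
    rw [← card_pos]
    have h1 : 0 < u * N := by positivity
    have h2 : 0 < w * N := by positivity
    rcases hL.fam.size σ hσ with ⟨h, -⟩ | ⟨h, -⟩ <;> omega
  obtain ⟨x, hx⟩ := hne
  refine (hL.sum_out_ge hB hu huw hK hCL (hL.fam.left σ hσ hx)).trans ?_
  refine sum_le_sum_of_subset_of_nonneg ?_ fun _ _ _ => by positivity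
  exact monotone_filter_right _ fun τ _ h => ⟨x, hx, h⟩

lemma Layout.arcs_eq_ge (hL : Layout G X Y (u * N) (u * N) T C L) (hB : Bal G X Y u u n)
    (hu : 1 ≤ u) {κ γ μ : ℝ} (hκγ : κ ≤ γ) (hN1 : 1 ≤ N)
    (hKκ : 2 * K ≤ κ * N) (hKγ : 2 * (u * K) ≤ γ * N) (hCL : (#C + #L : ℝ) ≤ κ / 2 * n)
    (hμ : μ * N = n) (hE : ¬ Extremal G X Y u u γ n) {τ σ : Finset V × Finset V} (hτT : τ ∈ T)
    (hσT : σ ∈ T.image Prod.swap) :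
    γ / (2 * u ^ 2) * μ ^ 2 ≤ (#{p ∈ T ×ˢ T | Arc G K τ p.1 ∧ Arc G K p.1 p.2 ∧
      Arc G K σ p.2.swap} : ℝ) := by
  have hT := hL.fam
  have hs : ∀ ρ ∈ T, #ρ.1 = u * N ∧ #ρ.2 = u * N := fun ρ hρ => by
    rcases hT.size ρ hρ with h | h <;> exact h
  have hTN := hL.card_mul_le hB hu le_rfl
  have h1 := hL.sum_arc_ge hB hu le_rfl hN1 hKκ hCL hτT
  have h2 := hL.swap.sum_arc_ge hB.swap hu le_rfl hN1 hKκ hCL hσT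
  have hg : ((u : ℝ) / (u + u) - γ) * n ≤ ((u : ℝ) / (u + u) - κ) * n := by gcongr
  rw [filter_image, sum_image (Prod.swap_injective.injOn)] at h2
  refine (hT.card_arcs_ge hN1 hu le_rfl hTN hKγ hE
    (filter_subset (fun ρ => Arc G K τ ρ) T) (filter_subset (fun ρ => Arc G K σ ρ.swap) T)
    (hg.trans (h1.trans_eq ?_)) (hg.trans (h2.trans_eq ?_)) hμ).trans ?_
  · refine sum_congr (by congr) fun ρ hρ => ?_
    have := hs ρ (mem_filter.1 hρ).1
    rw [this.1, this.2]
  · refine sum_congr (by congr) fun ρ hρ => ?_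
    have := hs ρ (mem_filter.1 hρ).1
    rw [Prod.snd_swap, this.1, this.2]
  · refine Nat.cast_le.2 (card_le_card ?_)
    rintro ⟨ρ, ρ'⟩ hp
    obtain ⟨hp, hp'⟩ := mem_filter.1 hp
    obtain ⟨hp1, hp2⟩ := mem_product.1 hp
    obtain ⟨h3, h4⟩ := mem_filter.1 hp1
    obtain ⟨h5, h6⟩ := mem_filter.1 hp2
    exact mem_filter.2 ⟨mem_product.2 ⟨h3, h5⟩, h4, hp', h6⟩

/-- If there are enough uncovered vertices on both sides, then an improvement exists unless `G` is
extremal; the case of equal class sizes. -/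
lemma Layout.improvable_eq (hL : Layout G X Y (u * N) (u * N) T C L) (hB : Bal G X Y u u n)
    (hu : 1 ≤ u) {κ γ α μ : ℝ} (hκ0 : 0 < κ) (hκ : κ ≤ 1 / (4 * (u + u)))
    (hκγ : κ ≤ γ) (hN : 4 * (u + u) ^ 2 ≤ N) (hK : K = 2 * (u + u) * u)
    (hKκ : 2 * K ≤ κ * N) (hKγ : 2 * (u * K) ≤ γ * N) (hCL : (#C + #L : ℝ) ≤ κ / 2 * n)
    (hLX : 4 * (u + u) ^ 2 ≤ #(L ∩ X)) (hLY : 4 * (u + u) ^ 2 ≤ #(L ∩ Y)) (hμ0 : 0 < μ)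
    (hμ : μ * N = n) (hα : α = 1 / (4 * (u + u) ^ 2 * u * 2 ^ (4 * (u + u) ^ 2)))
    (hr : r = 4 * (u + u)) (hμ2 : 2 * u ^ 2 * (3 * r + 1) < α ^ 2 * γ * μ)
    (hE : ¬ Extremal G X Y u u γ n) : Improvable G X Y u u T L 1 (r + 1) := by
  have hT := hL.fam
  have hN1 : 1 ≤ N := by nlinarith
  have huK : u ≤ K := by rw [hK]; nlinarith
  have hTN := hL.card_mul_le hB hu le_rfl
  have hu' : (1 : ℝ) ≤ u := by exact_mod_cast hu
  have hN' : (1 : ℝ) ≤ N := by exact_mod_cast hN1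
  have hTμ : (#T : ℝ) ≤ μ := by
    have h1 : (#T * N : ℝ) ≤ n := by exact_mod_cast hTN
    rw [← hμ] at h1
    exact le_of_mul_le_mul_right h1 (by linarith)
  obtain ⟨S, hS, hSc, hA⟩ := hL.exists_start hB hu le_rfl hκ hKκ hCL hLX hN1 hμ
  obtain ⟨S', hS', hSc', hA'⟩ := hL.swap.exists_start hB.swap hu le_rfl hκ hKκ hCL hLY hN1 hμ
  rw [← hα] at hA hA'
  have hα0 : 0 < α := by rw [hα]; positivity
  clear hα
  obtain ⟨A, hAe⟩ : ∃ A, A = {τ ∈ T | ∀ v ∈ S, K ≤ degIn G v τ.2} := ⟨_, rfl⟩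
  obtain ⟨B, hBe⟩ : ∃ B, B = {τ ∈ T.image Prod.swap | ∀ v ∈ S', K ≤ degIn G v τ.2} := ⟨_, rfl⟩
  rw [← hAe] at hA
  rw [← hBe] at hA'
  have hAT : A ⊆ T := hAe ▸ filter_subset _ _
  have hBT : B ⊆ T.image Prod.swap := hBe ▸ filter_subset _ _
  have hAd : ∀ τ ∈ A, ∀ v ∈ S, K ≤ degIn G v τ.2 := by
    rw [hAe]; exact fun τ hτ => (mem_filter.1 hτ).2
  have hBd : ∀ τ ∈ B, ∀ v ∈ S', K ≤ degIn G v τ.2 := by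
    rw [hBe]; exact fun τ hτ => (mem_filter.1 hτ).2
  have hγ0 : 0 < γ := hκ0.trans_le hκγ
  obtain ⟨ρ, hρ, h1, h2⟩ := exists_common_endpoint A T B (Arc G K)
    (fun σ ρ => Arc G K σ ρ.swap) ((2 * r + 1) * #T) r (t := γ / (2 * u ^ 2) * μ ^ 2)
    (fun τ hτ σ hσ => by
      convert hL.arcs_eq_ge hB hu hκγ hN1 hKκ hKγ hCL hμ hE (hAT hτ) (hBT hσ)) (by
      have hA1 : (#A : ℝ) ≤ μ := le_trans (by exact_mod_cast card_le_card hAT) hTμ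
      have hB1 : (#B : ℝ) ≤ μ := by
        refine le_trans ?_ hTμ
        exact_mod_cast (card_le_card hBT).trans card_image_le
      push_cast
      calc (#T : ℝ) * ((2 * r + 1) * #T * #B + r * (#A * #T))
          ≤ μ * ((2 * r + 1) * μ * μ + r * (μ * μ)) := by gcongr
        _ = (2 * u ^ 2 * (3 * r + 1)) * μ ^ 3 / (2 * u ^ 2) := by field_simp; ring
        _ < (α ^ 2 * γ * μ) * μ ^ 3 / (2 * u ^ 2) := by gcongr
        _ = (α * μ) * (α * μ) * (γ / (2 * u ^ 2) * μ ^ 2) := by field_simp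
        _ ≤ #A * #B * (γ / (2 * u ^ 2) * μ ^ 2) := by gcongr)
  obtain ⟨S₁, hS₁, hc₁⟩ := exists_subset_card_eq (show u ≤ #S by omega)
  obtain ⟨S₂, hS₂, hc₂⟩ := exists_subset_card_eq (show u ≤ #S' by omega)
  have hX : ∀ v ∈ S, v ∈ X ∧ v ∉ cov T := fun v hv =>
    ⟨(mem_inter.1 (hS hv)).2, disjoint_left.1 hL.disjLT (mem_inter.1 (hS hv)).1⟩
  have hY : ∀ v ∈ S', v ∈ Y ∧ v ∉ cov (T.image Prod.swap) := fun v hv =>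
    ⟨(mem_inter.1 (hS' hv)).2, disjoint_left.1 hL.swap.disjLT (mem_inter.1 (hS' hv)).1⟩
  subst hr hK
  refine hL.improvable_of_reach_eq hB.disj hu hN hρ (hS₁.trans hS) (hS₂.trans hS') hc₁ hc₂ ?_ ?_
  · intro v hv
    refine Reach.of_arc_arc hT hB.disj hu le_rfl hN1 huK (hX v (hS₁ hv)).1 (hX v (hS₁ hv)).2
      fun F hF => ?_
    obtain ⟨σ, hσ, σ', hσ', h3, h4, h5, h6, h7⟩ := exists_pair_avoiding
      (p := fun x => Arc G _ x.1 x.2 ∧ Arc G _ x.2 ρ) hAT hF (h1.trans_eq (congrArg card (by congr)))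
    exact ⟨σ, hAT hσ, σ', hσ', h3, h4, h5, hAd σ hσ v (hS₁ hv), h6, h7⟩
  · intro v hv
    refine Reach.of_arc hL.swap.fam hB.disj.symm hu le_rfl hN1 huK (hY v (hS₂ hv)).1
      (hY v (hS₂ hv)).2 fun F hF => ?_
    obtain ⟨σ, hσ, hσF⟩ := exists_mem_notMem_of_card_lt_card (hF.trans_lt h2)
    obtain ⟨hσB, hσa⟩ := mem_filter.1 hσ
    exact ⟨σ, hBT hσB, hσF, hBd σ hσB v (hS₂ hv), hσa⟩

lemma Tiled.card_inter (h : Tiled G X Y u u C) (hXY : Disjoint X Y) : #(C ∩ X) = #(C ∩ Y) := by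
  induction h with
  | nil => simp
  | cons P Q A hP hQ hc _ hd _ ih =>
    have h1 : (P ∪ Q ∪ A) ∩ X = P ∪ A ∩ X := by
      rw [union_inter_distrib_right, union_inter_distrib_right, inter_eq_left.2 hP,
        disjoint_iff_inter_eq_empty.1 (disjoint_of_subset_left hQ hXY.symm), union_empty]
    have h2 : (P ∪ Q ∪ A) ∩ Y = Q ∪ A ∩ Y := by
      rw [union_inter_distrib_right, union_inter_distrib_right, inter_eq_left.2 hQ,
        disjoint_iff_inter_eq_empty.1 (disjoint_of_subset_left hP hXY), empty_union]
    rw [disjoint_union_left] at hd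
    rw [h1, h2, card_union_of_disjoint (disjoint_of_subset_right inter_subset_left hd.1),
      card_union_of_disjoint (disjoint_of_subset_right inter_subset_left hd.2), ih]
    omega

lemma Layout.card_inter_eq (hL : Layout G X Y (u * N) (u * N) T C L) (hXY : Disjoint X Y)
    (hc : #X = #Y) (hC : Tiled G X Y u u C) : #(L ∩ X) = #(L ∩ Y) := by
  have h1 := hL.card_left hXY
  have h2 := hL.card_right hXY
  have h3 := hC.card_inter hXY
  have h4 : ∑ τ ∈ T, #τ.1 = ∑ τ ∈ T, #τ.2 := sum_congr rfl fun τ hτ => by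
    rcases hL.fam.size τ hτ with h | h <;> omega
  omega

/-- Either all but fewer than `8 (u + w)²` vertices can be tiled or `G` is extremal. -/
theorem tiled_or_extremal (hu : 1 ≤ u) (huw : u ≤ w) {γ : ℝ} (hγ : 0 < γ) :
    ∃ n0 : ℕ, ∀ n ≥ n0, ∀ {V : Type} (G : SimpleGraph V) (X Y : Finset V), Bal G X Y u w n →
      (∃ R ⊆ X ∪ Y, Tiled G X Y u w R ∧ #((X ∪ Y) \ R) < 8 * (u + w) ^ 2) ∨
        Extremal G X Y u w γ n := by
  have hu' : (1 : ℝ) ≤ u := by exact_mod_cast hu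
  have hw' : (1 : ℝ) ≤ w := by exact_mod_cast hu.trans huw
  obtain ⟨κ, hκ0, hκ1, hκ2⟩ : ∃ κ : ℝ, 0 < κ ∧ κ ≤ 1 / (4 * (u + w)) ∧ w * (1 + w) * κ ≤ γ := by
    refine ⟨min (1 / (4 * (u + w))) (γ / (w * (1 + w))), by positivity, min_le_left _ _, ?_⟩
    calc w * (1 + w) * min (1 / (4 * (u + w)) : ℝ) (γ / (w * (1 + w)))
        ≤ w * (1 + w) * (γ / (w * (1 + w))) := by gcongr; exact min_le_right _ _
      _ = γ := by field_simp
  have hκγ : κ ≤ γ := by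
    refine le_trans ?_ hκ2
    have : 1 * κ ≤ (w * (1 + w)) * κ := by gcongr; nlinarith
    linarith
  obtain ⟨K, hK⟩ : ∃ K, K = 2 * (u + w) * w := ⟨_, rfl⟩
  obtain ⟨N, hN1, hN2, hN3⟩ : ∃ N : ℕ, 4 * (u + w) ^ 2 ≤ N ∧ 2 * K ≤ κ * N ∧
      2 * (w * K) ≤ γ * N := by
    obtain ⟨N₁, h₁⟩ := exists_nat_ge (2 * K / κ)
    obtain ⟨N₂, h₂⟩ := exists_nat_ge (2 * (w * K) / γ)
    rw [div_le_iff₀' hκ0] at h₁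
    rw [div_le_iff₀' hγ] at h₂
    refine ⟨4 * (u + w) ^ 2 + N₁ + N₂, by omega, h₁.trans ?_, h₂.trans ?_⟩ <;>
    · gcongr; omega
  have hN0 : 1 ≤ N := le_trans (by nlinarith) hN1
  have hN' : (0 : ℝ) < N := by exact_mod_cast hN0
  obtain ⟨r, hr⟩ : ∃ r, r = 4 * (u + w) := ⟨_, rfl⟩
  obtain ⟨α, hα⟩ : ∃ α : ℝ, α = 1 / (4 * (u + w) ^ 2 * w * 2 ^ (4 * (u + w) ^ 2)) := ⟨_, rfl⟩
  have hα0 : 0 < α := by rw [hα]; positivity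
  obtain ⟨M, hM0, hM1⟩ : ∃ M : ℝ, 0 ≤ M ∧ ∀ μ > M, 2 * r ≤ κ * (α * μ) ∧
      4 * w ^ 2 * (2 * r + 1) < α * γ * μ ∧ 2 * w ^ 2 * (3 * r + 1) < α ^ 2 * γ * μ := by
    refine ⟨2 * r / (κ * α) + 4 * w ^ 2 * (2 * r + 1) / (α * γ) +
      2 * w ^ 2 * (3 * r + 1) / (α ^ 2 * γ), by positivity, fun μ hμ => ?_⟩
    have h1 : 0 ≤ 2 * r / (κ * α) := by positivity
    have h2 : 0 ≤ 4 * w ^ 2 * (2 * r + 1) / (α * γ) := by positivity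
    have h3 : 0 ≤ 2 * w ^ 2 * (3 * r + 1) / (α ^ 2 * γ) := by positivity
    refine ⟨?_, ?_, ?_⟩
    · rw [← mul_assoc, ← div_le_iff₀' (by positivity)]; linarith
    · rw [← div_lt_iff₀' (by positivity)]; linarith
    · rw [← div_lt_iff₀' (by positivity)]; linarith
  obtain ⟨n1, hn1⟩ := almostTiling hu huw
    (show 0 < κ / (2 * (1 + (u + w) * N * (r + 1))) by positivity) N hN0
  obtain ⟨n2, hn2⟩ := exists_nat_gt (M * N)
  refine ⟨max n1 n2, fun n hn V G X Y hB => ?_⟩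
  by_contra! hcon
  obtain ⟨hcon, hE⟩ := hcon
  obtain ⟨Z, hZ, hZt, hZc⟩ := hn1 n (le_of_max_le_left hn) G X Y hB
  obtain ⟨T, hT, rfl⟩ := hZt.exists_fam
  have hμM : M < n / N := by
    rw [lt_div_iff₀ hN']
    exact hn2.trans_le (by exact_mod_cast le_of_max_le_right hn)
  obtain ⟨hμ1, hμ2, hμ3⟩ := hM1 _ hμM
  have hμ0 : (0 : ℝ) < n / N := hM0.trans_lt hμM
  have hμ : (n / N : ℝ) * N = n := by field_simp
  refine absurd (augment (u := u) (w := w) hT hB.disj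
    (fun τ hτ => Tiled.refine (Tiled.single (hT.left τ hτ) (hT.right τ hτ) (hT.size τ hτ)
      (hT.joined τ hτ)) hB.disj) 1 (r + 1) (fun k => 8 * (u + w) ^ 2 ≤ k) ?_)
    fun ⟨R, hR, hRt, hRc⟩ => hRc (hcon R hR hRt)
  intro T' hT' C L hC hCL hCLT hall h1 h2 hbad
  have hL : Layout G X Y (u * N) (w * N) T' C L := ⟨hT.subset hT', hCL, hCLT, hall⟩
  change Improvable G X Y u w T' L 1 (r + 1)
  have hsm : (#C + #L : ℝ) ≤ κ / 2 * n := by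
    have h3 : #C + #L ≤ (1 + (u + w) * N * (r + 1)) * #((X ∪ Y) \ cov T) := by
      have : #(T \ T') ≤ (r + 1) * #((X ∪ Y) \ cov T) := by
        have := Nat.zero_le ((r + 1) * #L); omega
      calc #C + #L = _ := h2
        _ ≤ #((X ∪ Y) \ cov T) + (u * N + w * N) * ((r + 1) * #((X ∪ Y) \ cov T)) := by gcongr
        _ = _ := by ring
    calc (#C + #L : ℝ) ≤ (1 + (u + w) * N * (r + 1)) * #((X ∪ Y) \ cov T) := by
          exact_mod_cast h3
      _ ≤ (1 + (u + w) * N * (r + 1)) * (κ / (2 * (1 + (u + w) * N * (r + 1))) * n) := by gcongr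
      _ = κ / 2 * n := by field_simp
  have hsum : #(L ∩ X) + #(L ∩ Y) = #L := by
    rw [← card_union_of_disjoint, ← inter_union_distrib_left, inter_eq_left.2 hL.subL]
    exact disjoint_of_subset_left inter_subset_right
      (disjoint_of_subset_right inter_subset_right hB.disj)
  rcases huw.lt_or_eq with hlt | rfl
  · rcases le_or_gt (4 * (u + w) ^ 2) #(L ∩ X) with hX | hX
    · exact hL.improvable_lt hB hu hlt hκ0 hκ1 hκ2 hN1 hK hN2 hN3 hsm hX hμ0 hμ hα hr hμ1 hμ2 hE
    · refine Improvable.swap (hL.swap.improvable_lt hB.swap hu hlt hκ0 hκ1 hκ2 hN1 hK hN2 hN3 hsm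
        (by omega) hμ0 hμ hα hr hμ1 hμ2 fun h => hE h.swap)
  · have he := hL.card_inter_eq hB.disj (hB.cardX.trans hB.cardY.symm) hC
    exact hL.improvable_eq hB hu hκ0 hκ1 hκγ hN1 hK hN2 hN3 hsm (by omega) (by omega) hμ0 hμ hα hr
      hμ3 hE

/-! ### Disjoint stars -/

/-- The vertices of `E` are the centres of disjoint stars with `w` leaves each, the set of all
leaves being `L`. -/
inductive Stars (G : SimpleGraph V) (w : ℕ) : Finset V → Finset V → Prop
  | nil : Stars G w ∅ ∅
  | cons (e : V) (W E L : Finset V) : e ∉ E → #W = w → (∀ y ∈ W, G.Adj e y) → Disjoint W L →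
      Stars G w E L → Stars G w (insert e E) (W ∪ L)

variable {E I J Z : Finset V} {s t m k : ℕ}

lemma Stars.card (h : Stars G w E L) : #L = w * #E := by
  induction h with
  | nil => simp
  | cons e W E L he hW _ hd _ ih =>
    rw [card_insert_of_notMem he, card_union_of_disjoint hd, ih, hW]; ring

lemma Stars.union {E' L' : Finset V} (h : Stars G w E L) (h' : Stars G w E' L')
    (hE : Disjoint E E') (hL : Disjoint L L') : Stars G w (E ∪ E') (L ∪ L') := by
  induction h with
  | nil => simpa using h'
  | cons e W E L he hW ha hd _ ih =>
    rw [disjoint_insert_left] at hE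
    rw [disjoint_union_left] at hL
    rw [insert_union, union_assoc]
    refine Stars.cons e W _ _ ?_ hW ha (disjoint_union_right.2 ⟨hd, hL.1⟩) (ih hE.2 hL.2)
    simp only [mem_union, not_or]
    exact ⟨he, hE.1⟩

lemma degIn_le_sdiff (x : V) (A B : Finset V) : degIn G x A ≤ degIn G x (A \ B) + #B := by
  calc degIn G x A ≤ degIn G x ((A \ B) ∪ B) := degIn_mono _ (by
        rw [sdiff_union_self_eq_union]; exact subset_union_left)
    _ ≤ degIn G x (A \ B) + degIn G x B := degIn_union_le _ _ _
    _ ≤ _ := Nat.add_le_add_left (degIn_le _ _) _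

lemma exists_leaves {e : V} (h : k ≤ degIn G e J) : ∃ W ⊆ J, #W = k ∧ ∀ y ∈ W, G.Adj e y := by
  obtain ⟨W, hW, hc⟩ := exists_subset_card_eq h
  exact ⟨W, hW.trans (filter_subset _ _), hc, fun y hy => (mem_filter.1 (hW hy)).2⟩

lemma exists_stars_of_degIn (h : ∀ e ∈ E, w * #E ≤ degIn G e J) : ∃ L ⊆ J, Stars G w E L := by
  obtain ⟨k, hk⟩ : ∃ k, k = #E := ⟨_, rfl⟩
  rw [← hk] at h
  replace hk := hk.ge
  induction E using Finset.induction_on with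
  | empty => exact ⟨∅, empty_subset _, Stars.nil⟩
  | insert e E he ih =>
    rw [card_insert_of_notMem he] at hk
    obtain ⟨L, hL, hs⟩ := ih (fun e he => h e (mem_insert_of_mem he)) (by omega)
    have h1 := h e (mem_insert_self _ _)
    have h2 := degIn_le_sdiff (G := G) e J L
    have h3 : w * (#E + 1) ≤ w * k := Nat.mul_le_mul_left _ hk
    rw [hs.card] at h2
    obtain ⟨W, hW, hWc, ha⟩ := exists_leaves (show w ≤ degIn G e (J \ L) by
      rw [mul_add, mul_one] at h3; omega)
    exact ⟨W ∪ L, union_subset (hW.trans sdiff_subset) hL,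
      Stars.cons e W E L he hWc ha (disjoint_of_subset_left hW sdiff_disjoint) hs⟩

lemma exists_stars_of_sum (h : ∀ E ⊆ I, ∀ W ⊆ J, #E < k → #W ≤ w * k →
      (w - 1) * #I < ∑ i ∈ I \ E, degIn G i (J \ W)) :
    ∃ E ⊆ I, ∃ L ⊆ J, #E = k ∧ Stars G w E L := by
  have key : ∀ j ≤ k, ∃ E ⊆ I, ∃ L ⊆ J, #E = j ∧ Stars G w E L := by
    intro j
    induction j with
    | zero => exact fun _ => ⟨∅, empty_subset _, ∅, empty_subset _, rfl, Stars.nil⟩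
    | succ j ih =>
      intro hj
      obtain ⟨E, hE, L, hL, hc, hs⟩ := ih (by omega)
      have h1 := h E hE L hL (by omega) (by rw [hs.card]; exact Nat.mul_le_mul_left _ (by omega))
      have h2 : ∃ i ∈ I \ E, w ≤ degIn G i (J \ L) := by
        by_contra! hcon
        refine absurd h1 (not_lt.2 ?_)
        calc ∑ i ∈ I \ E, degIn G i (J \ L) ≤ ∑ i ∈ I \ E, (w - 1) :=
              sum_le_sum fun i hi => by have := hcon i hi; omega
          _ = #(I \ E) * (w - 1) := by rw [sum_const, smul_eq_mul]
          _ ≤ #I * (w - 1) := Nat.mul_le_mul_right _ (card_le_card sdiff_subset)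
          _ = _ := mul_comm _ _
      obtain ⟨i, hi, hd⟩ := h2
      obtain ⟨W, hW, hWc, ha⟩ := exists_leaves hd
      have hiE := (mem_sdiff.1 hi).2
      exact ⟨insert i E, insert_subset (mem_sdiff.1 hi).1 hE, W ∪ L,
        union_subset (hW.trans sdiff_subset) hL, by rw [card_insert_of_notMem hiE, hc],
        Stars.cons i W E L hiE hWc ha (disjoint_of_subset_left hW sdiff_disjoint) hs⟩
  exact key k le_rfl

lemma exists_stars_of_capped {I₀ : Finset V} (hI : I ⊆ I₀) (hI₀ : #(I₀ \ I) ≤ w * k)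
    (hmin : ∀ j ∈ J, k ≤ degIn G j I₀) (hcap : ∀ i ∈ I₀, degIn G i J ≤ m) (hk : w ≤ k)
    (hnum : (w - 1) * #I + w * (w * k + (w + 1) * m) < w * #J) :
    ∃ E ⊆ I, ∃ L ⊆ J, #E = k ∧ Stars G w E L := by
  refine exists_stars_of_sum fun E hE W hW hEc hWc => ?_
  have h1 : k * #(J \ W) ≤ ∑ i ∈ I₀, degIn G i (J \ W) := by
    rw [← eAB_eq_sum, eAB_comm, eAB_eq_sum, mul_comm, ← smul_eq_mul]
    exact card_nsmul_le_sum _ _ _ fun j hj => hmin j (mem_sdiff.1 hj).1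
  have h2 : ∑ i ∈ I₀, degIn G i (J \ W) = ∑ i ∈ I₀ \ (I \ E), degIn G i (J \ W) +
      ∑ i ∈ I \ E, degIn G i (J \ W) := (sum_sdiff (sdiff_subset.trans hI)).symm
  have h3 : ∑ i ∈ I₀ \ (I \ E), degIn G i (J \ W) ≤ (w * k + k) * m := by
    have h4 : #(I₀ \ (I \ E)) ≤ w * k + k := by
      calc #(I₀ \ (I \ E)) ≤ #((I₀ \ I) ∪ E) := card_le_card fun x => by
            simp only [mem_sdiff, mem_union]; tauto
        _ ≤ #(I₀ \ I) + #E := card_union_le _ _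
        _ ≤ _ := by omega
    refine (sum_le_card_nsmul _ _ m fun i hi => ?_).trans ?_
    · exact (degIn_mono _ sdiff_subset).trans (hcap i (mem_sdiff.1 hi).1)
    · rw [smul_eq_mul]; exact Nat.mul_le_mul_right _ h4
  have h5 : #J ≤ #(J \ W) + w * k := by
    have := le_card_sdiff W J
    omega
  by_contra! hcon
  obtain ⟨D, hD⟩ : ∃ D, #J = w * k + (w + 1) * m + D :=
    Nat.exists_eq_add_of_le (by by_contra! h6; nlinarith)
  have h6 : k * D ≤ (w - 1) * #I := by
    have h7 : k * #J ≤ k * (#(J \ W) + w * k) := Nat.mul_le_mul_left _ h5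
    rw [hD] at h7
    nlinarith
  have h7 : w * D ≤ k * D := Nat.mul_le_mul_right _ hk
  rw [hD] at hnum
  nlinarith

lemma exists_star_pair_of_le (hts : t ≤ s)
    (hI : w ≤ s → (∀ j ∈ J, s ≤ degIn G j I) ∧ ∀ i ∈ I, degIn G i J ≤ m)
    (hJ : w ≤ t → (∀ i ∈ I, t ≤ degIn G i J) ∧ ∀ j ∈ J, degIn G j I ≤ m)
    (hn1 : (w - 1) * #I + w * (w * s + (w + 1) * m + #Z + t) < w * #J)
    (hn2 : (w - 1) * #J + w * (w * t + (w + 1) * m + #Z + s) < w * #I) :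
    ∃ I₁ ⊆ I, ∃ J₁ ⊆ J, ∃ LI ⊆ (I \ I₁) \ Z, ∃ LJ ⊆ (J \ J₁) \ Z, Stars G w I₁ LJ ∧
      Stars G w J₁ LI ∧ #I₁ ≤ s ∧ s ≤ #I₁ + w ∧ #J₁ ≤ t ∧ t ≤ #J₁ + w := by
  obtain ⟨J₁, hJ₁, LI, hLI, hs, h1, h2⟩ : ∃ J₁ ⊆ J, ∃ LI ⊆ I \ Z, Stars G w J₁ LI ∧ #J₁ ≤ t ∧
      t ≤ #J₁ + w := by
    by_cases ht : w ≤ t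
    · obtain ⟨h1, h2⟩ := hJ ht
      have h3 := le_card_sdiff Z I
      obtain ⟨E, hE, L, hL, hc, hs⟩ := exists_stars_of_capped (J := I \ Z) (m := m)
        (Subset.refl J) (by simp)
        (fun i hi => h1 i (mem_sdiff.1 hi).1)
        (fun j hj => (degIn_mono _ sdiff_subset).trans (h2 j hj)) ht (by
          have : w * #I ≤ w * (#(I \ Z) + #Z) := Nat.mul_le_mul_left _ (by omega)
          nlinarith)
      exact ⟨E, hE, L, hL, hs, by omega, by omega⟩
    · exact ⟨∅, empty_subset _, ∅, empty_subset _, Stars.nil, by simp, by simp; omega⟩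
  obtain ⟨I₁, hI₁, LJ, hLJ, hs', h3, h4⟩ : ∃ I₁ ⊆ I \ LI, ∃ LJ ⊆ (J \ J₁) \ Z, Stars G w I₁ LJ ∧
      #I₁ ≤ s ∧ s ≤ #I₁ + w := by
    by_cases ht : w ≤ s
    · obtain ⟨h3, h4⟩ := hI ht
      have h5 := le_card_sdiff Z (J \ J₁)
      have h6 := le_card_sdiff J₁ J
      obtain ⟨E, hE, L, hL, hc, hs⟩ := exists_stars_of_capped (J := (J \ J₁) \ Z) (m := m) (k := s)
        (sdiff_subset : I \ LI ⊆ I) (by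
          rw [sdiff_sdiff_right_self]
          refine (card_le_card inf_le_right).trans ?_
          rw [hs.card]; exact Nat.mul_le_mul_left _ (h1.trans hts))
        (fun i hi => h3 i (mem_sdiff.1 (mem_sdiff.1 hi).1).1)
        (fun j hj => (degIn_mono _ (sdiff_subset.trans sdiff_subset)).trans (h4 j hj)) ht (by
          have h7 : w * #J ≤ w * (#((J \ J₁) \ Z) + #Z + t) := Nat.mul_le_mul_left _ (by omega)
          have h8 : (w - 1) * #(I \ LI) ≤ (w - 1) * #I :=
            Nat.mul_le_mul_left _ (card_le_card sdiff_subset)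
          nlinarith)
      exact ⟨E, hE, L, hL, hs, by omega, by omega⟩
    · exact ⟨∅, empty_subset _, ∅, empty_subset _, Stars.nil, by simp, by simp; omega⟩
  refine ⟨I₁, hI₁.trans sdiff_subset, J₁, hJ₁, LI, ?_, LJ, hLJ, hs', hs, h3, h4, h1, h2⟩
  intro x hx
  obtain ⟨h5, h6⟩ := mem_sdiff.1 (hLI hx)
  exact mem_sdiff.2 ⟨mem_sdiff.2 ⟨h5, fun h => (mem_sdiff.1 (hI₁ h)).2 hx⟩, h6⟩

lemma exists_star_pair_of_capped
    (hI : w ≤ s → (∀ j ∈ J, s ≤ degIn G j I) ∧ ∀ i ∈ I, degIn G i J ≤ m)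
    (hJ : w ≤ t → (∀ i ∈ I, t ≤ degIn G i J) ∧ ∀ j ∈ J, degIn G j I ≤ m)
    (hn1 : (w - 1) * #I + w * (w * s + (w + 1) * m + #Z + t) < w * #J)
    (hn2 : (w - 1) * #J + w * (w * t + (w + 1) * m + #Z + s) < w * #I) :
    ∃ I₁ ⊆ I, ∃ J₁ ⊆ J, ∃ LI ⊆ (I \ I₁) \ Z, ∃ LJ ⊆ (J \ J₁) \ Z, Stars G w I₁ LJ ∧
      Stars G w J₁ LI ∧ #I₁ ≤ s ∧ s ≤ #I₁ + w ∧ #J₁ ≤ t ∧ t ≤ #J₁ + w := by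
  rcases le_total t s with h | h
  · exact exists_star_pair_of_le h hI hJ hn1 hn2
  · obtain ⟨J₁, h1, I₁, h2, LJ, h3, LI, h4, h5, h6, h7, h8, h9, h10⟩ :=
      exists_star_pair_of_le h hJ hI hn2 hn1
    exact ⟨I₁, h2, J₁, h1, LI, h4, LJ, h3, h6, h5, h9, h10, h7, h8⟩

/-- Stars between `I` and `J`, about `s` of them centred in `I` and about `t` of them centred in
`J`, with no leaf in `Z` or among the centres. -/
lemma exists_star_pair (hI : ∀ j ∈ J, s ≤ degIn G j I) (hJ : ∀ i ∈ I, t ≤ degIn G i J)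
    (hm : (2 * w + 2) * (s + t) + #Z ≤ m)
    (hn1 : (w - 1) * #I + w * (w * s + (w + 1) * m + #Z + 2 * t) < w * #J)
    (hn2 : (w - 1) * #J + w * (w * t + (w + 1) * m + #Z + 2 * s) < w * #I) :
    ∃ I₁ ⊆ I, ∃ J₁ ⊆ J, ∃ LI ⊆ (I \ I₁) \ Z, ∃ LJ ⊆ (J \ J₁) \ Z, Stars G w I₁ LJ ∧
      Stars G w J₁ LI ∧ #I₁ ≤ s ∧ s ≤ #I₁ + w ∧ #J₁ ≤ t ∧ t ≤ #J₁ + w := by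
  have pick : ∀ (A B : Finset V) (s : ℕ), (∀ j ∈ B, s ≤ degIn G j A) → ∃ Aₐ ⊆ A, #Aₐ ≤ s ∧
      (∀ i ∈ Aₐ, m < degIn G i B) ∧ (w ≤ s - #Aₐ → 1 ≤ w → (∀ j ∈ B, s - #Aₐ ≤ degIn G j (A \ Aₐ)) ∧
        ∀ i ∈ A \ Aₐ, degIn G i B ≤ m) := by
    intro A B s h
    obtain ⟨F, hF, hc⟩ := exists_subset_card_eq
      (show min s #{i ∈ A | m < degIn G i B} ≤ #{i ∈ A | m < degIn G i B} from min_le_right _ _)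
    refine ⟨F, hF.trans (filter_subset _ _), by omega, fun i hi => (mem_filter.1 (hF hi)).2,
      fun hw hw1 => ⟨fun j hj => ?_, fun i hi => ?_⟩⟩
    · have := h j hj
      have := degIn_le_sdiff (G := G) j A F
      omega
    · have hF' : F = {i ∈ A | m < degIn G i B} := eq_of_subset_of_card_le hF (by omega)
      obtain ⟨h1, h2⟩ := mem_sdiff.1 hi
      rw [hF', mem_filter, not_and, not_lt] at h2
      exact h2 h1
  have hw1 : 1 ≤ w := by
    by_contra! hw0
    have : w = 0 := by omega
    subst this
    simp at hn1
  obtain ⟨Ia, hIa, hIc, hId, hIr⟩ := pick I J s hI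
  obtain ⟨Ja, hJa, hJc, hJd, hJr⟩ := pick J I t hJ
  have hIs := le_card_sdiff Ia I
  have hJs := le_card_sdiff Ja J
  have hI0 : #(I \ Ia) ≤ #I := card_le_card sdiff_subset
  have hJ0 : #(J \ Ja) ≤ #J := card_le_card sdiff_subset
  obtain ⟨I₁, hI₁, J₁, hJ₁, LI, hLI, LJ, hLJ, h1, h2, h3, h4, h5, h6⟩ :=
    exists_star_pair_of_capped (G := G) (w := w) (I := I \ Ia) (J := J \ Ja) (s := s - #Ia)
      (t := t - #Ja) (m := m) (Z := Z)
      (fun h => ⟨fun j hj => (hIr h hw1).1 j (mem_sdiff.1 hj).1, fun i hi =>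
        (degIn_mono _ sdiff_subset).trans ((hIr h hw1).2 i hi)⟩)
      (fun h => ⟨fun j hj => (hJr h hw1).1 j (mem_sdiff.1 hj).1, fun i hi =>
        (degIn_mono _ sdiff_subset).trans ((hJr h hw1).2 i hi)⟩)
      (by
        have a1 : w * #J ≤ w * (#(J \ Ja) + t) := Nat.mul_le_mul_left _ (by omega)
        have a2 : (w - 1) * #(I \ Ia) ≤ (w - 1) * #I := Nat.mul_le_mul_left _ hI0
        have a3 : w * (w * (s - #Ia) + (w + 1) * m + #Z + (t - #Ja)) ≤
          w * (w * s + (w + 1) * m + #Z + t) := by gcongr <;> omega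
        nlinarith)
      (by
        have a1 : w * #I ≤ w * (#(I \ Ia) + s) := Nat.mul_le_mul_left _ (by omega)
        have a2 : (w - 1) * #(J \ Ja) ≤ (w - 1) * #J := Nat.mul_le_mul_left _ hJ0
        have a3 : w * (w * (t - #Ja) + (w + 1) * m + #Z + (s - #Ia)) ≤
          w * (w * t + (w + 1) * m + #Z + s) := by gcongr <;> omega
        nlinarith)
  have greedy : ∀ (A B Aₐ Bₐ B₁ LB : Finset V) (s t : ℕ), (2 * w + 2) * (s + t) + #Z ≤ m →
      #Aₐ ≤ s → #Bₐ ≤ t → #B₁ ≤ t → #LB ≤ w * s → (∀ i ∈ Aₐ, m < degIn G i B) →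
      ∃ L ⊆ (((B \ Bₐ) \ B₁) \ LB) \ Z, Stars G w Aₐ L := by
    intro A B Aₐ Bₐ B₁ LB s t hm h1 h2 h3 h4 h5
    refine exists_stars_of_degIn fun i hi => ?_
    have a1 := h5 i hi
    have a2 := degIn_le_sdiff (G := G) i B Bₐ
    have a3 := degIn_le_sdiff (G := G) i (B \ Bₐ) B₁
    have a4 := degIn_le_sdiff (G := G) i ((B \ Bₐ) \ B₁) LB
    have a5 := degIn_le_sdiff (G := G) i (((B \ Bₐ) \ B₁) \ LB) Z
    have a6 : w * #Aₐ ≤ w * s := Nat.mul_le_mul_left _ h1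
    have a7 : (2 * w + 2) * (s + t) = 2 * (w * s) + 2 * (w * t) + 2 * s + 2 * t := by ring
    omega
  obtain ⟨VJ, hVJ, hsJ⟩ := greedy I J Ia Ja J₁ LJ s t hm hIc hJc (by omega)
    (by rw [h1.card]; exact Nat.mul_le_mul_left _ (by omega)) hId
  obtain ⟨VI, hVI, hsI⟩ := greedy J I Ja Ia I₁ LI t s (by rwa [add_comm t s]) hJc hIc (by omega)
    (by rw [h2.card]; exact Nat.mul_le_mul_left _ (by omega)) hJd
  have leaves : ∀ B Bₐ B₁ LB VB : Finset V, LB ⊆ ((B \ Bₐ) \ B₁) \ Z →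
      VB ⊆ (((B \ Bₐ) \ B₁) \ LB) \ Z → LB ∪ VB ⊆ (B \ (B₁ ∪ Bₐ)) \ Z := by
    intro B Bₐ B₁ LB VB b1 b2 x hx
    rcases mem_union.1 hx with h | h
    · have := b1 h
      simp only [mem_sdiff, mem_union] at this ⊢
      tauto
    · have := b2 h
      simp only [mem_sdiff, mem_union] at this ⊢
      tauto
  have dE : ∀ B Bₐ B₁ : Finset V, B₁ ⊆ B \ Bₐ → Disjoint B₁ Bₐ := fun B Bₐ B₁ h =>
    disjoint_of_subset_left h sdiff_disjoint
  have dL : ∀ B Bₐ B₁ LB VB : Finset V, VB ⊆ (((B \ Bₐ) \ B₁) \ LB) \ Z → Disjoint LB VB :=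
    fun B Bₐ B₁ LB VB h => disjoint_of_subset_right (h.trans sdiff_subset) disjoint_sdiff
  refine ⟨I₁ ∪ Ia, union_subset (hI₁.trans sdiff_subset) hIa, J₁ ∪ Ja,
    union_subset (hJ₁.trans sdiff_subset) hJa, LI ∪ VI, leaves _ _ _ _ _ hLI hVI, LJ ∪ VJ,
    leaves _ _ _ _ _ hLJ hVJ, h1.union hsJ (dE _ _ _ hI₁) (dL _ _ _ _ _ hVJ),
    h2.union hsI (dE _ _ _ hJ₁) (dL _ _ _ _ _ hVI), ?_⟩
  rw [card_union_of_disjoint (dE _ _ _ hI₁), card_union_of_disjoint (dE _ _ _ hJ₁)]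
  omega

/-! ### Tiling nearly complete pairs -/

lemma miss_subset {x : V} {Q Q' : Finset V} {m : ℕ} (h : #Q ≤ degIn G x Q + m) (hQ : Q' ⊆ Q) :
    #Q' ≤ degIn G x Q' + m := by
  have h1 := degIn_union_le (G := G) x Q' (Q \ Q')
  rw [union_sdiff_of_subset hQ] at h1
  have h2 := degIn_le (G := G) x (Q \ Q')
  have h3 := card_sdiff_add_card_eq_card hQ
  omega

lemma exists_common {P L : Finset V} {m k : ℕ} (h : ∀ l ∈ L, #P ≤ degIn G l P + m)
    (hc : #L * m + k ≤ #P) : ∃ W ⊆ P, #W = k ∧ Joined G W L := by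
  induction L using Finset.induction_on generalizing P with
  | empty =>
    obtain ⟨W, hW, hWc⟩ := exists_subset_card_eq (s := P) (n := k) (by omega)
    exact ⟨W, hW, hWc, fun _ _ y hy => absurd hy (notMem_empty y)⟩
  | insert l L hl ih =>
    rw [card_insert_of_notMem hl, add_mul, one_mul] at hc
    have h1 : #P ≤ #(P.filter fun y => G.Adj l y) + m := h l (mem_insert_self _ _)
    obtain ⟨W, hW, hWc, hJ⟩ := ih (P := P.filter fun y => G.Adj l y)
      (fun l' hl' => miss_subset (h l' (mem_insert_of_mem hl')) (filter_subset _ _)) (by omega)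
    refine ⟨W, hW.trans (filter_subset _ _), hWc, fun x hx y hy => ?_⟩
    rcases mem_insert.1 hy with rfl | hy
    · exact (mem_filter.1 (hW hx)).2.symm
    · exact hJ x hx y hy

/-- Every star can be extended to a tile containing its centre. -/
lemma Stars.absorb (hXY : Disjoint X Y) {E L : Finset V} {p q m : ℕ} (hs : Stars G w E L)
    (hE : E ⊆ X) (hL : L ⊆ Y) (hp : 1 ≤ p) (hq : q ≤ w) (hpq : p = u ∧ q = w ∨ p = w ∧ q = u)
    {P : Finset V} (hP : P ⊆ X) (hEP : Disjoint E P) (hm : ∀ l ∈ L, #P ≤ degIn G l P + m)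
    (hc : w * m + p * #E ≤ #P) :
    ∃ P₁ ⊆ E ∪ P, ∃ Q₁ ⊆ L, E ⊆ P₁ ∧ #P₁ = p * #E ∧ #Q₁ = q * #E ∧
      Tiled G X Y u w (P₁ ∪ Q₁) := by
  induction hs generalizing P with
  | nil => exact ⟨∅, by simp, ∅, by simp, by simp, by simp, by simp, by simpa using Tiled.nil⟩
  | cons e W E L he hW ha hd _ ih =>
    rw [insert_subset_iff] at hE
    rw [union_subset_iff] at hL
    rw [disjoint_insert_left] at hEP
    rw [card_insert_of_notMem he, mul_add, mul_one] at hc ⊢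
    obtain ⟨W', hW', hWc⟩ := exists_subset_card_eq (s := W) (n := q) (by omega)
    have h1 : q * m ≤ w * m := Nat.mul_le_mul_right _ hq
    obtain ⟨R, hR, hRc, hJ⟩ := exists_common (G := G) (P := P) (L := W') (m := m) (k := p - 1)
      (fun l hl => hm l (mem_union_left _ (hW' hl))) (by rw [hWc]; omega)
    have h2 := card_sdiff_add_card_eq_card hR
    obtain ⟨P₁, hP₁, Q₁, hQ₁, hEP₁, hPc, hQc, hT⟩ := ih hE.2 hL.2 (P := P \ R)
      (sdiff_subset.trans hP) (disjoint_of_subset_right sdiff_subset hEP.2)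
      (fun l hl => miss_subset (hm l (mem_union_right _ hl)) sdiff_subset) (by omega)
    have heR : e ∉ R := fun h => hEP.1 (hR h)
    have hdP : Disjoint (insert e R) P₁ := by
      rw [disjoint_left]
      intro x hx hx1
      have h3 := hP₁ hx1
      rw [mem_union, mem_sdiff] at h3
      rcases mem_insert.1 hx with rfl | hx
      · exact h3.elim he fun h => hEP.1 h.1
      · exact h3.elim (fun h => disjoint_left.1 hEP.2 h (hR hx)) fun h => h.2 hx
    have hdQ : Disjoint W' Q₁ := disjoint_of_subset_left hW' (disjoint_of_subset_right hQ₁ hd)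
    have hX1 : insert e R ⊆ X := insert_subset hE.1 (hR.trans hP)
    have hX2 : P₁ ⊆ X := hP₁.trans (union_subset hE.2 (sdiff_subset.trans hP))
    have hY1 : W' ⊆ Y := hW'.trans hL.1
    have hY2 : Q₁ ⊆ Y := hQ₁.trans hL.2
    refine ⟨insert e R ∪ P₁, ?_, W' ∪ Q₁, union_subset_union hW' hQ₁, ?_, ?_, ?_, ?_⟩
    · refine union_subset (insert_subset (by simp) (hR.trans subset_union_right)) (hP₁.trans ?_)
      exact union_subset_union (subset_insert _ _) sdiff_subset
    · exact insert_subset (by simp) (hEP₁.trans subset_union_right)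
    · rw [card_union_of_disjoint hdP, card_insert_of_notMem heR, hPc]; omega
    · rw [card_union_of_disjoint hdQ, hQc, hWc]; ring
    · rw [union_union_union_comm]
      refine Tiled.cons _ _ _ hX1 hY1 ?_ ?_ ?_ hT
      · rw [card_insert_of_notMem heR, hRc, hWc]; omega
      · intro x hx y hy
        rcases mem_insert.1 hx with rfl | hx
        · exact ha y (hW' hy)
        · exact hJ x hx y hy
      · simp only [disjoint_union_left, disjoint_union_right]
        exact ⟨⟨hdP, disjoint_of_subset_left hY1 (disjoint_of_subset_right hX2 hXY.symm)⟩,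
          disjoint_of_subset_left hX1 (disjoint_of_subset_right hY2 hXY), hdQ⟩

lemma exists_groups (k : ℕ) : ∀ (a : ℕ) (P : Finset V), a * k ≤ #P → ∃ g : ℕ → Finset V,
    (∀ i < a, g i ⊆ P ∧ #(g i) = k) ∧ ∀ i < a, ∀ j < a, i ≠ j → Disjoint (g i) (g j) := by
  intro a
  induction a with
  | zero => exact fun P _ => ⟨fun _ => ∅, by simp, by simp⟩
  | succ a ih =>
    intro P hP
    rw [Nat.succ_mul] at hP
    obtain ⟨A, hA, hAc⟩ := exists_subset_card_eq (s := P) (n := k) (by omega)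
    have h1 := card_sdiff_add_card_eq_card hA
    obtain ⟨g, hg, hd⟩ := ih (P \ A) (by omega)
    have hgA : ∀ i < a, Disjoint (g i) A := fun i hi =>
      disjoint_of_subset_left (hg i hi).1 sdiff_disjoint
    refine ⟨Function.update g a A, fun i hi => ?_, fun i hi j hj hij => ?_⟩
    · rcases eq_or_ne i a with rfl | h
      · simpa using ⟨hA, hAc⟩
      · rw [Function.update_of_ne h]
        exact ⟨(hg i (by omega)).1.trans sdiff_subset, (hg i (by omega)).2⟩
    · rcases eq_or_ne i a with rfl | h
      · rw [Function.update_self, Function.update_of_ne hij.symm]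
        exact (hgA j (by omega)).symm
      · rw [Function.update_of_ne h]
        rcases eq_or_ne j a with rfl | h'
        · rw [Function.update_self]; exact hgA i (by omega)
        · rw [Function.update_of_ne h']; exact hd i (by omega) j (by omega) hij

lemma card_groups_bad {k m : ℕ} {Q R : Finset V} {g : ℕ → Finset V} {a : ℕ}
    (hg : ∀ i < a, g i ⊆ Q) (hd : ∀ i < a, ∀ j < a, i ≠ j → Disjoint (g i) (g j))
    (hm : ∀ x ∈ R, #Q ≤ degIn G x Q + m) (hR : #R = k) :
    #((range a).filter fun i => ¬ Joined G R (g i)) ≤ k * m := by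
  have h1 : ∀ i ∈ (range a).filter fun i => ¬ Joined G R (g i), ∃ y, y ∈ g i ∧ ∃ x ∈ R,
      ¬ G.Adj x y := by
    intro i hi
    have h2 := (mem_filter.1 hi).2
    simp only [Joined, not_forall] at h2
    obtain ⟨x, hx, y, hy, h⟩ := h2
    exact ⟨y, hy, x, hx, h⟩
  rcases isEmpty_or_nonempty V with hV | hV
  · rw [filter_false_of_mem fun i _ hJ => hJ fun x => (hV.false x).elim]; simp
  choose! f hf1 hf2 using h1
  have h3 : #((range a).filter fun i => ¬ Joined G R (g i)) ≤
      #(R.biUnion fun x => Q.filter fun y => ¬ G.Adj x y) := by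
    refine card_le_card_of_injOn f (fun i hi => ?_) fun i hi j hj hij => ?_
    · obtain ⟨x, hx, hn⟩ := hf2 i hi
      exact mem_coe.2 (mem_biUnion.2 ⟨x, hx, mem_filter.2
        ⟨hg i (mem_range.1 (mem_filter.1 hi).1) (hf1 i hi), hn⟩⟩)
    · by_contra hne
      refine disjoint_left.1 (hd i (mem_range.1 (mem_filter.1 hi).1) j
        (mem_range.1 (mem_filter.1 hj).1) hne) (hf1 i hi) ?_
      rw [hij]; exact hf1 j hj
  refine h3.trans ?_
  rw [← hR]
  refine card_biUnion_le_card_mul _ _ _ fun x hx => ?_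
  have h4 := hm x hx
  have h5 := card_filter_add_card_filter_not (s := Q) (fun y => G.Adj x y)
  have h6 : degIn G x Q = #(Q.filter fun y => G.Adj x y) := rfl
  omega

lemma exists_tiled_of_miss_left (hXY : Disjoint X Y) {P Q : Finset V} {a m : ℕ} (hP : P ⊆ X)
    (hQ : Q ⊆ Y) (hmP : ∀ x ∈ P, #Q ≤ degIn G x Q + m) (hmQ : ∀ y ∈ Q, #P ≤ degIn G y P + m)
    (ha : (u + w) * m ≤ a) (hcP : a * u ≤ #P) (hcQ : a * w ≤ #Q) :
    ∃ R ⊆ P ∪ Q, Tiled G X Y u w R ∧ #R = a * (u + w) := by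
  obtain ⟨g, hg, hgd⟩ := exists_groups u a P hcP
  obtain ⟨f, hf, hfd⟩ := exists_groups w a Q hcQ
  obtain ⟨φ, hφ, hφt⟩ : ∃ φ : Fin a → ℕ, Function.Injective φ ∧
      ∀ i : Fin a, φ i ∈ (range a).filter fun j => Joined G (g i) (f j) := by
    rw [← all_card_le_biUnion_card_iff_exists_injective]
    intro S
    rcases S.eq_empty_or_nonempty with rfl | ⟨i, hi⟩
    · simp
    have h1 : a ≤ #(S.biUnion fun i : Fin a => (range a).filter fun j => Joined G (g i) (f j)) +
        u * m := by
      have h2 := card_groups_bad (G := G) (fun j hj => (hf j hj).1) hfd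
        (fun x hx => hmP x ((hg i i.2).1 hx)) (hg i i.2).2
      have h3 := card_filter_add_card_filter_not (s := range a) (fun j => Joined G (g i) (f j))
      have h4 := card_le_card (subset_biUnion_of_mem
        (fun i : Fin a => (range a).filter fun j => Joined G (g i) (f j)) hi)
      rw [card_range] at h3
      omega
    by_cases h : range a ⊆ S.biUnion fun i : Fin a => (range a).filter fun j =>
        Joined G (g i) (f j)
    · have h2 := card_le_card h
      rw [card_range] at h2
      have h3 := card_le_univ S
      rw [Fintype.card_fin] at h3
      exact h3.trans h2
    · obtain ⟨j, hj, hjn⟩ := not_subset.1 h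
      rw [mem_range] at hj
      have h2 := card_groups_bad (G := G) (fun i hi => (hg i hi).1) hgd
        (fun y hy => hmQ y ((hf j hj).1 hy)) (hf j hj).2
      have h3 : #S ≤ w * m := by
        refine le_trans ?_ h2
        refine card_le_card_of_injOn (fun i : Fin a => (i : ℕ)) (fun i hi => ?_)
          (Fin.val_injective.injOn)
        refine mem_coe.2 (mem_filter.2 ⟨mem_range.2 i.2, fun hJ => hjn ?_⟩)
        exact mem_biUnion.2 ⟨i, hi, mem_filter.2 ⟨mem_range.2 hj, hJ.symm⟩⟩
      rw [add_mul] at ha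
      omega
  have key : ∀ S : Finset (Fin a), Tiled G X Y u w (S.biUnion fun i : Fin a => g i ∪ f (φ i)) ∧
      #(S.biUnion fun i : Fin a => g i ∪ f (φ i)) = #S * (u + w) := by
    intro S
    induction S using Finset.induction_on with
    | empty => simpa using Tiled.nil
    | insert i S hi ih =>
      have hr : ∀ i : Fin a, φ i < a := fun i => mem_range.1 (mem_filter.1 (hφt i)).1
      have hsub : ∀ i : Fin a, g i ⊆ X ∧ f (φ i) ⊆ Y := fun i =>
        ⟨(hg i i.2).1.trans hP, (hf _ (hr i)).1.trans hQ⟩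
      have hdis : Disjoint (g i ∪ f (φ i)) (S.biUnion fun i : Fin a => g i ∪ f (φ i)) := by
        rw [disjoint_biUnion_right]
        intro j hj
        have hij : i ≠ j := fun h => hi (h ▸ hj)
        simp only [disjoint_union_left, disjoint_union_right]
        exact ⟨⟨hgd i i.2 j j.2 (fun h => hij (Fin.ext h)), disjoint_of_subset_left (hsub i).2
          (disjoint_of_subset_right (hsub j).1 hXY.symm)⟩, disjoint_of_subset_left (hsub i).1
          (disjoint_of_subset_right (hsub j).2 hXY), hfd _ (hr i) _ (hr j) (hφ.ne hij)⟩
      rw [biUnion_insert]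
      refine ⟨Tiled.cons _ _ _ (hsub i).1 (hsub i).2 (Or.inl ⟨(hg i i.2).2, (hf _ (hr i)).2⟩)
        (mem_filter.1 (hφt i)).2 hdis ih.1, ?_⟩
      rw [card_union_of_disjoint hdis, ih.2, card_insert_of_notMem hi, card_union_of_disjoint
        (disjoint_of_subset_left (hsub i).1 (disjoint_of_subset_right (hsub i).2 hXY)),
        (hg i i.2).2, (hf _ (hr i)).2]
      ring
  refine ⟨_, ?_, (key univ).1, by rw [(key univ).2, card_univ, Fintype.card_fin]⟩
  exact biUnion_subset.2 fun i _ => union_subset_union (hg i i.2).1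
    (hf _ (mem_range.1 (mem_filter.1 (hφt i)).1)).1

lemma exists_tiled_of_miss (hXY : Disjoint X Y) (hu : 1 ≤ u) {a m : ℕ}
    (ha : (u + w) * m ≤ a) : ∀ (b : ℕ) (P Q : Finset V), P ⊆ X → Q ⊆ Y →
    (∀ x ∈ P, #Q ≤ degIn G x Q + m) → (∀ y ∈ Q, #P ≤ degIn G y P + m) →
    a * u + b * w ≤ #P → a * w + b * u ≤ #Q →
    ∃ R ⊆ P ∪ Q, Tiled G X Y u w R ∧ #R = (a + b) * (u + w) := by
  intro b
  induction b with
  | zero =>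
    intro P Q hP hQ hmP hmQ h1 h2
    rw [zero_mul, add_zero] at h1 h2
    exact exists_tiled_of_miss_left hXY hP hQ hmP hmQ ha h1 h2
  | succ b ih =>
    intro P Q hP hQ hmP hmQ h1 h2
    rw [Nat.succ_mul] at h1 h2
    obtain ⟨Q₁, hQ₁, hQc⟩ := exists_subset_card_eq (s := Q) (n := u) (by omega)
    obtain ⟨P₁, hP₁, hPc, hJ⟩ := exists_common (G := G) (P := P) (L := Q₁) (m := m) (k := w)
      (fun l hl => hmQ l (hQ₁ hl)) (by
        rw [hQc]
        have : (u + w) * m * u ≤ a * u := Nat.mul_le_mul_right _ ha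
        have : u * m * 1 ≤ u * m * u := Nat.mul_le_mul_left _ hu
        nlinarith)
    have h3 := card_sdiff_add_card_eq_card hP₁
    have h4 := card_sdiff_add_card_eq_card hQ₁
    obtain ⟨R, hR, hT, hRc⟩ := ih (P \ P₁) (Q \ Q₁) (sdiff_subset.trans hP)
      (sdiff_subset.trans hQ)
      (fun x hx => miss_subset (hmP x (mem_sdiff.1 hx).1) sdiff_subset)
      (fun x hx => miss_subset (hmQ x (mem_sdiff.1 hx).1) sdiff_subset) (by omega) (by omega)
    have hPQ : Disjoint P Q := disjoint_of_subset_left hP (disjoint_of_subset_right hQ hXY)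
    have hd : Disjoint (P₁ ∪ Q₁) R := by
      refine disjoint_of_subset_right hR ?_
      simp only [disjoint_union_left, disjoint_union_right]
      exact ⟨⟨disjoint_sdiff, disjoint_of_subset_left hQ₁ (disjoint_of_subset_right sdiff_subset
        hPQ.symm)⟩, disjoint_of_subset_left hP₁ (disjoint_of_subset_right sdiff_subset hPQ),
        disjoint_sdiff⟩
    refine ⟨P₁ ∪ Q₁ ∪ R, ?_, Tiled.cons _ _ _ (hP₁.trans hP) (hQ₁.trans hQ)
      (Or.inr ⟨hPc, hQc⟩) hJ hd hT, ?_⟩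
    · exact union_subset (union_subset_union hP₁ hQ₁)
        (hR.trans (union_subset_union sdiff_subset sdiff_subset))
    · rw [card_union_of_disjoint hd, card_union_of_disjoint (disjoint_of_subset_left hP₁
        (disjoint_of_subset_right hQ₁ hPQ)), hRc, hPc, hQc]
      ring

lemma exists_tile_counts_of_near {p q e M : ℕ} (hu : 1 ≤ u) (huw : u ≤ w)
    (h1 : u * q ≤ w * p + w * (u + w)) (h2 : w * p ≤ u * q + e)
    (he : u = w → e ≤ w * (u + w))
    (hp : (u + w) * (M + 4 * ((u + w) * (u + w)) + e) ≤ p)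
    (hq : (u + w) * (M + 4 * ((u + w) * (u + w)) + e) ≤ q) :
    ∃ a b : ℕ, M ≤ a ∧ a * u + b * w ≤ p ∧ a * w + b * u ≤ q ∧
      p + q ≤ (a + b) * (u + w) + w * (u + w) + 3 * (u + w) := by
  rcases huw.eq_or_lt with rfl | huw
  · have h3 : q ≤ p + (u + u) := by
      by_contra! hcon
      have := Nat.mul_le_mul_left u hcon.le
      have h4 : u * (p + (u + u) + 1) ≤ u * q := Nat.mul_le_mul_left u hcon
      nlinarith
    have h3' : p ≤ q + (u + u) := by
      by_contra! hcon
      have h4 : u * (q + (u + u) + 1) ≤ u * p := Nat.mul_le_mul_left u hcon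
      have := he rfl
      nlinarith
    have key : ∀ x y : ℕ, x ≤ y → y ≤ x + (u + u) → (u + u) * (M + 4 * ((u + u) * (u + u)) + e) ≤ x →
        ∃ a, M ≤ a ∧ a * u ≤ x ∧ x + y ≤ a * (u + u) + u * (u + u) + 3 * (u + u) := by
      intro x y hxy hyx hx
      have h5 := Nat.div_add_mod' x u
      have h6 := Nat.mod_lt x hu
      refine ⟨x / u, (Nat.le_div_iff_mul_le hu).2 ?_, by omega, ?_⟩
      · nlinarith [Nat.zero_le ((u + u) * (4 * ((u + u) * (u + u)) + e)), Nat.zero_le (M * u)]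
      · rw [mul_add]
        have := Nat.zero_le (u * (u + u))
        omega
    rcases le_total p q with h | h
    · obtain ⟨a, ha, h4, h5⟩ := key p q h h3 hp
      exact ⟨a, 0, ha, by omega, by omega, by simpa using h5⟩
    · obtain ⟨a, ha, h4, h5⟩ := key q p h h3' hq
      exact ⟨a, 0, ha, by omega, by omega, by rw [add_zero]; omega⟩
  · obtain ⟨q₁, hq₁, h3, h4, h5, h6⟩ : ∃ q₁ ≤ q, u * q₁ ≤ w * p ∧ u * p ≤ w * q₁ ∧
        q ≤ q₁ + w * (u + w) ∧ w * p ≤ u * q₁ + e + u := by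
      by_cases hle : u * q ≤ w * p
      · refine ⟨q, le_rfl, hle, ?_, by omega, by omega⟩
        have h7 : e ≤ q := by nlinarith [Nat.zero_le ((u + w) * (M + 4 * ((u + w) * (u + w))))]
        by_contra! hcon
        have h8 : w * (w * q) ≤ w * (u * p) := Nat.mul_le_mul_left _ hcon.le
        have h9 : u * (w * p) ≤ u * (u * q + e) := Nat.mul_le_mul_left _ h2
        have h10 : u * e ≤ u * q := Nat.mul_le_mul_left _ h7
        have h11 : (u + 1) * q ≤ w * q := Nat.mul_le_mul_right _ huw
        have h12 : w * ((u + 1) * q) ≤ w * (w * q) := Nat.mul_le_mul_left _ h11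
        have h13 : (u + 1) * ((u + 1) * q) ≤ w * ((u + 1) * q) := Nat.mul_le_mul_right _ huw
        have h14 : 1 ≤ q := by nlinarith [Nat.zero_le ((u + w) * (M + e))]
        nlinarith
      · have h7 := Nat.div_add_mod (w * p) u
        have h8 := Nat.mod_lt (w * p) hu
        set q₁ := w * p / u
        have h9 : q₁ < q := by
          by_contra! hcon
          have := Nat.mul_le_mul_left u hcon
          omega
        refine ⟨q₁, h9.le, by omega, ?_, ?_, by omega⟩
        · by_contra! hcon
          have h10 : u * (w * q₁ + 1) ≤ u * (u * p) := Nat.mul_le_mul_left _ hcon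
          have h11 : w * (w * p) ≤ w * (u * q₁ + u) := Nat.mul_le_mul_left _ (by omega)
          have h12 : (u + 1) * p ≤ w * p := Nat.mul_le_mul_right _ huw
          have h13 : w * ((u + 1) * p) ≤ w * (w * p) := Nat.mul_le_mul_left _ h12
          have h14 : (u + 1) * (u * p) ≤ w * (u * p) := Nat.mul_le_mul_right _ huw
          have h15 : u ≤ p := by nlinarith [Nat.zero_le ((u + w) * (M + e))]
          have h16 : w * u ≤ w * p := Nat.mul_le_mul_left _ h15
          nlinarith
        · by_contra! hcon
          have h10 : u * (q₁ + w * (u + w) + 1) ≤ u * q := Nat.mul_le_mul_left _ hcon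
          have h11 : 1 * (w * (u + w)) ≤ u * (w * (u + w)) := Nat.mul_le_mul_right _ hu
          nlinarith
    obtain ⟨a, b, ha, hb, hab⟩ := exists_tile_counts hu huw.le h3 h4
    have h7 : b ≤ e + u + 2 * (u * (u + w)) := by
      have h8 : w * (a * u + b * w) ≤ w * p := Nat.mul_le_mul_left _ ha
      have h9 : u * (q₁ + 1) ≤ u * (a * w + b * u + 2 * (u + w)) :=
        Nat.mul_le_mul_left _ (by omega)
      have h10 : (u + 1) * (b * w) ≤ w * (b * w) := Nat.mul_le_mul_right _ huw
      have h11 : b * (u + 1) ≤ b * w := Nat.mul_le_mul_left _ huw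
      have h12 : u * (b * (u + 1)) ≤ u * (b * w) := Nat.mul_le_mul_left _ h11
      nlinarith
    refine ⟨a, b, ?_, ha, by omega, ?_⟩
    · by_contra! hcon
      have h8 : p + 1 ≤ (a + b + 2) * (u + w) := by nlinarith
      have h9 : (a + b + 2) * (u + w) ≤ (M + 4 * ((u + w) * (u + w)) + e) * (u + w) := by
        refine Nat.mul_le_mul_right _ ?_
        nlinarith
      rw [mul_comm] at hp
      omega
    · have h8 : (a + b) * (u + w) = (a * u + b * w) + (a * w + b * u) := by ring
      omega

set_option maxHeartbeats 400000 in
/-- A nearly complete pair together with disjoint stars that absorb its exceptional vertices. -/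
lemma exists_tiled_pair (hXY : Disjoint X Y) (hu : 1 ≤ u) (huw : u ≤ w)
    {P Q EP LP EQ LQ : Finset V} {m e k : ℕ} (hP : P ⊆ X) (hQ : Q ⊆ Y)
    (hEP : EP ⊆ P) (hEQ : EQ ⊆ Q) (hLP : LP ⊆ P \ EP) (hLQ : LQ ⊆ Q \ EQ)
    (hsP : Stars G w EP LQ) (hsQ : Stars G w EQ LP)
    (hmP : ∀ x ∈ P \ EP, #(Q \ EQ) ≤ degIn G x (Q \ EQ) + m)
    (hmQ : ∀ y ∈ Q \ EQ, #(P \ EP) ≤ degIn G y (P \ EP) + m)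
    (h1 : u * #Q ≤ w * #P + w * (u + w)) (h2 : w * #P ≤ u * #Q + e)
    (he : u = w → e ≤ w * (u + w)) (hk : #EP + #EQ ≤ k)
    (hp : 3 * ((u + w) * ((u + w) * m + 4 * ((u + w) * (u + w)) + e + k)) ≤ #P)
    (hq : 3 * ((u + w) * ((u + w) * m + 4 * ((u + w) * (u + w)) + e + k)) ≤ #Q) :
    ∃ R ⊆ P ∪ Q, Tiled G X Y u w R ∧ #((P ∪ Q) \ R) ≤ w * (u + w) + 3 * (u + w) := by
  have hsz : w * m + 3 * (w * k) + 3 * k ≤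
      3 * ((u + w) * ((u + w) * m + 4 * ((u + w) * (u + w)) + e + k)) := by
    have i1 : w * m ≤ (u + w) * ((u + w) * m) := by
      rw [← mul_assoc]
      exact Nat.mul_le_mul_right _ ((Nat.le_add_left w u).trans (Nat.le_mul_self _))
    have i2 : 1 * k ≤ u * k := Nat.mul_le_mul_right _ hu
    have i3 : 0 ≤ (u + w) * (4 * ((u + w) * (u + w)) + e) := Nat.zero_le _
    have i4 : 0 ≤ w * m := Nat.zero_le _
    linarith
  have hkP : #EP ≤ k := by omega
  have hkQ : #EQ ≤ k := by omega
  have hwP : w * #EP ≤ w * k := Nat.mul_le_mul_left _ hkP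
  have hwQ : w * #EQ ≤ w * k := Nat.mul_le_mul_left _ hkQ
  have huP : u * #EP ≤ w * #EP := Nat.mul_le_mul_right _ huw
  have huQ : u * #EQ ≤ w * #EQ := Nat.mul_le_mul_right _ huw
  have cP := card_sdiff_add_card_eq_card hEP
  have cQ := card_sdiff_add_card_eq_card hEQ
  have cLP := card_sdiff_add_card_eq_card hLP
  have cLQ := card_sdiff_add_card_eq_card hLQ
  have cLP' := hsQ.card
  have cLQ' := hsP.card
  obtain ⟨P₁, hP₁, Q₁, hQ₁, hEP₁, hP₁c, hQ₁c, hT₁⟩ := hsP.absorb (u := u) (p := u) (q := w) (m := m)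
    hXY (hEP.trans hP) (hLQ.trans (sdiff_subset.trans hQ)) hu le_rfl (Or.inl ⟨rfl, rfl⟩)
    (P := (P \ EP) \ LP) ((sdiff_subset.trans sdiff_subset).trans hP)
    (disjoint_of_subset_right sdiff_subset disjoint_sdiff)
    (fun l hl => miss_subset (hmQ l (hLQ hl)) sdiff_subset) (by omega)
  obtain ⟨Q₂, hQ₂, P₂, hP₂, hEQ₂, hQ₂c, hP₂c, hT₂⟩ := hsQ.absorb (u := u) (p := w) (q := u) (m := m)
    hXY.symm (hEQ.trans hQ) (hLP.trans (sdiff_subset.trans hP)) (hu.trans huw) huw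
    (Or.inr ⟨rfl, rfl⟩) (P := (Q \ EQ) \ LQ) ((sdiff_subset.trans sdiff_subset).trans hQ)
    (disjoint_of_subset_right sdiff_subset disjoint_sdiff)
    (fun l hl => miss_subset (hmP l (hLP hl)) sdiff_subset) (by omega)
  have hP₁P : P₁ ⊆ P := hP₁.trans (union_subset hEP (sdiff_subset.trans sdiff_subset))
  have hQ₂Q : Q₂ ⊆ Q := hQ₂.trans (union_subset hEQ (sdiff_subset.trans sdiff_subset))
  have hP₂P : P₂ ⊆ P := hP₂.trans (hLP.trans sdiff_subset)
  have hQ₁Q : Q₁ ⊆ Q := hQ₁.trans (hLQ.trans sdiff_subset)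
  have hdP : Disjoint P₁ P₂ := by
    refine disjoint_of_subset_left hP₁ (disjoint_of_subset_right hP₂ (disjoint_union_left.2
      ⟨disjoint_of_subset_right hLP disjoint_sdiff, sdiff_disjoint⟩))
  have hdQ : Disjoint Q₁ Q₂ := by
    refine disjoint_of_subset_left hQ₁ (disjoint_of_subset_right hQ₂ (disjoint_union_right.2
      ⟨disjoint_of_subset_left hLQ sdiff_disjoint, disjoint_sdiff⟩))
  have hPQ : Disjoint P Q := disjoint_of_subset_left hP (disjoint_of_subset_right hQ hXY)
  have dPQ : ∀ {A B : Finset V}, A ⊆ P → B ⊆ Q → Disjoint A B := fun hA hB =>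
    disjoint_of_subset_left hA (disjoint_of_subset_right hB hPQ)
  have cP₁₂ := card_sdiff_add_card_eq_card (union_subset hP₁P hP₂P)
  have cQ₁₂ := card_sdiff_add_card_eq_card (union_subset hQ₁Q hQ₂Q)
  rw [card_union_of_disjoint hdP, hP₁c, hP₂c] at cP₁₂
  rw [card_union_of_disjoint hdQ, hQ₁c, hQ₂c] at cQ₁₂
  have hbig : (u + w) * ((u + w) * m + 4 * ((u + w) * (u + w)) + e) + w * k + w * k ≤
      3 * ((u + w) * ((u + w) * m + 4 * ((u + w) * (u + w)) + e + k)) := by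
    have i1 : 0 ≤ (u + w) * ((u + w) * m + 4 * ((u + w) * (u + w)) + e) := Nat.zero_le _
    have i2 : 0 ≤ u * k := Nat.zero_le _
    have i3 : 0 ≤ w * k := Nat.zero_le _
    linarith
  have eP : ∀ x : ℕ, x * (#(P \ (P₁ ∪ P₂)) + (u * #EP + u * #EQ)) = x * #P := fun x => by rw [cP₁₂]
  have eQ : ∀ x : ℕ, x * (#(Q \ (Q₁ ∪ Q₂)) + (w * #EP + w * #EQ)) = x * #Q := fun x => by rw [cQ₁₂]
  obtain ⟨a, b, hM, ha, hb, hab⟩ := exists_tile_counts_of_near (e := e) (M := (u + w) * m)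
    (p := #(P \ (P₁ ∪ P₂))) (q := #(Q \ (Q₁ ∪ Q₂))) hu huw (by linarith [eP w, eQ u]) (by linarith [eP w, eQ u]) he
    (by omega) (by omega)
  have subP : P \ (P₁ ∪ P₂) ⊆ P \ EP := sdiff_subset_sdiff subset_rfl
    (hEP₁.trans subset_union_left)
  have subQ : Q \ (Q₁ ∪ Q₂) ⊆ Q \ EQ := sdiff_subset_sdiff subset_rfl
    (hEQ₂.trans subset_union_right)
  obtain ⟨R, hR, hT, hRc⟩ := exists_tiled_of_miss (G := G) (m := m) hXY hu hM b _ _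
    (sdiff_subset.trans hP) (sdiff_subset.trans hQ)
    (fun x hx => miss_subset (hmP x (subP hx)) subQ)
    (fun x hx => miss_subset (hmQ x (subQ hx)) subP) ha hb
  have hd₁₂ : Disjoint (P₁ ∪ Q₁) (P₂ ∪ Q₂) := by
    simp only [disjoint_union_left, disjoint_union_right]
    exact ⟨⟨hdP, (dPQ hP₂P hQ₁Q).symm⟩, dPQ hP₁P hQ₂Q, hdQ⟩
  have hdR : Disjoint (P₁ ∪ Q₁ ∪ (P₂ ∪ Q₂)) R := by
    refine disjoint_of_subset_right hR ?_
    rw [union_union_union_comm]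
    exact disjoint_union_right.2 ⟨disjoint_union_left.2 ⟨disjoint_sdiff,
      (dPQ sdiff_subset (union_subset hQ₁Q hQ₂Q)).symm⟩, disjoint_union_left.2
      ⟨dPQ (union_subset hP₁P hP₂P) sdiff_subset, disjoint_sdiff⟩⟩
  rw [union_comm] at hT₂
  have hsub : P₁ ∪ Q₁ ∪ (P₂ ∪ Q₂) ∪ R ⊆ P ∪ Q := by
    refine union_subset (union_subset (union_subset_union hP₁P hQ₁Q)
      (union_subset_union hP₂P hQ₂Q)) (hR.trans (union_subset_union sdiff_subset sdiff_subset))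
  refine ⟨_, hsub, (hT₁.union hT₂.symm hd₁₂).union hT hdR, ?_⟩
  rw [card_sdiff_of_subset hsub, card_union_of_disjoint hdR, card_union_of_disjoint hd₁₂, hRc,
    card_union_of_disjoint (dPQ hP₁P hQ₁Q), card_union_of_disjoint (dPQ hP₂P hQ₂Q), hP₁c, hP₂c, hQ₁c,
    hQ₂c, card_union_of_disjoint hPQ]
  omega

/-! ### The extremal case -/

/-- One of the two nearly complete pairs of the extremal case, after moving the centres of some
stars across. -/
lemma exists_tiled_half (hXY : Disjoint X Y) (hu : 1 ≤ u) (huw : u ≤ w)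
    {A₁ B B₁ C C₀ C₁ D₁ LA LD : Finset V} {m e z d : ℕ} (hC : C ⊆ X) (hB : B ⊆ Y)
    (hC₁ : C₁ ⊆ C) (hB₁ : B₁ ⊆ B) (hA₁ : A₁ ⊆ X \ C) (hD₁ : D₁ ⊆ Y \ B)
    (hLA : LA ⊆ B \ B₁) (hLD : LD ⊆ (C \ C₁) \ C₀) (hsA : Stars G w A₁ LA)
    (hsD : Stars G w D₁ LD) (hmC : ∀ x ∈ C \ C₀, #B ≤ degIn G x B + m)
    (hmB : ∀ y ∈ B, #C ≤ degIn G y C + m) (hC₀ : C₀ ⊆ C) (hdC : ∀ x ∈ C₀, d ≤ degIn G x B)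
    (z0 : #C₀ ≤ z) (zA : #A₁ ≤ z) (zB : #B₁ ≤ z) (zC : #C₁ ≤ z) (zD : #D₁ ≤ z)
    (hd : (2 * w + 1) * z ≤ d)
    (h1 : u * (#B - #B₁ + #D₁) ≤ w * (#C - #C₁ + #A₁) + w * (u + w))
    (h2 : w * (#C - #C₁ + #A₁) ≤ u * (#B - #B₁ + #D₁) + e)
    (he : u = w → e ≤ w * (u + w))
    (hsC : 3 * ((u + w) * ((u + w) * m + 4 * ((u + w) * (u + w)) + e + 3 * z)) + z ≤ #C)
    (hsB : 3 * ((u + w) * ((u + w) * m + 4 * ((u + w) * (u + w)) + e + 3 * z)) + z ≤ #B) :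
    ∃ R ⊆ (C \ C₁ ∪ A₁) ∪ (B \ B₁ ∪ D₁), Tiled G X Y u w R ∧
      #(((C \ C₁ ∪ A₁) ∪ (B \ B₁ ∪ D₁)) \ R) ≤ w * (u + w) + 3 * (u + w) := by
  obtain ⟨L, hL, hsL⟩ : ∃ L ⊆ (B \ B₁) \ LA, Stars G w (C₀ \ C₁) L := by
    refine exists_stars_of_degIn fun x hx => ?_
    have i1 := hdC x (mem_sdiff.1 hx).1
    have i2 := degIn_le_sdiff (G := G) x B B₁
    have i3 := degIn_le_sdiff (G := G) x (B \ B₁) LA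
    have i4 : w * #(C₀ \ C₁) ≤ w * z := Nat.mul_le_mul_left _ ((card_le_card sdiff_subset).trans z0)
    have i5 : w * #A₁ ≤ w * z := Nat.mul_le_mul_left _ zA
    rw [hsA.card] at i3
    have i6 : (2 * w + 1) * z = w * z + w * z + z := by ring
    omega
  have dA : Disjoint (C \ C₁) A₁ := disjoint_of_subset_left sdiff_subset
    (disjoint_of_subset_right hA₁ disjoint_sdiff)
  have dD : Disjoint (B \ B₁) D₁ := disjoint_of_subset_left sdiff_subset
    (disjoint_of_subset_right hD₁ disjoint_sdiff)
  have sP : (C \ C₁ ∪ A₁) \ (A₁ ∪ C₀ \ C₁) ⊆ C \ C₀ := by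
    intro x; simp only [mem_union, mem_sdiff]; tauto
  have sQ : (B \ B₁ ∪ D₁) \ D₁ ⊆ B := by
    intro x; simp only [mem_union, mem_sdiff]; tauto
  have cP : #(C \ C₁ ∪ A₁) = #C - #C₁ + #A₁ := by
    rw [card_union_of_disjoint dA, card_sdiff_of_subset hC₁]
  have cQ : #(B \ B₁ ∪ D₁) = #B - #B₁ + #D₁ := by
    rw [card_union_of_disjoint dD, card_sdiff_of_subset hB₁]
  have cC : #(C₀ \ C₁) ≤ #C₀ := card_le_card sdiff_subset
  have cE := card_union_le A₁ (C₀ \ C₁)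
  refine exists_tiled_pair (m := m) (e := e) (k := 3 * z) (EP := A₁ ∪ C₀ \ C₁) (EQ := D₁) (LP := LD)
    (LQ := LA ∪ L) hXY hu huw
    (union_subset (sdiff_subset.trans hC) (hA₁.trans sdiff_subset))
    (union_subset (sdiff_subset.trans hB) (hD₁.trans sdiff_subset))
    (union_subset subset_union_right
      ((sdiff_subset_sdiff hC₀ subset_rfl).trans subset_union_left)) subset_union_right ?_ ?_
    (hsA.union hsL ?_ (disjoint_of_subset_right hL disjoint_sdiff)) hsD
    (fun x hx => miss_subset (hmC x (sP hx)) sQ)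
    (fun y hy => miss_subset (hmB y (sQ hy)) (sP.trans sdiff_subset))
    (by rw [cP, cQ]; exact h1) (by rw [cP, cQ]; exact h2) he (by omega)
    (by rw [cP]; omega) (by rw [cQ]; omega)
  · intro x hx
    have i1 := hLD hx
    have i2 : x ∉ A₁ := fun h => (mem_sdiff.1 (hA₁ h)).2 (mem_sdiff.1 (mem_sdiff.1 i1).1).1
    simp only [mem_union, mem_sdiff] at i1 ⊢
    tauto
  · intro x hx
    have i1 : x ∈ B \ B₁ := by
      rcases mem_union.1 hx with h | h
      · exact hLA h
      · exact (mem_sdiff.1 (hL h)).1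
    have i2 : x ∉ D₁ := fun h => disjoint_left.1 dD i1 h
    simp only [mem_union, mem_sdiff] at i1 ⊢
    tauto
  · exact (disjoint_of_subset_left (sdiff_subset_sdiff hC₀ subset_rfl) dA).symm

/-- The graph is close to the extremal configuration: `A` and `B` have size about `N`, and
`(X \ A, B)` and `(Y \ B, A)` are nearly complete apart from small sets `C₀` and `D₀`. -/
structure Split (G : SimpleGraph V) (X Y A B C₀ D₀ : Finset V) (N z m d : ℕ) : Prop where
  subA : A ⊆ X
  subB : B ⊆ Y
  subC : C₀ ⊆ X \ A
  subD : D₀ ⊆ Y \ B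
  leA : #A ≤ N + z
  geA : N ≤ #A + z
  leB : #B ≤ N + z
  geB : N ≤ #B + z
  leC : #C₀ ≤ z
  leD : #D₀ ≤ z
  missC : ∀ x ∈ (X \ A) \ C₀, #B ≤ degIn G x B + m
  missB : ∀ y ∈ B, #(X \ A) ≤ degIn G y (X \ A) + m
  missD : ∀ x ∈ (Y \ B) \ D₀, #A ≤ degIn G x A + m
  missA : ∀ y ∈ A, #(Y \ B) ≤ degIn G y (Y \ B) + m
  degC : ∀ x ∈ C₀, d ≤ degIn G x B
  degD : ∀ x ∈ D₀, d ≤ degIn G x A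

lemma Split.exists_tiled {A B C₀ D₀ A₁ B₁ C₁ D₁ LA LB LC LD : Finset V} {N z m d e z' : ℕ}
    (h : Split G X Y A B C₀ D₀ N z m d) (hXY : Disjoint X Y) (hu : 1 ≤ u) (huw : u ≤ w)
    (hA₁ : A₁ ⊆ A) (hB₁ : B₁ ⊆ B) (hC₁ : C₁ ⊆ X \ A) (hD₁ : D₁ ⊆ Y \ B)
    (hLA : LA ⊆ B \ B₁) (hLB : LB ⊆ A \ A₁) (hLC : LC ⊆ ((Y \ B) \ D₁) \ D₀)
    (hLD : LD ⊆ ((X \ A) \ C₁) \ C₀) (hsA : Stars G w A₁ LA) (hsB : Stars G w B₁ LB)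
    (hsC : Stars G w C₁ LC) (hsD : Stars G w D₁ LD)
    (hz : z ≤ z') (zA : #A₁ ≤ z') (zB : #B₁ ≤ z') (zC : #C₁ ≤ z') (zD : #D₁ ≤ z')
    (hd : (2 * w + 1) * z' ≤ d)
    (h1 : u * (#B - #B₁ + #D₁) ≤ w * (#(X \ A) - #C₁ + #A₁) + w * (u + w))
    (h2 : w * (#(X \ A) - #C₁ + #A₁) ≤ u * (#B - #B₁ + #D₁) + e)
    (h1' : u * (#A - #A₁ + #C₁) ≤ w * (#(Y \ B) - #D₁ + #B₁) + w * (u + w))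
    (h2' : w * (#(Y \ B) - #D₁ + #B₁) ≤ u * (#A - #A₁ + #C₁) + e)
    (he : u = w → e ≤ w * (u + w)) {K : ℕ}
    (hK : 3 * ((u + w) * ((u + w) * m + 4 * ((u + w) * (u + w)) + e + 3 * z')) + z' ≤ K)
    (sA : K ≤ #A) (sB : K ≤ #B) (sC : K ≤ #(X \ A)) (sD : K ≤ #(Y \ B)) :
    ∃ R ⊆ X ∪ Y, Tiled G X Y u w R ∧
      #((X ∪ Y) \ R) ≤ 2 * (w * (u + w) + 3 * (u + w)) := by
  have hXA : X \ (X \ A) = A := by rw [sdiff_sdiff_right_self]; exact inter_eq_right.2 h.subA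
  have hYB : Y \ (Y \ B) = B := by rw [sdiff_sdiff_right_self]; exact inter_eq_right.2 h.subB
  obtain ⟨R, hR, hT, hRc⟩ := exists_tiled_half hXY hu huw (C := X \ A) sdiff_subset h.subB hC₁ hB₁
    (by rwa [hXA]) hD₁ hLA hLD hsA hsD h.missC h.missB h.subC h.degC (h.leC.trans hz) zA zB zC zD
    hd h1 h2 he (hK.trans sC) (hK.trans sB)
  obtain ⟨R', hR', hT', hRc'⟩ := exists_tiled_half hXY.symm hu huw (C := Y \ B) sdiff_subset
    h.subA hD₁ hA₁ (by rwa [hYB]) hC₁ hLB hLC hsB hsC h.missD h.missA h.subD h.degD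
    (h.leD.trans hz) zB zA zD zC hd h1' h2' he (hK.trans sD) (hK.trans sA)
  have hdis : Disjoint ((X \ A) \ C₁ ∪ A₁ ∪ (B \ B₁ ∪ D₁))
      ((Y \ B) \ D₁ ∪ B₁ ∪ (A \ A₁ ∪ C₁)) := by
    have sub : ∀ {X A A₁ C₁ : Finset V}, A ⊆ X → A₁ ⊆ A → (X \ A) \ C₁ ∪ A₁ ⊆ X := fun h h' =>
      union_subset (sdiff_subset.trans sdiff_subset) (h'.trans h)
    have sub' : ∀ {X A A₁ C₁ : Finset V}, A ⊆ X → C₁ ⊆ X \ A → A \ A₁ ∪ C₁ ⊆ X := fun h h' =>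
      union_subset (sdiff_subset.trans h) (h'.trans sdiff_subset)
    have dis : ∀ {X A A₁ C₁ : Finset V}, A₁ ⊆ A → C₁ ⊆ X \ A →
        Disjoint ((X \ A) \ C₁ ∪ A₁) (A \ A₁ ∪ C₁) := by
      intro X A A₁ C₁ i1 i2
      simp only [disjoint_union_left, disjoint_union_right]
      exact ⟨⟨disjoint_of_subset_left sdiff_subset (disjoint_of_subset_right sdiff_subset
        sdiff_disjoint), disjoint_sdiff⟩, sdiff_disjoint, disjoint_of_subset_left i1
        (disjoint_of_subset_right i2 disjoint_sdiff)⟩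
    have dXY : ∀ {S T : Finset V}, S ⊆ X → T ⊆ Y → Disjoint S T := fun i1 i2 =>
      disjoint_of_subset_left i1 (disjoint_of_subset_right i2 hXY)
    rw [disjoint_union_left, disjoint_union_right, disjoint_union_right (s := B \ B₁ ∪ D₁)]
    exact ⟨⟨dXY (sub h.subA hA₁) (sub h.subB hB₁), dis hA₁ hC₁⟩, (dis hB₁ hD₁).symm,
      (dXY (sub' h.subA hC₁) (sub' h.subB hD₁)).symm⟩
  have hcov : X ∪ Y ⊆ ((X \ A) \ C₁ ∪ A₁ ∪ (B \ B₁ ∪ D₁)) ∪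
      ((Y \ B) \ D₁ ∪ B₁ ∪ (A \ A₁ ∪ C₁)) := by
    have cov : ∀ X A A₁ C₁ : Finset V, X ⊆ (X \ A) \ C₁ ∪ A₁ ∪ (A \ A₁ ∪ C₁) := by
      intro X A A₁ C₁ x
      simp only [mem_union, mem_sdiff]
      tauto
    refine union_subset ((cov X A A₁ C₁).trans (union_subset_union subset_union_left
      subset_union_right)) ((cov Y B B₁ D₁).trans (union_subset ?_ ?_))
    · exact subset_union_left.trans subset_union_right
    · exact subset_union_right.trans subset_union_left
  have dR : Disjoint R R' := disjoint_of_subset_left hR (disjoint_of_subset_right hR' hdis)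
  have hTR := hT.union hT'.symm dR
  refine ⟨R ∪ R', hTR.subset, hTR, ?_⟩
  calc #((X ∪ Y) \ (R ∪ R')) ≤ #((((X \ A) \ C₁ ∪ A₁ ∪ (B \ B₁ ∪ D₁)) \ R) ∪
        (((Y \ B) \ D₁ ∪ B₁ ∪ (A \ A₁ ∪ C₁)) \ R')) := by
        refine card_le_card fun x hx => ?_
        rw [mem_sdiff, mem_union (s := R), not_or] at hx
        rw [mem_union, mem_sdiff, mem_sdiff]
        exact (mem_union.1 (hcov hx.1)).imp (fun h => ⟨h, hx.2.1⟩) fun h => ⟨h, hx.2.2⟩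
    _ ≤ _ := (card_union_le _ _).trans (by omega)

lemma Bal.le_degIn {A : Finset V} {N y : ℕ} (hB : Bal G X Y u w n) (hA : A ⊆ X)
    (hN : w * n < (u + w) * N + (u + w)) {v : V} (hv : v ∈ Y) (hy : N + y = #A) :
    y ≤ degIn G v A := by
  have h1 := hB.degY v hv
  have h2 := degIn_le_sdiff (G := G) v X (X \ A)
  rw [sdiff_sdiff_right_self, inf_eq_inter, inter_eq_right.2 hA, card_sdiff_of_subset hA, hB.cardX] at h2
  have h3 : #A ≤ n := hB.cardX ▸ card_le_card hA
  by_contra! hcon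
  have h4 : (u + w) * degIn G v X ≤ (u + w) * (y - 1 + (n - #A)) :=
    Nat.mul_le_mul_left _ (by omega)
  obtain ⟨r, rfl⟩ := Nat.exists_eq_add_of_le h3
  obtain ⟨y, rfl⟩ := Nat.exists_eq_succ_of_ne_zero (show y ≠ 0 by omega)
  simp only [Nat.succ_sub_one, Nat.add_sub_cancel_left] at h4
  rw [← hy] at h1 hN
  have h5 := h1.trans h4
  rw [Nat.succ_eq_add_one] at hN h5
  nlinarith

lemma Bal.le_degIn_sub {A : Finset V} {N : ℕ} (hB : Bal G X Y u w n) (hA : A ⊆ X)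
    (hN : w * n < (u + w) * N + (u + w)) {v : V} (hv : v ∈ Y) : #A - N ≤ degIn G v A := by
  rcases le_total N #A with h | h
  · exact hB.le_degIn hA hN hv (Nat.add_sub_of_le h)
  · rw [Nat.sub_eq_zero_of_le h]; exact Nat.zero_le _

lemma star_pair_size {s t q x y M : ℕ} (hw : 1 ≤ w) (hM : 1 ≤ M) (hs : s ≤ M) (ht : t ≤ M)
    (hq : q ≤ 2 * M) (hxy : x ≤ y + 2 * M) (hy : 20 * M * (w + 1) ^ 3 ≤ y) :
    (w - 1) * x + w * (w * s + (w + 1) * ((2 * w + 2) * (s + t) + q) + q + 2 * t) < w * y := by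
  obtain ⟨v, rfl⟩ : ∃ v, w = v + 1 := ⟨w - 1, by omega⟩
  rw [Nat.add_sub_cancel]
  have i1 : v * x ≤ v * (y + 2 * M) := Nat.mul_le_mul_left _ hxy
  have i2 : (v + 1) * ((v + 1) * s + (v + 1 + 1) * ((2 * (v + 1) + 2) * (s + t) + q) + q + 2 * t) ≤
      (v + 1) * ((v + 1) * M + (v + 1 + 1) * ((2 * (v + 1) + 2) * (M + M) + 2 * M) + 2 * M +
        2 * M) := by gcongr
  have i3 : v * (2 * M) + (v + 1) * ((v + 1) * M + (v + 1 + 1) * ((2 * (v + 1) + 2) * (M + M) +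
      2 * M) + 2 * M + 2 * M) < 20 * M * (v + 1 + 1) ^ 3 := by
    linarith [Nat.zero_le (v * M), Nat.zero_le (v ^ 2 * M), Nat.zero_le (v ^ 3 * M)]
  linarith

lemma half_balance_of_lt {N z x c y a b : ℕ} (huw : u < w)
    (hN : (u + w) * N ≤ w * n) (hN' : w * n < (u + w) * N + (u + w)) (hc : c + x = n)
    (hx : x ≤ N + z) (hx' : N ≤ x + z) (hy : y ≤ N + z) (hy' : N ≤ y + z)
    (ha : a ≤ x - N) (ha' : x - N ≤ a + w) (hb : b ≤ y - N) (hb' : y - N ≤ b + w) :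
    u * (y - b) ≤ w * (c + a) + w * (u + w) ∧
      w * (c + a) ≤ u * (y - b) + (u + w) * (z + 1) := by
  constructor
  · have i3 : u * (y - b) ≤ u * (N + w) := Nat.mul_le_mul_left _ (by omega)
    have i4 : w * n ≤ w * (c + a + N + w) := Nat.mul_le_mul_left _ (by omega)
    linarith
  · have i3 : u * N ≤ u * (y - b + z) := Nat.mul_le_mul_left _ (by omega)
    have i4 : w * (c + a + N) ≤ w * (n + z) := Nat.mul_le_mul_left _ (by omega)
    linarith

lemma Split.exists_tiled_of_lt {A B C₀ D₀ : Finset V} {N z m d K : ℕ}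
    (h : Split G X Y A B C₀ D₀ N z m d) (hB : Bal G X Y u w n) (hu : 1 ≤ u) (huw : u < w)
    (hN : (u + w) * N ≤ w * n) (hN' : w * n < (u + w) * N + (u + w))
    (hd : (2 * w + 1) * z ≤ d)
    (hK : 3 * ((u + w) * ((u + w) * m + 4 * ((u + w) * (u + w)) + (u + w) * (z + 1) + 3 * z)) + z ≤ K)
    (hK' : 20 * (z + 1) * (w + 1) ^ 3 ≤ K)
    (sA : K ≤ #A) (sB : K ≤ #B) (sC : K ≤ #(X \ A)) (sD : K ≤ #(Y \ B)) :
    ∃ R ⊆ X ∪ Y, Tiled G X Y u w R ∧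
      #((X ∪ Y) \ R) ≤ 2 * (w * (u + w) + 3 * (u + w)) := by
  have lA : ∀ x : ℕ, x ≤ N + z → x - N ≤ z := fun x hx => by omega
  have cX := card_sdiff_add_card_eq_card h.subA
  have cY := card_sdiff_add_card_eq_card h.subB
  rw [hB.cardX] at cX
  rw [hB.cardY] at cY
  have hn : ∀ x y : ℕ, x ≤ N + z → N ≤ x + z → y ≤ N + z → N ≤ y + z → K ≤ y →
      (w - 1) * x + w * (w * (x - N) + (w + 1) * ((2 * w + 2) * ((x - N) + (y - N)) +
        #(∅ : Finset V)) + #(∅ : Finset V) + 2 * (y - N)) < w * y := by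
    intro x y hx hx' hy hy' hKy
    refine star_pair_size (M := z + 1) (by omega) (by omega) (by omega) (by omega) (by simp)
      (by omega) (hK'.trans hKy)
  obtain ⟨A₁, hA₁, B₁, hB₁, LB, hLB, LA, hLA, hsA, hsB, a1, a2, b1, b2⟩ :=
    exists_star_pair (G := G) (w := w) (I := A) (J := B) (Z := ∅) (s := #A - N) (t := #B - N)
      (fun j hj => hB.le_degIn_sub h.subA hN' (h.subB hj))
      (fun i hi => hB.swap.le_degIn_sub h.subB hN' (h.subA hi)) le_rfl
      (hn _ _ h.leA h.geA h.leB h.geB sB)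
      (by
        have := hn _ _ h.leB h.geB h.leA h.geA sA
        rwa [add_comm (#B - N)] at this)
  rw [sdiff_empty] at hLA hLB
  obtain ⟨n1, n2⟩ := half_balance_of_lt huw hN hN' cX h.leA h.geA h.leB h.geB a1 a2 b1 b2
  obtain ⟨n3, n4⟩ := half_balance_of_lt huw hN hN' cY h.leB h.geB h.leA h.geA b1 b2 a1 a2
  exact h.exists_tiled (C₁ := ∅) (D₁ := ∅) (LC := ∅) (LD := ∅) hB.disj hu huw.le hA₁ hB₁
    (empty_subset _) (empty_subset _) hLA hLB (empty_subset _) (empty_subset _) hsA hsB Stars.nil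
    Stars.nil le_rfl (a1.trans (lA _ h.leA)) (b1.trans (lA _ h.leB)) (by simp) (by simp) hd
    (by simpa only [card_empty, Nat.sub_zero, add_zero] using n1)
    (by simpa only [card_empty, Nat.sub_zero, add_zero] using n2)
    (by simpa only [card_empty, Nat.sub_zero, add_zero] using n3)
    (by simpa only [card_empty, Nat.sub_zero, add_zero] using n4)
    (fun hw => absurd hw huw.ne) hK sA sB sC sD

lemma Split.exists_tiled_of_eq {A B C₀ D₀ : Finset V} {N z m d K : ℕ}
    (h : Split G X Y A B C₀ D₀ N z m d) (hB : Bal G X Y w w n) (hw : 1 ≤ w)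
    (hN : 2 * N ≤ n) (hN' : n < 2 * N + 2) (hd : (2 * w + 1) * (z + 1) ≤ d)
    (hK : 3 * ((w + w) * ((w + w) * m + 4 * ((w + w) * (w + w)) + w * (w + w) + 3 * (z + 1))) +
      (z + 1) ≤ K)
    (hK' : 20 * (z + 1) * (w + 1) ^ 3 ≤ K)
    (sA : K ≤ #A) (sB : K ≤ #B) (sC : K ≤ #(X \ A)) (sD : K ≤ #(Y \ B)) :
    ∃ R ⊆ X ∪ Y, Tiled G X Y w w R ∧
      #((X ∪ Y) \ R) ≤ 2 * (w * (w + w) + 3 * (w + w)) := by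
  have cX := card_sdiff_add_card_eq_card h.subA
  have cY := card_sdiff_add_card_eq_card h.subB
  rw [hB.cardX] at cX
  rw [hB.cardY] at cY
  have b1 := h.leA
  have b2 := h.geA
  have b3 := h.leB
  have b4 := h.geB
  have hwN : w * n < (w + w) * N + (w + w) := by
    have := Nat.mul_lt_mul_of_pos_left hN' hw
    linarith
  have lift : ∀ x y : ℕ, x ≤ y + 2 * w → w * x ≤ w * y + w * (w + w) := fun x y hxy => by
    have := Nat.mul_le_mul_left w hxy
    linarith
  rcases le_total n (#A + #B) with hT | hT
  · obtain ⟨T, hT⟩ := Nat.exists_eq_add_of_le hT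
    obtain ⟨s, t, hst, hs, ht⟩ : ∃ s t, s + t = T ∧ s ≤ #A - N ∧ t ≤ #B - N :=
      ⟨min (#A - N) T, T - min (#A - N) T, by omega, by omega, by omega⟩
    obtain ⟨A₁, hA₁, B₁, hB₁, LB, hLB, LA, hLA, hsA, hsB, a1, a2, a3, a4⟩ :=
      exists_star_pair (G := G) (w := w) (I := A) (J := B) (Z := ∅) (s := s) (t := t)
        (fun j hj => hs.trans (hB.le_degIn_sub h.subA hwN (h.subB hj)))
        (fun i hi => ht.trans (hB.swap.le_degIn_sub h.subB hwN (h.subA hi))) le_rfl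
        (star_pair_size (M := z + 1) hw (by omega) (by omega) (by omega) (by simp) (by omega)
          (hK'.trans sB))
        (by
          rw [add_comm s t]
          exact star_pair_size (M := z + 1) hw (by omega) (by omega) (by omega) (by simp)
            (by omega) (hK'.trans sA))
    rw [sdiff_empty] at hLA hLB
    have hA₁c := card_le_card hA₁
    have hB₁c := card_le_card hB₁
    exact h.exists_tiled (z' := z + 1) (C₁ := ∅) (D₁ := ∅) (LC := ∅) (LD := ∅) hB.disj hw le_rfl
      hA₁ hB₁ (empty_subset _) (empty_subset _) hLA hLB (empty_subset _) (empty_subset _) hsA hsB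
      Stars.nil Stars.nil (by omega) (by omega) (by omega) (by simp) (by simp) hd
      (lift _ _ (by rw [card_empty]; omega)) (lift _ _ (by rw [card_empty]; omega))
      (lift _ _ (by rw [card_empty]; omega)) (lift _ _ (by rw [card_empty]; omega))
      (fun _ => le_rfl) hK sA sB sC sD
  · obtain ⟨T, hT⟩ := Nat.exists_eq_add_of_le hT
    obtain ⟨s, t, hst, hs, ht⟩ : ∃ s t, s + t = T ∧ s ≤ #(X \ A) - N ∧ t ≤ #(Y \ B) - N :=
      ⟨min (#(X \ A) - N) T, T - min (#(X \ A) - N) T, by omega, by omega, by omega⟩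
    have hZ : #(C₀ ∪ D₀) ≤ 2 * (z + 1) := by
      have h1 := card_union_le C₀ D₀
      have h2 := h.leC
      have h3 := h.leD
      omega
    obtain ⟨C₁, hC₁, D₁, hD₁, LD, hLD, LC, hLC, hsC, hsD, a1, a2, a3, a4⟩ :=
      exists_star_pair (G := G) (w := w) (I := X \ A) (J := Y \ B) (Z := C₀ ∪ D₀) (s := s) (t := t)
        (fun j hj => hs.trans (hB.le_degIn_sub sdiff_subset hwN (sdiff_subset hj)))
        (fun i hi => ht.trans (hB.swap.le_degIn_sub sdiff_subset hwN (sdiff_subset hi))) le_rfl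
        (star_pair_size (M := z + 1) hw (by omega) (by omega) (by omega) hZ (by omega)
          (hK'.trans sD))
        (by
          rw [add_comm s t]
          exact star_pair_size (M := z + 1) hw (by omega) (by omega) (by omega) hZ
            (by omega) (hK'.trans sC))
    have hC₁c := card_le_card hC₁
    have hD₁c := card_le_card hD₁
    exact h.exists_tiled (z' := z + 1) (A₁ := ∅) (B₁ := ∅) (LA := ∅) (LB := ∅) hB.disj hw le_rfl
      (empty_subset _) (empty_subset _) hC₁ hD₁ (empty_subset _) (empty_subset _)
      (hLC.trans (sdiff_subset_sdiff Subset.rfl subset_union_right))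
      (hLD.trans (sdiff_subset_sdiff Subset.rfl subset_union_left))
      Stars.nil Stars.nil hsC hsD (by omega) (by simp) (by simp) (by omega) (by omega) hd
      (lift _ _ (by rw [card_empty]; omega)) (lift _ _ (by rw [card_empty]; omega))
      (lift _ _ (by rw [card_empty]; omega)) (lift _ _ (by rw [card_empty]; omega))
      (fun _ => le_rfl) hK sA sB sC sD

lemma Split.exists_tiled_of_bal {A B C₀ D₀ : Finset V} {N z m d K : ℕ}
    (h : Split G X Y A B C₀ D₀ N z m d) (hB : Bal G X Y u w n) (hu : 1 ≤ u) (huw : u ≤ w)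
    (hN : (u + w) * N ≤ w * n) (hN' : w * n < (u + w) * N + (u + w))
    (hd : (2 * w + 1) * (z + 1) ≤ d)
    (hK : 60 * (u + w) ^ 3 * (m + z + 1) ≤ K)
    (sA : K ≤ #A) (sB : K ≤ #B) (sC : K ≤ #(X \ A)) (sD : K ≤ #(Y \ B)) :
    ∃ R ⊆ X ∪ Y, Tiled G X Y u w R ∧ #((X ∪ Y) \ R) < 8 * (u + w) ^ 2 := by
  have hK' : 20 * (z + 1) * (w + 1) ^ 3 ≤ K := by
    refine le_trans ?_ hK
    have : (w + 1) ^ 3 ≤ (u + w) ^ 3 := Nat.pow_le_pow_left (by omega) 3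
    calc 20 * (z + 1) * (w + 1) ^ 3 ≤ 60 * (m + z + 1) * (u + w) ^ 3 := by gcongr <;> omega
      _ = _ := by ring
  obtain ⟨q, hq⟩ : ∃ q, u + w = q + 2 := ⟨u + w - 2, by omega⟩
  have hwq : w ≤ q + 1 := by omega
  have key : ∃ R ⊆ X ∪ Y, Tiled G X Y u w R ∧
      #((X ∪ Y) \ R) ≤ 2 * (w * (u + w) + 3 * (u + w)) := by
    rcases huw.lt_or_eq with hlt | rfl
    · refine h.exists_tiled_of_lt hB hu hlt hN hN' (le_trans (by gcongr; omega) hd) ?_ hK' sA sB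
        sC sD
      refine le_trans ?_ hK
      rw [hq]
      nlinarith [Nat.zero_le (q * z), Nat.zero_le (q * m), Nat.zero_le (q ^ 2 * z),
        Nat.zero_le (q ^ 2 * m), Nat.zero_le (q ^ 3 * z), Nat.zero_le (q ^ 3 * m),
        Nat.zero_le (q ^ 2), Nat.zero_le (q ^ 3)]
    · have e1 : u * (2 * N) ≤ u * n := by linarith
      have e2 : u * n < u * (2 * N + 2) := by linarith
      refine h.exists_tiled_of_eq hB hu (Nat.le_of_mul_le_mul_left e1 hu)
        (Nat.lt_of_mul_lt_mul_left e2) hd ?_ hK' sA sB sC sD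
      refine le_trans ?_ hK
      have e3 : u * (u + u) ≤ (u + u) * (u + u) := Nat.mul_le_mul_right _ (by omega)
      have e4 : (u + u) * (u * (u + u)) ≤ (u + u) * ((u + u) * (u + u)) :=
        Nat.mul_le_mul_left _ e3
      rw [hq] at e4 ⊢
      nlinarith [Nat.zero_le (q * z), Nat.zero_le (q * m), Nat.zero_le (q ^ 2 * z),
        Nat.zero_le (q ^ 2 * m), Nat.zero_le (q ^ 3 * z), Nat.zero_le (q ^ 3 * m),
        Nat.zero_le (q ^ 2), Nat.zero_le (q ^ 3)]
  obtain ⟨R, hR, hT, hc⟩ := key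
  refine ⟨R, hR, hT, hc.trans_lt ?_⟩
  have e1 : w * (u + w) ≤ (q + 1) * (u + w) := Nat.mul_le_mul_right _ hwq
  rw [hq] at e1 ⊢
  nlinarith [Nat.zero_le (q ^ 2)]

lemma eAB_union_le (A B C : Finset V) : eAB G (A ∪ B) C ≤ eAB G A C + eAB G B C := by
  rw [eAB_comm _ C, eAB_comm A, eAB_comm B, eAB_eq_sum, eAB_eq_sum, eAB_eq_sum, ← sum_add_distrib]
  exact sum_le_sum fun x _ => degIn_union_le x A B

lemma card_mul_le_eAB {A B : Finset V} {c : ℝ} (h : ∀ x ∈ A, c ≤ degIn G x B) :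
    #A * c ≤ eAB G A B := by
  rw [eAB_eq_sum, Nat.cast_sum, ← nsmul_eq_mul]
  exact card_nsmul_le_sum _ _ _ h

lemma eAB_le_card_mul {A B : Finset V} {c : ℝ} (h : ∀ x ∈ A, (degIn G x B : ℝ) ≤ c) :
    (eAB G A B : ℝ) ≤ #A * c := by
  rw [eAB_eq_sum, Nat.cast_sum, ← nsmul_eq_mul]
  exact sum_le_card_nsmul _ _ _ h

lemma cast_card_sdiff_add {A B : Finset V} (h : A ⊆ B) : (#(B \ A) : ℝ) + #A = #B := by
  exact_mod_cast card_sdiff_add_card_eq_card h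

lemma degIn_le_add_card_sdiff (v : V) (A A' : Finset V) :
    (degIn G v A : ℝ) ≤ degIn G v A' + #(A \ A') := by
  have h : degIn G v A ≤ degIn G v A' + degIn G v (A \ A') :=
    (degIn_mono v (by rw [union_sdiff_self_eq_union]; exact subset_union_right)).trans
      (degIn_union_le v A' (A \ A'))
  exact_mod_cast h.trans (Nat.add_le_add_left (degIn_le _ _) _)

lemma degIn_sdiff_add (v : V) {A B : Finset V} (h : A ⊆ B) :
    (degIn G v (B \ A) : ℝ) + degIn G v A = degIn G v B := by
  have := degIn_union (G := G) v (sdiff_disjoint (s := A) (t := B))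
  rw [sdiff_union_of_subset h] at this
  exact_mod_cast this.symm

/-- The vertices of `X` with few neighbours in `B`. -/
noncomputable def lowDeg (G : SimpleGraph V) (X B : Finset V) (c : ℝ) : Finset V :=
  X.filter fun x => (degIn G x B : ℝ) ≤ c

section LowDeg

variable {A B : Finset V} {p x β θ : ℝ}

/-- `A` and `B` are sets of relative size about `p` in the classes `X` and `Y` of size `x`, with
few edges between them. -/
structure SparsePair (G : SimpleGraph V) (X Y A B : Finset V) (p x β θ : ℝ) : Prop where
  half_le : 1 / 2 ≤ p
  le_one : p ≤ 1
  beta_pos : 0 < β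
  beta_le : β ≤ 1 / 100
  theta_pos : 0 < θ
  theta_le : θ ≤ 1 / 100
  pos : 0 < x
  cardX : (#X : ℝ) = x
  cardY : (#Y : ℝ) = x
  degX : ∀ v ∈ X, (1 - p) * x ≤ degIn G v Y
  degY : ∀ v ∈ Y, (1 - p) * x ≤ degIn G v X
  subA : A ⊆ X
  subB : B ⊆ Y
  cardA : (p - β ^ 2 * θ) * x ≤ #A
  cardB : (p - β ^ 2 * θ) * x ≤ #B
  edges : (eAB G A B : ℝ) ≤ β ^ 2 * θ * x ^ 2

lemma SparsePair.swap (h : SparsePair G X Y A B p x β θ) : SparsePair G Y X B A p x β θ :=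
  ⟨h.half_le, h.le_one, h.beta_pos, h.beta_le, h.theta_pos, h.theta_le, h.pos, h.cardY, h.cardX,
    h.degY, h.degX, h.subB, h.subA, h.cardB, h.cardA, by rw [eAB_comm]; exact h.edges⟩

lemma SparsePair.small (h : SparsePair G X Y A B p x β θ) :
    100 * (β ^ 2 * θ) * x ≤ β * θ * x ∧ 100 * (β * θ) * x ≤ θ * x ∧
      100 * (β * θ) * x ≤ β * x := by
  have h1 := h.beta_pos
  have h2 := h.theta_pos
  have h3 := h.pos
  refine ⟨?_, ?_, ?_⟩
  · have := mul_le_mul_of_nonneg_right h.beta_le (show 0 ≤ β * θ * x by positivity)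
    linarith
  · have := mul_le_mul_of_nonneg_right h.beta_le (show 0 ≤ θ * x by positivity)
    linarith
  · have := mul_le_mul_of_nonneg_right h.theta_le (show 0 ≤ β * x by positivity)
    linarith

lemma SparsePair.lowDeg_card (h : SparsePair G X Y A B p x β θ) :
    (#(A \ lowDeg G X B (β * x)) : ℝ) ≤ β * θ * x ∧
      (#(lowDeg G X B (β * x) \ A) : ℝ) ≤ 8 * (β ^ 2 * θ) * x ∧
      (p - 2 * (β * θ)) * x ≤ #(lowDeg G X B (β * x)) ∧
      (#(lowDeg G X B (β * x)) : ℝ) ≤ (p + 2 * (β * θ)) * x := by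
  obtain ⟨hp, hp1, hβ, hβ1, hθ, hθ1, hx, cX, cY, hX, hY, hA, hB, cA, cB, he⟩ := h
  have hγ : 0 < β ^ 2 * θ := by positivity
  have hβθ : 0 < β * θ := by positivity
  have hγ1 : 100 * (β ^ 2 * θ) ≤ β * θ := by
    have := mul_le_mul_of_nonneg_right hβ1 hβθ.le
    linarith
  have hβθ1 : 100 * (β * θ) ≤ θ := by
    have := mul_le_mul_of_nonneg_right hβ1 hθ.le
    linarith
  set γ := β ^ 2 * θ with hγd
  have hlow : lowDeg G X B (β * x) ⊆ X := filter_subset _ _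
  have bA : x / 3 ≤ #A := by nlinarith
  have bB : x / 3 ≤ #B := by nlinarith
  have leX : (#A : ℝ) ≤ x := by rw [← cX]; exact_mod_cast card_le_card hA
  have leY : (#B : ℝ) ≤ x := by rw [← cY]; exact_mod_cast card_le_card hB
  have s1 : (#(A \ lowDeg G X B (β * x)) : ℝ) ≤ β * θ * x := by
    have h1 : #(A \ lowDeg G X B (β * x)) * (β * x) ≤ (eAB G (A \ lowDeg G X B (β * x)) B : ℝ) := by
      refine card_mul_le_eAB fun v hv => ?_
      by_contra! hc
      exact (mem_sdiff.1 hv).2 (mem_filter.2 ⟨hA (mem_sdiff.1 hv).1, hc.le⟩)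
    have h2 : (eAB G (A \ lowDeg G X B (β * x)) B : ℝ) ≤ eAB G A B := by
      exact_mod_cast eAB_mono sdiff_subset Subset.rfl
    have h3 : (#(A \ lowDeg G X B (β * x)) : ℝ) * (β * x) ≤ β * θ * x * (β * x) := by
      rw [hγd] at he; linarith
    exact le_of_mul_le_mul_right h3 (by positivity)
  have s2 : (#(lowDeg G X B (β * x) \ A) : ℝ) ≤ 8 * γ * x := by
    set E := lowDeg G X B (β * x) \ A with hE
    have hEX : E ⊆ X \ A := sdiff_subset_sdiff hlow Subset.rfl
    have h1 : (#B : ℝ) * ((1 - p) * x) ≤ eAB G B X := card_mul_le_eAB fun v hv => hY v (hB hv)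
    have h2 : (eAB G E B : ℝ) ≤ #E * (β * x) := eAB_le_card_mul fun v hv =>
      (mem_filter.1 (mem_sdiff.1 hv).1).2
    have h3 : (eAB G ((X \ A) \ E) B : ℝ) ≤ #((X \ A) \ E) * #B := by exact_mod_cast eAB_le _ _
    have h4 : (eAB G X B : ℝ) ≤ eAB G A B + (eAB G E B + eAB G ((X \ A) \ E) B) := by
      have e1 : X = A ∪ (E ∪ (X \ A) \ E) := by
        rw [union_sdiff_of_subset hEX, union_sdiff_of_subset hA]
      have e2 : eAB G X B ≤ eAB G A B + (eAB G E B + eAB G ((X \ A) \ E) B) := by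
        conv_lhs => rw [e1]
        exact (eAB_union_le _ _ _).trans (Nat.add_le_add_left (eAB_union_le _ _ _) _)
      exact_mod_cast e2
    have h5 := cast_card_sdiff_add hEX
    have h6 := cast_card_sdiff_add hA
    rw [eAB_comm] at h1
    have h7 : (#((X \ A) \ E) : ℝ) = x - #A - #E := by linarith
    rw [h7] at h3
    have h8 : (x - #A) * #B ≤ (1 - p + γ) * x * #B :=
      mul_le_mul_of_nonneg_right (by linarith) (Nat.cast_nonneg _)
    have h9 : γ * x * #B ≤ γ * x * x := mul_le_mul_of_nonneg_left leY (by positivity)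
    have h10 : (#E : ℝ) * (x / 4) ≤ #E * (#B - β * x) := by
      refine mul_le_mul_of_nonneg_left ?_ (Nat.cast_nonneg _)
      have := mul_le_mul_of_nonneg_right hβ1 hx.le
      linarith
    have h11 : (#E : ℝ) * (x / 4) ≤ 8 * γ * x * (x / 4) := by nlinarith
    exact le_of_mul_le_mul_right h11 (by positivity)
  have s3 : (#A : ℝ) ≤ (p + 3 * γ) * x := by
    by_contra! hc
    have h1 : (#B : ℝ) * (#A - p * x) ≤ eAB G B A := by
      refine card_mul_le_eAB fun v hv => ?_
      have h2 := hY v (hB hv)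
      have h3 := degIn_le_add_card_sdiff (G := G) v X A
      have h4 := cast_card_sdiff_add hA
      linarith
    rw [eAB_comm] at h1
    have h2 : x / 3 * (#A - p * x) ≤ #B * (#A - p * x) :=
      mul_le_mul_of_nonneg_right bB (by nlinarith)
    have h3 : x / 3 * (3 * γ * x) < x / 3 * (#A - p * x) :=
      mul_lt_mul_of_pos_left (by linarith) (by positivity)
    nlinarith
  have a1 : (#(lowDeg G X B (β * x)) : ℝ) ≤ #A + #(lowDeg G X B (β * x) \ A) := by
    have := card_le_card_sdiff_add_card (s := lowDeg G X B (β * x)) (t := A)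
    rw [add_comm]
    exact_mod_cast this
  have a2 : (#A : ℝ) ≤ #(lowDeg G X B (β * x)) + #(A \ lowDeg G X B (β * x)) := by
    have := card_le_card_sdiff_add_card (s := A) (t := lowDeg G X B (β * x))
    rw [add_comm]
    exact_mod_cast this
  have t1 : 100 * γ * x ≤ β * θ * x := mul_le_mul_of_nonneg_right hγ1 hx.le
  exact ⟨s1, s2, by linarith, by linarith⟩

lemma SparsePair.miss (h : SparsePair G X Y A B p x β θ) {v : V}
    (hv : v ∈ lowDeg G Y A (β * x)) :
    (#(X \ lowDeg G X B (β * x)) : ℝ) ≤ degIn G v (X \ lowDeg G X B (β * x)) + 2 * β * x := by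
  obtain ⟨-, h2, h3, -⟩ := h.lowDeg_card
  obtain ⟨e1, e2, e3⟩ := h.small
  obtain ⟨hvY, hvA⟩ := mem_filter.1 hv
  have hsub : lowDeg G X B (β * x) ⊆ X := filter_subset _ _
  have h4 := degIn_sdiff_add (G := G) v hsub
  have h5 := cast_card_sdiff_add hsub
  have h6 := degIn_le_add_card_sdiff (G := G) v (lowDeg G X B (β * x)) A
  have h7 := h.degY v hvY
  rw [h.cardX] at h5
  linarith [h.pos, mul_pos h.beta_pos h.pos]

lemma SparsePair.le_degIn (h : SparsePair G X Y A B p x β θ) {v : V}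
    (hv : v ∈ X \ lowDeg G X B (β * x)) : β / 2 * x ≤ degIn G v (lowDeg G Y A (β * x)) := by
  obtain ⟨h1, -, -, -⟩ := h.swap.lowDeg_card
  obtain ⟨e1, e2, e3⟩ := h.small
  have h2 : β * x < degIn G v B := by
    by_contra! hc
    exact (mem_sdiff.1 hv).2 (mem_filter.2 ⟨(mem_sdiff.1 hv).1, hc⟩)
  have h3 := degIn_le_add_card_sdiff (G := G) v B (lowDeg G Y A (β * x))
  linarith [mul_pos h.beta_pos h.pos]

lemma SparsePair.card_bad (h : SparsePair G X Y A B p x β θ) :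
    (#((X \ lowDeg G X B (β * x)).filter fun v =>
      (degIn G v (lowDeg G Y A (β * x)) : ℝ) + 2 * β * x < #(lowDeg G Y A (β * x))) : ℝ) ≤
      2 * θ * x := by
  obtain ⟨-, a2, a3, -⟩ := h.lowDeg_card
  obtain ⟨-, b2, -, -⟩ := h.swap.lowDeg_card
  obtain ⟨e1, e2, e3⟩ := h.small
  have hβ := h.beta_pos
  have hx := h.pos
  set A' := lowDeg G X B (β * x)
  set B' := lowDeg G Y A (β * x)
  have hA' : A' ⊆ X := filter_subset _ _
  have hB' : B' ⊆ Y := filter_subset _ _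
  set F := (X \ A').filter fun v => (degIn G v B' : ℝ) + 2 * β * x < #B' with hF
  have hFX : F ⊆ X \ A' := filter_subset _ _
  have leX : (#A' : ℝ) ≤ x := by rw [← h.cardX]; exact_mod_cast card_le_card hA'
  have leY : (#B' : ℝ) ≤ x := by rw [← h.cardY]; exact_mod_cast card_le_card hB'
  have leA : (#A : ℝ) ≤ x := by rw [← h.cardX]; exact_mod_cast card_le_card h.subA
  have h1 : (#B' : ℝ) * ((1 - p) * x) ≤ eAB G B' X := card_mul_le_eAB fun v hv => h.degY v (hB' hv)
  have h2 : (eAB G F B' : ℝ) ≤ #F * (#B' - 2 * β * x) := eAB_le_card_mul fun v hv => by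
    have := (mem_filter.1 hv).2
    linarith
  have h3 : (eAB G ((X \ A') \ F) B' : ℝ) ≤ #((X \ A') \ F) * #B' := by exact_mod_cast eAB_le _ _
  have h4 : (eAB G X B' : ℝ) ≤ eAB G A' B' + (eAB G F B' + eAB G ((X \ A') \ F) B') := by
    have e1 : X = A' ∪ (F ∪ (X \ A') \ F) := by
      rw [union_sdiff_of_subset hFX, union_sdiff_of_subset hA']
    have e2 : eAB G X B' ≤ eAB G A' B' + (eAB G F B' + eAB G ((X \ A') \ F) B') := by
      conv_lhs => rw [e1]
      exact (eAB_union_le _ _ _).trans (Nat.add_le_add_left (eAB_union_le _ _ _) _)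
    exact_mod_cast e2
  have h5 : (eAB G A' B' : ℝ) ≤ 17 * (β ^ 2 * θ) * x ^ 2 := by
    have i1 : eAB G A' B' ≤ eAB G A B' + eAB G (A' \ A) B' :=
      (eAB_mono (by rw [union_sdiff_self_eq_union]; exact subset_union_right) Subset.rfl).trans
        (eAB_union_le A (A' \ A) B')
    have i2 : eAB G A B' ≤ eAB G A B + eAB G A (B' \ B) := by
      rw [eAB_comm A, eAB_comm A, eAB_comm A]
      exact (eAB_mono (by rw [union_sdiff_self_eq_union]; exact subset_union_right)
        Subset.rfl).trans (eAB_union_le B (B' \ B) A)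
    have i3 : (eAB G (A' \ A) B' : ℝ) ≤ #(A' \ A) * #B' := by exact_mod_cast eAB_le _ _
    have i4 : (eAB G A (B' \ B) : ℝ) ≤ #A * #(B' \ B) := by exact_mod_cast eAB_le _ _
    have i5 : (#(A' \ A) : ℝ) * #B' ≤ 8 * (β ^ 2 * θ) * x * x :=
      mul_le_mul a2 leY (Nat.cast_nonneg _) ((Nat.cast_nonneg _).trans a2)
    have i6 : (#A : ℝ) * #(B' \ B) ≤ x * (8 * (β ^ 2 * θ) * x) :=
      mul_le_mul leA b2 (Nat.cast_nonneg _) hx.le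
    have i7 : (eAB G A' B' : ℝ) ≤ eAB G A B' + eAB G (A' \ A) B' := by exact_mod_cast i1
    have i8 : (eAB G A B' : ℝ) ≤ eAB G A B + eAB G A (B' \ B) := by exact_mod_cast i2
    linarith [h.edges]
  have h6 := cast_card_sdiff_add hFX
  have h7 := cast_card_sdiff_add hA'
  rw [h.cardX] at h7
  rw [eAB_comm] at h1
  have h8 : (#((X \ A') \ F) : ℝ) = x - #A' - #F := by linarith
  rw [h8] at h3
  have h9 : (x - #A' - (1 - p) * x) * #B' ≤ (2 * (β * θ) * x) * #B' :=
    mul_le_mul_of_nonneg_right (by linarith) (Nat.cast_nonneg _)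
  have hθ := h.theta_pos
  have h10 : (2 * (β * θ) * x) * #B' ≤ (2 * (β * θ) * x) * x :=
    mul_le_mul_of_nonneg_left leY (by positivity)
  have h11 := mul_le_mul_of_nonneg_right e1 hx.le
  have h12 : (#F : ℝ) * (2 * β * x) ≤ 2 * θ * x * (2 * β * x) := by
    have : 0 ≤ β * θ * x * x := by positivity
    linarith
  exact le_of_mul_le_mul_right h12 (by positivity)

end LowDeg

lemma SparsePair.split {A B : Finset V} {β θ : ℝ} {c : ℕ} (hc : 0 < c)
    (h : SparsePair G X Y A B ((w : ℝ) / c) n β θ) :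
    Split G X Y (lowDeg G X B (β * n)) (lowDeg G Y A (β * n))
      ((X \ lowDeg G X B (β * n)).filter fun v =>
        (degIn G v (lowDeg G Y A (β * n)) : ℝ) + 2 * β * n < #(lowDeg G Y A (β * n)))
      ((Y \ lowDeg G Y A (β * n)).filter fun v =>
        (degIn G v (lowDeg G X B (β * n)) : ℝ) + 2 * β * n < #(lowDeg G X B (β * n)))
      (w * n / c) (⌈2 * θ * n⌉₊ + 1) ⌈2 * β * n⌉₊ ⌈β / 2 * n⌉₊ := by
  have hc' : (0 : ℝ) < c := Nat.cast_pos.2 hc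
  have hN1 : ((w * n / c : ℕ) : ℝ) ≤ (w : ℝ) / c * n := by
    have : (c : ℝ) * (w * n / c : ℕ) ≤ w * n := by exact_mod_cast Nat.mul_div_le (w * n) c
    rw [div_mul_eq_mul_div, le_div_iff₀ hc']
    linarith
  have hN2 : (w : ℝ) / c * n ≤ (w * n / c : ℕ) + 1 := by
    have : (w * n : ℝ) ≤ c * ((w * n / c : ℕ) + 1) := by
      exact_mod_cast (Nat.lt_mul_div_succ (w * n) hc).le
    rw [div_mul_eq_mul_div, div_le_iff₀ hc']
    linarith
  have hz := Nat.le_ceil (2 * θ * (n : ℝ))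
  have hm := Nat.le_ceil (2 * β * (n : ℝ))
  obtain ⟨e1, e2, e3⟩ := h.small
  have hθ := mul_pos h.theta_pos h.pos
  obtain ⟨-, -, a3, a4⟩ := h.lowDeg_card
  obtain ⟨-, -, b3, b4⟩ := h.swap.lowDeg_card
  have up : ∀ k : ℕ, (k : ℝ) ≤ ((w : ℝ) / c + 2 * (β * θ)) * n →
      k ≤ w * n / c + (⌈2 * θ * (n : ℝ)⌉₊ + 1) := fun k hk => by
    have : (k : ℝ) ≤ ((w * n / c + (⌈2 * θ * (n : ℝ)⌉₊ + 1) : ℕ) : ℝ) := by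
      push_cast
      linarith
    exact_mod_cast this
  have lo : ∀ k : ℕ, ((w : ℝ) / c - 2 * (β * θ)) * n ≤ k →
      w * n / c ≤ k + (⌈2 * θ * (n : ℝ)⌉₊ + 1) := fun k hk => by
    have : ((w * n / c : ℕ) : ℝ) ≤ ((k + (⌈2 * θ * (n : ℝ)⌉₊ + 1) : ℕ) : ℝ) := by
      push_cast
      linarith
    exact_mod_cast this
  have toNat : ∀ i j : ℕ, (i : ℝ) ≤ j + 2 * β * n → i ≤ j + ⌈2 * β * (n : ℝ)⌉₊ := fun i j hij => by
    have : (i : ℝ) ≤ ((j + ⌈2 * β * (n : ℝ)⌉₊ : ℕ) : ℝ) := by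
      push_cast
      linarith
    exact_mod_cast this
  have bad : ∀ k : ℕ, (k : ℝ) ≤ 2 * θ * n → k ≤ ⌈2 * θ * (n : ℝ)⌉₊ + 1 := fun k hk =>
    Nat.le_succ_of_le (by exact_mod_cast hk.trans hz)
  refine ⟨filter_subset _ _, filter_subset _ _, filter_subset _ _, filter_subset _ _, up _ a4,
    lo _ a3, up _ b4, lo _ b3, bad _ h.card_bad, bad _ h.swap.card_bad, ?_,
    fun v hv => toNat _ _ (h.miss hv), ?_, fun v hv => toNat _ _ (h.swap.miss hv), ?_, ?_⟩
  · intro v hv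
    obtain ⟨h1, h2⟩ := mem_sdiff.1 hv
    refine toNat _ _ ?_
    by_contra! h3
    exact h2 (mem_filter.2 ⟨h1, h3⟩)
  · intro v hv
    obtain ⟨h1, h2⟩ := mem_sdiff.1 hv
    refine toNat _ _ ?_
    by_contra! h3
    exact h2 (mem_filter.2 ⟨h1, h3⟩)
  · exact fun v hv => Nat.ceil_le.2 (h.le_degIn (mem_filter.1 hv).1)
  · exact fun v hv => Nat.ceil_le.2 (h.swap.le_degIn (mem_filter.1 hv).1)

/-- In the extremal case there is a tiling missing fewer than `8 (u + w) ^ 2` vertices. -/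
theorem exists_tiled_of_extremal (hu : 1 ≤ u) (huw : u ≤ w) :
    ∃ γ : ℝ, 0 < γ ∧ ∃ n0 : ℕ, ∀ n ≥ n0, ∀ {V : Type} (G : SimpleGraph V) (X Y : Finset V),
      Bal G X Y u w n → Extremal G X Y u w γ n →
        ∃ R ⊆ X ∪ Y, Tiled G X Y u w R ∧ #((X ∪ Y) \ R) < 8 * (u + w) ^ 2 := by
  obtain ⟨c, hc⟩ : ∃ c, c = u + w := ⟨_, rfl⟩
  have hc2 : (2 : ℝ) ≤ c := by
    have : 2 ≤ c := by omega
    exact_mod_cast this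
  have hc0 : (0 : ℝ) < c := by linarith
  have hcr : (u : ℝ) + w = c := by rw [hc]; push_cast; rfl
  obtain ⟨β, hβ⟩ : ∃ β : ℝ, β = 1 / (1000 * (c : ℝ) ^ 4) := ⟨_, rfl⟩
  obtain ⟨θ, hθ⟩ : ∃ θ : ℝ, θ = β / (16 * c) := ⟨_, rfl⟩
  have hβ0 : 0 < β := by rw [hβ]; positivity
  have hθ0 : 0 < θ := by rw [hθ]; positivity
  have hc4 : (1 : ℝ) ≤ (c : ℝ) ^ 3 := one_le_pow₀ (by linarith)
  have hβc : β * (c : ℝ) ^ 3 * c = 1 / 1000 := by rw [hβ]; field_simp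
  have hθc : θ * c = β / 16 := by rw [hθ]; field_simp
  have hβ1 : β * c ≤ 1 / 1000 := by
    have := mul_le_mul_of_nonneg_left hc4 (mul_pos hβ0 hc0).le
    linarith
  have hβ2 : β ≤ 1 / 100 := by
    have := mul_le_mul_of_nonneg_left hc2 hβ0.le
    linarith
  have hθβ : θ ≤ β := by
    have := mul_le_mul_of_nonneg_left hc2 hθ0.le
    linarith
  refine ⟨β ^ 2 * θ, by positivity, 24000 * c ^ 5, fun n hn V G X Y hB hE => ?_⟩
  obtain ⟨A, hA, B, hB', cA, cB, he⟩ := hE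
  rw [hcr] at cA cB
  have hn' : 24000 * (c : ℝ) ^ 5 ≤ n := by exact_mod_cast hn
  have hn0 : (0 : ℝ) < n := lt_of_lt_of_le (by positivity) hn'
  have hp : (1 : ℝ) - w / c = u / c := by
    field_simp
    linarith
  have hu1 : (1 : ℝ) ≤ u := by exact_mod_cast hu
  have hw1 : (u : ℝ) ≤ w := by exact_mod_cast huw
  have deg : ∀ k : ℕ, u * n ≤ (u + w) * k → (1 - (w : ℝ) / c) * n ≤ k := fun k hk => by
    rw [hp, div_mul_eq_mul_div, div_le_iff₀ hc0, ← hcr]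
    have : (u * n : ℝ) ≤ (u + w) * k := by exact_mod_cast hk
    linarith
  have h : SparsePair G X Y A B ((w : ℝ) / c) n β θ :=
    ⟨by rw [div_le_div_iff₀ two_pos hc0]; linarith, by rw [div_le_one hc0]; linarith, hβ0, hβ2, hθ0,
      hθβ.trans hβ2, hn0, by rw [hB.cardX], by rw [hB.cardY], fun v hv => deg _ (hB.degX v hv),
      fun v hv => deg _ (hB.degY v hv), hA, hB', cA, cB, he⟩
  have hc0' : 0 < c := by omega
  have hS := h.split hc0'
  have hz := (Nat.ceil_lt_add_one (show 0 ≤ 2 * θ * (n : ℝ) by positivity)).le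
  have hm := (Nat.ceil_lt_add_one (show 0 ≤ 2 * β * (n : ℝ) by positivity)).le
  have hK : ((60 * (u + w) ^ 3 * (⌈2 * β * (n : ℝ)⌉₊ + (⌈2 * θ * (n : ℝ)⌉₊ + 1) + 1) : ℕ) : ℝ) ≤
      (1 / c - 2 * (β * θ)) * n := by
    have i1 : (60 : ℝ) * (c : ℝ) ^ 3 * (⌈2 * β * (n : ℝ)⌉₊ + (⌈2 * θ * (n : ℝ)⌉₊ + 1) + 1) ≤
        60 * (c : ℝ) ^ 3 * (4 * β * n + 4) := by
      refine mul_le_mul_of_nonneg_left ?_ (by positivity)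
      have := mul_le_mul_of_nonneg_right hθβ hn0.le
      linarith
    have i2 : (60 * (c : ℝ) ^ 3 * (4 * β * n + 4)) * c ≤ 1 / 2 * n := by
      have j1 : (60 * (c : ℝ) ^ 3 * (4 * β * n + 4)) * c =
        240 * (β * (c : ℝ) ^ 3 * c) * n + 240 * (c : ℝ) ^ 4 := by ring
      have j2 : (c : ℝ) ^ 4 * 2 ≤ (c : ℝ) ^ 4 * c := mul_le_mul_of_nonneg_left hc2 (by positivity)
      rw [j1, hβc]
      linarith
    have i3 : (2 * (β * θ)) * n * c ≤ 1 / 2 * n := by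
      have j1 : (2 * (β * θ)) * n * c = 2 * (β * n) * (θ * c) := by ring
      rw [j1, hθc]
      have j2 : β * β ≤ 1 * 1 := mul_le_mul (by linarith) (by linarith) hβ0.le zero_le_one
      have j3 := mul_le_mul_of_nonneg_right j2 hn0.le
      linarith
    push_cast
    rw [hcr]
    refine i1.trans ?_
    have i4 : (1 / (c : ℝ) - 2 * (β * θ)) * n * c = n - (2 * (β * θ)) * n * c := by
      field_simp
    refine le_of_mul_le_mul_right ?_ hc0
    rw [i4]
    linarith
  have hsmall : (1 : ℝ) / c ≤ u / c := div_le_div_of_nonneg_right hu1 hc0.le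
  have hsmall' : (u : ℝ) / c ≤ w / c := div_le_div_of_nonneg_right hw1 hc0.le
  obtain ⟨-, -, a3, a4⟩ := h.lowDeg_card
  obtain ⟨-, -, b3, b4⟩ := h.swap.lowDeg_card
  have s1 : ∀ k : ℕ, ((w : ℝ) / c - 2 * (β * θ)) * n ≤ k →
      60 * (u + w) ^ 3 * (⌈2 * β * (n : ℝ)⌉₊ + (⌈2 * θ * (n : ℝ)⌉₊ + 1) + 1) ≤ k := fun k hk => by
    have := mul_le_mul_of_nonneg_right (hsmall.trans hsmall') hn0.le
    exact_mod_cast (show _ ≤ (k : ℝ) from hK.trans (by linarith))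
  have s2 : ∀ Z Z' : Finset V, #Z = n → Z' ⊆ Z → (#Z' : ℝ) ≤ ((w : ℝ) / c + 2 * (β * θ)) * n →
      60 * (u + w) ^ 3 * (⌈2 * β * (n : ℝ)⌉₊ + (⌈2 * θ * (n : ℝ)⌉₊ + 1) + 1) ≤ #(Z \ Z') :=
    fun Z Z' hZ hZ' hk => by
      have h1 := mul_le_mul_of_nonneg_right hsmall hn0.le
      have h2 := cast_card_sdiff_add hZ'
      rw [hZ] at h2
      rw [← hp] at h1
      exact_mod_cast (show _ ≤ (#(Z \ Z') : ℝ) from hK.trans (by linarith))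
  refine hS.exists_tiled_of_bal hB hu huw ?_ ?_ ?_ le_rfl (s1 _ a3) (s1 _ b3)
    (s2 _ _ hB.cardX (filter_subset _ _) a4) (s2 _ _ hB.cardY (filter_subset _ _) b4)
  · rw [← hc]
    exact Nat.mul_div_le _ _
  · rw [← hc, ← Nat.mul_succ]
    exact Nat.lt_mul_div_succ _ hc0'
  · have h1 : ((2 * w + 1 : ℕ) : ℝ) ≤ 2 * c := by
      rw [← hcr]; push_cast; linarith
    have h2 : ((⌈2 * θ * (n : ℝ)⌉₊ + 1 + 1 : ℕ) : ℝ) ≤ 2 * θ * n + 3 := by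
      push_cast; linarith
    have h3 : (2 * c : ℝ) * (2 * θ * n + 3) ≤ β / 2 * n := by
      have j1 : (2 * c : ℝ) * (2 * θ * n + 3) = 4 * (θ * c) * n + 6 * c := by ring
      have j2 : 24 * (c : ℝ) ≤ β * n := by
        have := mul_le_mul_of_nonneg_left hn' hβ0.le
        have j3 : β * (24000 * (c : ℝ) ^ 5) = 24000 * (β * (c : ℝ) ^ 3 * c) * c := by ring
        rw [j3, hβc] at this
        linarith
      rw [j1, hθc]
      linarith
    have h4 : (((2 * w + 1) * (⌈2 * θ * (n : ℝ)⌉₊ + 1 + 1) : ℕ) : ℝ) ≤ ⌈β / 2 * (n : ℝ)⌉₊ := by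
      rw [Nat.cast_mul]
      exact (mul_le_mul h1 h2 (Nat.cast_nonneg _) (by positivity)).trans
        (h3.trans (Nat.le_ceil _))
    exact_mod_cast h4

lemma Proper2Coloring.not {H : SimpleGraph α} {c : α → Bool} (hc : Proper2Coloring H c) : Proper2Coloring H fun v => !c v :=
  fun a b hab h => hc hab (by simpa using h)

section Assembly

variable [Fintype α] {H : SimpleGraph α} {c : α → Bool}

lemma colorCard_add (c : α → Bool) : colorCard c true + colorCard c false = Fintype.card α := by
  unfold colorCard
  rw [← card_univ, ← card_filter_add_card_filter_not (s := univ) (fun v => c v = true)]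
  simp only [Bool.not_eq_true]

lemma Proper2Coloring.exists_copy {P Q : Finset V} (hc : Proper2Coloring H c)
    (hP : #P = colorCard c true) (hQ : #Q = colorCard c false) (hd : Disjoint P Q)
    (hJ : Joined G P Q) : ∃ f : α → V, IsCopy H G f ∧ univ.image f = P ∪ Q := by
  let e₁ := equivOfCardEq hP.symm
  let e₂ := equivOfCardEq hQ.symm
  have m₁ : ∀ v, c v = true → v ∈ univ.filter fun v => c v = true := fun v hv => by simpa using hv
  have m₂ : ∀ v, ¬ c v = true → v ∈ univ.filter fun v => c v = false := fun v hv => by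
    simpa using hv
  let f : α → V := fun v => if hv : c v = true then e₁ ⟨v, m₁ v hv⟩ else e₂ ⟨v, m₂ v hv⟩
  have f₁ : ∀ v (hv : c v = true), f v = e₁ ⟨v, m₁ v hv⟩ := fun v hv => dif_pos hv
  have f₂ : ∀ v (hv : ¬ c v = true), f v = e₂ ⟨v, m₂ v hv⟩ := fun v hv => dif_neg hv
  have fP : ∀ v, c v = true → f v ∈ P := fun v hv => by rw [f₁ v hv]; exact coe_mem _
  have fQ : ∀ v, ¬ c v = true → f v ∈ Q := fun v hv => by rw [f₂ v hv]; exact coe_mem _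
  have inj : Function.Injective f := by
    intro a b hab
    by_cases ha : c a = true <;> by_cases hb : c b = true
    · rw [f₁ a ha, f₁ b hb] at hab
      simpa using e₁.injective (Subtype.ext hab)
    · exact absurd hab (disjoint_iff_ne.1 hd _ (fP a ha) _ (fQ b hb))
    · exact absurd hab.symm (disjoint_iff_ne.1 hd _ (fP b hb) _ (fQ a ha))
    · rw [f₂ a ha, f₂ b hb] at hab
      simpa using e₂.injective (Subtype.ext hab)
  refine ⟨f, ⟨inj, fun a b hab => ?_⟩, ?_⟩
  · have := hc hab
    by_cases ha : c a = true <;> by_cases hb : c b = true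
    · exact absurd (ha.trans hb.symm) this
    · exact hJ _ (fP a ha) _ (fQ b hb)
    · exact (hJ _ (fP b hb) _ (fQ a ha)).symm
    · rw [Bool.not_eq_true] at ha hb
      exact absurd (ha.trans hb.symm) this
  · refine eq_of_subset_of_card_le (fun y hy => ?_) ?_
    · obtain ⟨v, -, rfl⟩ := mem_image.1 hy
      by_cases hv : c v = true
      · exact mem_union_left _ (fP v hv)
      · exact mem_union_right _ (fQ v hv)
    · rw [card_image_of_injective _ inj, card_union_of_disjoint hd, hP, hQ, colorCard_add, card_univ]

lemma colorCard_not (c : α → Bool) (i : Bool) : colorCard (fun v => !c v) i = colorCard c (!i) := by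
  unfold colorCard
  congr 1
  ext v
  cases i <;> simp

lemma Tiled.exists_tiling [Fintype V] {R : Finset V} (hc : Proper2Coloring H c)
    (hu : colorCard c true = u) (hw : colorCard c false = w) (hXY : Disjoint X Y)
    (h : Tiled G X Y u w R) : ∃ s : Finset (α → V), IsHTiling H G s ∧ coveredSet s = R := by
  induction h with
  | nil => exact ⟨∅, ⟨by simp, by simp⟩, by simp [coveredSet]⟩
  | cons P Q A hP hQ hPQ hJ hd _ ih =>
    obtain ⟨s, ⟨h1, h2⟩, hs⟩ := ih
    have hPQd : Disjoint P Q := disjoint_of_subset_left hP (disjoint_of_subset_right hQ hXY)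
    obtain ⟨f, hf, hfi⟩ : ∃ f : α → V, IsCopy H G f ∧ univ.image f = P ∪ Q := by
      rcases hPQ with ⟨hp, hq⟩ | ⟨hp, hq⟩
      · exact hc.exists_copy (hp.trans hu.symm) (hq.trans hw.symm) hPQd hJ
      · exact hc.not.exists_copy (by rw [colorCard_not, hp, ← hw]; rfl)
          (by rw [colorCard_not, hq, ← hu]; rfl) hPQd hJ
    have ne : ∀ g ∈ s, ∀ a b, f a ≠ g b := fun g hg a b =>
      disjoint_iff_ne.1 hd _ (hfi ▸ mem_image_of_mem f (mem_univ a)) _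
        (hs ▸ mem_biUnion.2 ⟨g, hg, mem_image_of_mem g (mem_univ b)⟩)
    refine ⟨insert f s, ⟨fun g hg => ?_, fun g hg g' hg' hne a b => ?_⟩, ?_⟩
    · rcases mem_insert.1 hg with rfl | hg
      · exact hf
      · exact h1 g hg
    · rcases mem_insert.1 hg with e | hs₁ <;> rcases mem_insert.1 hg' with e' | hs₂
      · exact absurd (e.trans e'.symm) hne
      · exact e ▸ ne g' hs₂ a b
      · exact e' ▸ (ne g hs₁ b a).symm
      · exact h2 g hs₁ g' hs₂ hne a b
    · unfold coveredSet at hs ⊢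
      rw [biUnion_insert, hs, hfi]

lemma exists_sigmaBip_coloring (hbip : IsBip H) :
    ∃ c, Proper2Coloring H c ∧ colorCard c true = sigmaBip H ∧
      sigmaBip H ≤ colorCard c false := by
  obtain ⟨c₀, hc₀⟩ := hbip
  have hmem := Nat.sInf_mem (s := {k | ∃ c : α → Bool, Proper2Coloring H c ∧
    k = min (colorCard c true) (colorCard c false)}) ⟨_, c₀, hc₀, rfl⟩
  obtain ⟨c, hc, hk⟩ := hmem
  change sigmaBip H = _ at hk
  rcases le_total (colorCard c true) (colorCard c false) with h | h
  · rw [min_eq_left h] at hk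
    exact ⟨c, hc, hk.symm, hk ▸ h⟩
  · rw [min_eq_right h] at hk
    refine ⟨_, hc.not, ?_, ?_⟩
    · rw [colorCard_not, hk]; rfl
    · rw [colorCard_not, hk]; exact h

lemma BipartiteWith.bal [Fintype V] (hG : BipartiteWith G X Y) (hX : #X = n) (hY : #Y = n)
    (h0 : 0 < u + w) (hdeg : ∀ v : V, ((u : ℝ) / (u + w : ℕ)) * n ≤ G.degree v) :
    Bal G X Y u w n := by
  have h0' : (0 : ℝ) < (u + w : ℕ) := Nat.cast_pos.2 h0
  have key : ∀ (v : V) (Z : Finset V), (∀ y, G.Adj v y → y ∈ Z) →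
      u * n ≤ (u + w) * degIn G v Z := by
    intro v Z hZ
    have h1 : G.degree v ≤ degIn G v Z := card_le_card fun y hy => by
      have := (G.mem_neighborFinset v y).1 hy
      exact mem_filter.2 ⟨hZ y this, this⟩
    have h2 := hdeg v
    rw [div_mul_eq_mul_div, div_le_iff₀ h0'] at h2
    have h3 : u * n ≤ G.degree v * (u + w) := by exact_mod_cast h2
    exact h3.trans (by rw [mul_comm]; exact Nat.mul_le_mul_left _ h1)
  refine ⟨hG.disj, hX, hY, fun x hx => key x Y fun y hy => ?_, fun x hx => key x X fun y hy => ?_⟩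
  · rcases hG.cross hy with h | h
    · exact h.2
    · exact absurd h.1 (disjoint_left.1 hG.disj hx)
  · rcases hG.cross hy with h | h
    · exact absurd hx (disjoint_left.1 hG.disj h.1)
    · exact h.2

lemma exists_tiled_of_bal (hu : 1 ≤ u) (huw : u ≤ w) : ∃ n0 : ℕ, ∀ n ≥ n0, ∀ {V : Type}
    (G : SimpleGraph V) (X Y : Finset V), Bal G X Y u w n →
      ∃ R ⊆ X ∪ Y, Tiled G X Y u w R ∧ #((X ∪ Y) \ R) < 8 * (u + w) ^ 2 := by
  obtain ⟨γ, hγ, n₁, h₁⟩ := exists_tiled_of_extremal hu huw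
  obtain ⟨n₂, h₂⟩ := tiled_or_extremal hu huw hγ
  refine ⟨max n₁ n₂, fun n hn V G X Y hB => ?_⟩
  rcases h₂ n (le_of_max_le_right hn) G X Y hB with h | h
  · exact h
  · exact h₁ n (le_of_max_le_left hn) G X Y hB h

lemma exists_tiled_zero (hw : 0 < w) (hXY : Disjoint X Y) :
    ∃ R ⊆ X ∪ Y, Tiled G X Y 0 w R ∧ #((X ∪ Y) \ R) < 8 * (0 + w) ^ 2 := by
  obtain ⟨P, hP, hPc⟩ := exists_subset_card_eq (Nat.div_mul_le_self #X w)
  obtain ⟨Q, hQ, hQc⟩ := exists_subset_card_eq (Nat.div_mul_le_self #Y w)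
  have hPT : Tiled G X Y 0 w (P ∪ ∅) := tiled_of_joined hXY hP (empty_subset _)
    (fun _ _ y hy => absurd hy (notMem_empty y)) 0 (#X / w) (by simpa using hPc) (by simp)
  have hQT : Tiled G X Y 0 w (∅ ∪ Q) := tiled_of_joined hXY (empty_subset _) hQ
    (fun x hx => absurd hx (notMem_empty x)) (#Y / w) 0 (by simp) (by simpa using hQc)
  rw [union_empty] at hPT
  rw [empty_union] at hQT
  have hPQ : Disjoint P Q := disjoint_of_subset_left hP (disjoint_of_subset_right hQ hXY)
  refine ⟨P ∪ Q, union_subset_union hP hQ, hPT.union hQT hPQ, ?_⟩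
  rw [card_sdiff_of_subset (union_subset_union hP hQ), card_union_of_disjoint hXY,
    card_union_of_disjoint hPQ, hPc, hQc]
  have h1 := Nat.lt_div_mul_add (a := #X) hw
  have h2 := Nat.lt_div_mul_add (a := #Y) hw
  have h3 : w ≤ w ^ 2 := Nat.le_self_pow two_ne_zero w
  rw [zero_add]
  omega

end Assembly

end Tiling

/-- Theorem 1.5. Let `H` be a bipartite graph of order `h`. There exist
integers `n₀` and `c₂ < 8h²` such that every balanced bipartite graph `G` with `n ≥ n₀`
vertices in each partition set and `δ(G) ≥ (1 - 1/χ_cr(H))n = (σ(H)/h)n` contains an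
`H`-tiling covering all but at most `c₂` vertices. -/
theorem statement_3 {α : Type*} [Fintype α] (H : SimpleGraph α) (h : ℕ)
    (hh : Fintype.card α = h) (h0 : 0 < h) (hbip : IsBip H) :
    ∃ n₀ c₂ : ℕ, c₂ < 8 * h ^ 2 ∧
      ∀ (V : Type) [Fintype V], ∀ (G : SimpleGraph V) (X Y : Finset V) (n : ℕ),
        n₀ ≤ n → BipartiteWith G X Y → X.card = n → Y.card = n →
        (∀ v : V, ((sigmaBip H : ℝ) / h) * n ≤ G.degree v) →
        HasHTilingMissingAtMost H G c₂ := by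
  obtain ⟨c, hc, hcu, hle⟩ := exists_sigmaBip_coloring hbip
  set u := sigmaBip H
  obtain ⟨w, hw⟩ : ∃ w, colorCard c false = w := ⟨_, rfl⟩
  have huw : h = u + w := by rw [← hh, ← colorCard_add c, hcu, hw]
  subst huw
  rw [hw] at hle
  obtain ⟨n₀, key⟩ : ∃ n₀ : ℕ, ∀ n ≥ n₀, ∀ {V : Type} (G : SimpleGraph V) (X Y : Finset V),
      Bal G X Y u w n → ∃ R ⊆ X ∪ Y, Tiled G X Y u w R ∧ #((X ∪ Y) \ R) < 8 * (u + w) ^ 2 := by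
    rcases Nat.eq_zero_or_pos u with hu | hu
    · rw [hu]
      exact ⟨0, fun n _ V G X Y hB => exists_tiled_zero (by omega) hB.disj⟩
    · exact exists_tiled_of_bal hu hle
  have hpos : 0 < 8 * (u + w) ^ 2 := by positivity
  refine ⟨n₀, 8 * (u + w) ^ 2 - 1, Nat.sub_lt hpos one_pos, ?_⟩
  intro V _ G X Y n hn hG hX hY hdeg
  obtain ⟨R, -, hT, hR⟩ := key n hn G X Y (hG.bal hX hY h0 hdeg)
  obtain ⟨s, hs, hsR⟩ := hT.exists_tiling hc hcu hw hG.disj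
  refine ⟨s, hs, ?_⟩
  rw [hsR, ← hG.cover]
  exact Nat.le_pred_of_lt hR

end BipTiling
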